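/- arXiv:2111.07381 — 4 statements merged into one kernel-verified Lean document; each statement's English description precedes it below -/
import Mathlib

section
/- Time-localization estimate (Lemma 2.23). Let γ₁′, γ₁, γ₂ ∈ (−1/2, 0) with γ₁′ < γ₁, and let χ̃: ℝ → ℝ be smooth and compactly supported. Then there is a constant C, depending only on γ₁′, γ₁, γ₂ and χ̃, such that for every τ > 0 and every C_b^∞ function F: ℝ² → ℝ, ‖(u,v) ↦ χ̃((u−v)/τ)·F(u,v)‖_{C_u^{γ₁′}C_v^{γ₂}} ≤ C τ^{γ₁−γ₁′} ‖F‖_{C_u^{γ₁}C_v^{γ₂}}. -/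
noncomputable section

open Real MeasureTheory
open scoped ENNReal Classical NNReal

/-- A function between real normed spaces is `C_b^∞`: it is smooth and it together with all of
its iterated derivatives is bounded. -/
def CbSmooth {E F : Type*} [NormedAddCommGroup E] [NormedSpace ℝ E]
    [NormedAddCommGroup F] [NormedSpace ℝ F] (f : E → F) : Prop :=
  ContDiff ℝ (⊤ : ℕ∞) f ∧ ∀ n : ℕ, ∃ C : ℝ, ∀ x : E, ‖iteratedFDeriv ℝ n f x‖ ≤ C

/-- An admissible Littlewood–Paley cutoff: a smooth even `[0,1]`-valued function which is `≡ 1`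
on `{|ξ| ≤ 7/8}` and vanishes on `{|ξ| ≥ 9/8}`. -/
structure IsLPCutoff (ρ : ℝ → ℝ) : Prop where
  smooth : ContDiff ℝ (⊤ : ℕ∞) ρ
  nonneg : ∀ ξ, 0 ≤ ρ ξ
  le_one : ∀ ξ, ρ ξ ≤ 1
  even : ∀ ξ, ρ (-ξ) = ρ ξ
  eq_one : ∀ ξ : ℝ, |ξ| ≤ 7 / 8 → ρ ξ = 1
  eq_zero : ∀ ξ : ℝ, 9 / 8 ≤ |ξ| → ρ ξ = 0

/-- The Littlewood–Paley symbol `ρ_N` at the dyadic scale `N = 2 ^ k`. -/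
def lpSymbol (ρ : ℝ → ℝ) : ℕ → ℝ → ℝ
  | 0 => ρ
  | k + 1 => fun ξ => ρ (ξ / 2 ^ (k + 1)) - ρ (2 * ξ / 2 ^ (k + 1))

/-- The inverse Fourier transform `(2π)^{-1/2} ∫ e^{ixξ} g(ξ) dξ` of a real even function,
written as a cosine transform. -/
def invFourier (g : ℝ → ℝ) (x : ℝ) : ℝ :=
  (Real.sqrt (2 * Real.pi))⁻¹ * ∫ ξ : ℝ, Real.cos (x * ξ) * g ξ

/-- The Littlewood–Paley convolution kernel `ρ̌_N`, `N = 2 ^ k`. -/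
def lpKernel (ρ : ℝ → ℝ) (k : ℕ) : ℝ → ℝ :=
  invFourier (lpSymbol ρ k)

/-- The Littlewood–Paley projection `P_N f = ρ̌_N ∗ f`, `N = 2 ^ k`. -/
def LP (ρ : ℝ → ℝ) (k : ℕ) (f : ℝ → ℝ) (x : ℝ) : ℝ :=
  ∫ y : ℝ, lpKernel ρ k y * f (x - y)

/-- The Littlewood–Paley projection in the first variable. -/
def LPu (ρ : ℝ → ℝ) (k : ℕ) (F : ℝ × ℝ → ℝ) (p : ℝ × ℝ) : ℝ :=
  ∫ y : ℝ, lpKernel ρ k y * F (p.1 - y, p.2)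

/-- The Littlewood–Paley projection in the second variable. -/
def LPv (ρ : ℝ → ℝ) (k : ℕ) (F : ℝ × ℝ → ℝ) (p : ℝ × ℝ) : ℝ :=
  ∫ y : ℝ, lpKernel ρ k y * F (p.1, p.2 - y)

/-- The Hölder norm `‖f‖_{C^γ} = sup_N N^γ ‖P_N f‖_{L^∞}`, valued in `[0,∞]`. -/
def hNorm (ρ : ℝ → ℝ) (γ : ℝ) (f : ℝ → ℝ) : ℝ≥0∞ :=
  ⨆ k : ℕ, ENNReal.ofReal (((2 : ℝ) ^ k) ^ γ) * ⨆ x : ℝ, ENNReal.ofReal |LP ρ k f x|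

/-- The product Hölder norm `‖F‖_{C_u^{γ₁} C_v^{γ₂}}`, valued in `[0,∞]`. -/
def hNorm2 (ρ : ℝ → ℝ) (γ₁ γ₂ : ℝ) (F : ℝ × ℝ → ℝ) : ℝ≥0∞ :=
  ⨆ k₁ : ℕ, ⨆ k₂ : ℕ,
    ENNReal.ofReal (((2 : ℝ) ^ k₁) ^ γ₁ * ((2 : ℝ) ^ k₂) ^ γ₂) *
      ⨆ p : ℝ × ℝ, ENNReal.ofReal |LPu ρ k₁ (LPv ρ k₂ F) p|

/-- `2 ^ k₁ ∼ 2 ^ k₂`: comparable dyadic scales. -/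
def DClose (k₁ k₂ : ℕ) : Prop :=
  (2 : ℝ) ^ k₂ / 2 ^ 10 < (2 : ℝ) ^ k₁ ∧ (2 : ℝ) ^ k₁ < 2 ^ 10 * (2 : ℝ) ^ k₂

/-- `2 ^ k₁ ≪ 2 ^ k₂`. -/
def DLow (k₁ k₂ : ℕ) : Prop := (2 : ℝ) ^ k₁ ≤ (2 : ℝ) ^ k₂ / 2 ^ 10

/-- `2 ^ k₁ ≳ 2 ^ k₂`. -/
def DGtr (k₁ k₂ : ℕ) : Prop := (2 : ℝ) ^ k₂ ≤ 2 ^ 10 * (2 : ℝ) ^ k₁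


abbrev XX := BoundedContinuousFunction (ℝ × ℝ) ℝ

lemma conv_integrable {a : ℝ → ℝ} (ha : Integrable a) (e : ℝ × ℝ) (H : XX) (p : ℝ × ℝ) :
    Integrable (fun y => a y * H (p - y • e)) := by
  refine ha.mul_bdd (c := ‖H‖) ?_ (Filter.Eventually.of_forall fun y => H.norm_coe_le_norm _)
  exact (by fun_prop : Continuous fun y : ℝ => H (p - y • e)).aestronglyMeasurable

lemma conv_bound {a : ℝ → ℝ} (ha : Integrable a) (e : ℝ × ℝ) (H : XX) (p : ℝ × ℝ) :
    ‖∫ y, a y * H (p - y • e)‖ ≤ (∫ y, |a y|) * ‖H‖ := by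
  refine (norm_integral_le_integral_norm _).trans ?_
  rw [← integral_mul_const]
  refine integral_mono (conv_integrable ha e H p).norm (ha.abs.mul_const _) fun y => ?_
  simp only [norm_mul, Real.norm_eq_abs]
  exact mul_le_mul_of_nonneg_left (H.norm_coe_le_norm _) (abs_nonneg _)

/-- Convolution with `a` in the direction `e` -/
def conv (a : ℝ → ℝ) (ha : Integrable a) (e : ℝ × ℝ) : Module.End ℝ XX where
  toFun H := BoundedContinuousFunction.ofNormedAddCommGroup (fun p => ∫ y, a y * H (p - y • e))
    (by
      refine continuous_of_dominated (bound := fun y => |a y| * ‖H‖)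
        (fun p => (conv_integrable ha e H p).aestronglyMeasurable)
        (fun p => Filter.Eventually.of_forall fun y => ?_) (ha.abs.mul_const _)
        (Filter.Eventually.of_forall fun y => by fun_prop)
      simp only [norm_mul, Real.norm_eq_abs]
      exact mul_le_mul_of_nonneg_left (H.norm_coe_le_norm _) (abs_nonneg _))
    ((∫ y, |a y|) * ‖H‖) (fun p => conv_bound ha e H p)
  map_add' H H' := by
    ext p
    simp only [BoundedContinuousFunction.coe_ofNormedAddCommGroup, BoundedContinuousFunction.coe_add,
      Pi.add_apply, mul_add]
    exact integral_add (conv_integrable ha e H p) (conv_integrable ha e H' p)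
  map_smul' r H := by
    ext p
    simp only [BoundedContinuousFunction.coe_ofNormedAddCommGroup, BoundedContinuousFunction.coe_smul,
      smul_eq_mul, RingHom.id_apply]
    rw [← integral_const_mul]
    congr 1; ext y; ring

lemma conv_apply {a : ℝ → ℝ} (ha : Integrable a) (e : ℝ × ℝ) (H : XX) (p : ℝ × ℝ) :
    conv a ha e H p = ∫ y, a y * H (p - y • e) := rfl

lemma conv_norm {a : ℝ → ℝ} (ha : Integrable a) (e : ℝ × ℝ) (H : XX) :
    ‖conv a ha e H‖ ≤ (∫ y, |a y|) * ‖H‖ := by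
  refine (BoundedContinuousFunction.norm_le (by positivity)).2 fun p => conv_bound ha e H p

lemma conv_comm {a b : ℝ → ℝ} (ha : Integrable a) (hb : Integrable b) (e e' : ℝ × ℝ) :
    Commute (conv a ha e) (conv b hb e') := by
  ext H p
  simp only [Module.End.mul_apply, conv_apply, ← integral_const_mul]
  rw [integral_integral_swap]
  · congr 1; ext y; congr 1; ext z
    rw [sub_right_comm]; ring
  · have : Integrable (fun q : ℝ × ℝ => (a q.1 * b q.2) * H (p - q.1 • e - q.2 • e'))
        (volume.prod volume) := by
      refine (ha.mul_prod hb).mul_bdd (c := ‖H‖) ?_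
        (Filter.Eventually.of_forall fun y => H.norm_coe_le_norm _)
      exact (by fun_prop : Continuous fun q : ℝ × ℝ => H (p - q.1 • e - q.2 • e')).aestronglyMeasurable
    refine this.congr (Filter.Eventually.of_forall fun q => ?_)
    simp [Function.uncurry]; ring

/-- admissible test functions in the plane -/
structure Gd (G : ℝ × ℝ → ℝ) (B : ℝ) : Prop where
  cont : Continuous G
  bdd : ∃ C, ∀ p, |G p| ≤ C
  int : Integrable G
  le : ∫ p, |G p| ≤ B

lemma Gd.add {G G' : ℝ × ℝ → ℝ} {B B' : ℝ} (h : Gd G B) (h' : Gd G' B') :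
    Gd (fun p => G p + G' p) (B + B') := by
  obtain ⟨C, hC⟩ := h.bdd
  obtain ⟨C', hC'⟩ := h'.bdd
  refine ⟨h.cont.add h'.cont, ⟨C + C', fun p => (abs_add_le _ _).trans (add_le_add (hC p) (hC' p))⟩,
    h.int.add h'.int, ?_⟩
  refine le_trans ?_ (add_le_add h.le h'.le)
  rw [← integral_add h.int.abs h'.int.abs]
  exact integral_mono (h.int.add h'.int).abs (h.int.abs.add h'.int.abs) fun p => abs_add_le _ _

lemma Gd.neg {G : ℝ × ℝ → ℝ} {B : ℝ} (h : Gd G B) : Gd (fun p => - G p) B := by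
  obtain ⟨C, hC⟩ := h.bdd
  exact ⟨h.cont.neg, ⟨C, fun p => by simpa using hC p⟩, h.int.neg, by simpa using h.le⟩

lemma Gd.mono {G : ℝ × ℝ → ℝ} {B B' : ℝ} (h : Gd G B) (h' : B ≤ B') : Gd G B' :=
  ⟨h.cont, h.bdd, h.int, h.le.trans h'⟩

lemma Gd.mulH {G : ℝ × ℝ → ℝ} {B : ℝ} (h : Gd G B) (H : XX) : Integrable fun p => G p * H p :=
  h.int.mul_bdd (c := ‖H‖) H.continuous.aestronglyMeasurable
    (Filter.Eventually.of_forall fun y => H.norm_coe_le_norm _)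

lemma Gd.pair {G : ℝ × ℝ → ℝ} {B : ℝ} (h : Gd G B) (H : XX) : |∫ p, G p * H p| ≤ B * ‖H‖ := by
  refine (norm_integral_le_integral_norm (fun p => G p * H p)).trans ?_
  refine le_trans ?_ (mul_le_mul_of_nonneg_right h.le (norm_nonneg _))
  rw [← integral_mul_const]
  refine integral_mono (h.mulH H).norm (h.int.abs.mul_const _) fun y => ?_
  simp only [norm_mul, Real.norm_eq_abs]
  exact mul_le_mul_of_nonneg_left (H.norm_coe_le_norm _) (abs_nonneg _)

lemma Gd.transpose_aux {G : ℝ × ℝ → ℝ} {B : ℝ} (h : Gd G B) (H : XX) {a : ℝ → ℝ} (ha : Integrable a)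
    (e : ℝ × ℝ) : 
    Integrable (fun p => (∫ y, a y * G (p + y • e)) * H p) ∧
    ∫ p, G p * conv a ha e H p = ∫ p, (∫ y, a y * G (p + y • e)) * H p := by
  have h1 : Integrable (fun q : (ℝ × ℝ) × ℝ => G q.1 * (a q.2 * H (q.1 - q.2 • e)))
      (volume.prod volume) := by
    have : Integrable (fun q : (ℝ × ℝ) × ℝ => (G q.1 * a q.2) * H (q.1 - q.2 • e))
        (volume.prod volume) := by
      refine (h.int.mul_prod ha).mul_bdd (c := ‖H‖) ?_
        (Filter.Eventually.of_forall fun y => H.norm_coe_le_norm _)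
      exact (by fun_prop : Continuous fun q : (ℝ × ℝ) × ℝ => H (q.1 - q.2 • e)).aestronglyMeasurable
    refine this.congr (Filter.Eventually.of_forall fun q => ?_)
    simp only []; ring
  have h2 : Integrable (fun q : (ℝ × ℝ) × ℝ => a q.2 * G (q.1 + q.2 • e) * H q.1)
      (volume.prod volume) := by
    have hs : Integrable (fun q : (ℝ × ℝ) × ℝ => a q.2 * G (q.1 + q.2 • e))
      (volume.prod volume) := by
      have hm : AEStronglyMeasurable (fun q : (ℝ × ℝ) × ℝ => a q.2 * G (q.1 + q.2 • e))
          (volume.prod volume) := by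
        refine AEStronglyMeasurable.mul ha.aestronglyMeasurable.comp_snd ?_
        exact (h.cont.comp (by fun_prop : Continuous fun q : (ℝ × ℝ) × ℝ =>
          (q.1 + q.2 • e))).aestronglyMeasurable
      refine (integrable_prod_iff' hm).2 ⟨Filter.Eventually.of_forall fun y =>
        (h.int.comp_add_right (y • e)).const_mul (a y), ?_⟩
      simp only [norm_mul, Real.norm_eq_abs]
      simp_rw [integral_const_mul, integral_add_right_eq_self (fun p => |G p|)]
      exact ha.abs.mul_const _
    refine hs.mul_bdd (c := ‖H‖) ?_ (Filter.Eventually.of_forall fun y => H.norm_coe_le_norm _)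
    exact (by fun_prop : Continuous fun q : (ℝ × ℝ) × ℝ => H q.1).aestronglyMeasurable
  refine ⟨by simpa only [integral_mul_const] using h2.integral_prod_left, ?_⟩
  simp_rw [conv_apply, ← integral_const_mul, ← integral_mul_const]
  rw [integral_integral_swap h1]
  symm
  rw [integral_integral_swap h2]
  symm
  congr 1; ext y
  rw [← integral_add_right_eq_self _ (y • e)]
  congr 1; ext p
  simp; ring

lemma Gd.transpose {G : ℝ × ℝ → ℝ} {B : ℝ} (h : Gd G B) (H : XX) {a : ℝ → ℝ} (ha : Integrable a)
    (e : ℝ × ℝ) : ∫ p, G p * conv a ha e H p = ∫ p, (∫ y, a y * G (p + y • e)) * H p :=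
  (h.transpose_aux H ha e).2

open scoped SchwartzMap FourierTransform in
lemma exists_kernel {ρ : ℝ → ℝ} (hρ : IsLPCutoff ρ) :
    ∃ φ : 𝓢(ℝ, ℝ), (∀ x, invFourier ρ x = √(2 * π) * φ x) ∧ ∫ x, φ x = 1 := by
  have hpi : (0 : ℝ) < 2 * π := by positivity
  have hsq : √(2 * π) * √(2 * π) = 2 * π := Real.mul_self_sqrt hpi.le
  have hs0 : √(2 * π) ≠ 0 := (Real.sqrt_pos.2 hpi).ne'
  have hc : HasCompactSupport (fun x => (ρ x : ℂ)) := by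
    refine HasCompactSupport.of_support_subset_isCompact (isCompact_Icc (a := -(9/8 : ℝ)) (b := 9/8)) ?_
    intro x hx
    by_contra h
    apply hx
    simp only [Complex.ofReal_eq_zero]
    apply hρ.eq_zero
    by_contra h'
    exact h (abs_le.1 (not_le.1 h').le)
  have hsm : ContDiff ℝ (⊤ : ℕ∞) (fun x => (ρ x : ℂ)) := Complex.ofRealCLM.contDiff.comp hρ.smooth
  let r : 𝓢(ℝ, ℂ) := hc.toSchwartzMap hsm
  have hr : ∀ x, r x = (ρ x : ℂ) := fun x => rfl
  let f : 𝓢(ℝ, ℂ) := 𝓕 r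
  let L : ℝ ≃L[ℝ] ℝ := ContinuousLinearEquiv.smulLeft (Units.mk0 ((2 * π)⁻¹) (by positivity))
  have hL : ∀ x, L x = (2 * π)⁻¹ * x := fun x => rfl
  let φ : 𝓢(ℝ, ℝ) := (2 * π)⁻¹ • SchwartzMap.compCLMOfContinuousLinearEquiv ℝ L
    (SchwartzMap.postcompCLM (𝕜 := ℝ) Complex.reCLM f)
  have hφ : ∀ x, φ x = (2 * π)⁻¹ * (f ((2 * π)⁻¹ * x)).re := fun x => rfl
  have hf : ∀ w, f w = ∫ v : ℝ, Complex.exp (↑(-2 * π * v * w) * Complex.I) • r v := by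
    intro w
    change (𝓕 (r : ℝ → ℂ)) w = _
    rw [Real.fourier_real_eq_integral_exp_smul]
  have hfre : ∀ w, (f w).re = ∫ v : ℝ, Real.cos (2 * π * v * w) * ρ v := by
    intro w
    rw [hf]
    have hint : Integrable (fun v : ℝ => Complex.exp (↑(-2 * π * v * w) * Complex.I) • r v) := by
      refine r.integrable.bdd_mul (c := 1) (by fun_prop) (Filter.Eventually.of_forall fun v => ?_)
      rw [Complex.norm_exp_ofReal_mul_I]
    have := integral_re (𝕜 := ℂ) hint
    simp only [RCLike.re_to_complex] at this
    rw [← this]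
    congr 1; ext v
    rw [hr, smul_eq_mul, Complex.re_mul_ofReal, Complex.exp_ofReal_mul_I_re]
    congr 1
    rw [← Real.cos_neg]; congr 1; ring
  refine ⟨φ, fun x => ?_, ?_⟩
  · rw [hφ, hfre, invFourier]
    have : (√(2 * π))⁻¹ = √(2 * π) * (2 * π)⁻¹ := by
      rw [eq_mul_inv_iff_mul_eq₀ hpi.ne', inv_mul_eq_iff_eq_mul₀ hs0, hsq]
    rw [this, mul_assoc]
    congr 3; ext ξ
    congr 2
    field_simp
  · simp_rw [hφ]
    rw [integral_const_mul, Measure.integral_comp_mul_left (fun x => (f x).re)]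
    have := integral_re (𝕜 := ℂ) (f.integrable (μ := volume))
    simp only [RCLike.re_to_complex] at this
    rw [this]
    have h0 : ∫ x, f x = 1 := by
      have h1 : (𝓕⁻ f) = r := FourierTransform.fourierInv_fourier_eq r
      have h2 : (𝓕⁻ f) 0 = 1 := by rw [h1, hr, hρ.eq_one 0 (by norm_num)]; simp
      rw [SchwartzMap.fourierInv_coe, Real.fourierInv_eq] at h2
      simpa using h2
    rw [h0, abs_of_pos (by positivity)]
    simp; field_simp

open scoped SchwartzMap Topology in
/-- The kernel of `(1 - S) ∂⁻¹`. -/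
lemma exists_psi (φ : 𝓢(ℝ, ℝ)) (h1 : ∫ x, φ x = 1) :
    ∃ Ψ : ℝ → ℝ, Integrable Ψ ∧ ∀ g g' : ℝ → ℝ, (∀ x, HasDerivAt g (g' x) x) → Continuous g' →
      (∃ C, ∀ x, |g x| ≤ C) → (∃ C, ∀ x, |g' x| ≤ C) →
      g 0 - ∫ y, φ y * g y = - ∫ s, Ψ s * g' s := by
  have hφi : Integrable φ := φ.integrable
  let P : ℝ → ℝ := fun s => ∫ y in Set.Iic s, φ y
  have hPd : ∀ s, HasDerivAt P (φ s) s := by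
    intro s
    have : P = fun s => (∫ y in (0:ℝ)..s, φ y) + P 0 := by
      ext s
      have := intervalIntegral.integral_Iic_sub_Iic (μ := volume) (a := 0) (b := s)
        hφi.integrableOn hφi.integrableOn
      simp only [P]; linarith
    rw [this]
    exact (intervalIntegral.integral_hasDerivAt_right (hφi.intervalIntegrable)
      (φ.continuous.stronglyMeasurableAtFilter _ _) φ.continuous.continuousAt).add_const _
  have hP1 : ∀ s, P s - 1 = - ∫ y in Set.Ioi s, φ y := by
    intro s
    have := intervalIntegral.integral_Iic_add_Ioi (μ := volume) (b := s)
        hφi.integrableOn hφi.integrableOn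
    rw [h1] at this
    simp only [P]; linarith
  have hw : Integrable (fun y => (1 + y ^ 2) * |φ y|) := by
    have h2 := φ.integrable_pow_mul volume 2
    have := hφi.abs.add h2
    refine this.congr (Filter.Eventually.of_forall fun y => ?_)
    simp; ring
  set Cw := ∫ y, (1 + y ^ 2) * |φ y| with hCw
  have hgen : ∀ (A : Set ℝ) (s : ℝ), MeasurableSet A → (∀ y ∈ A, s ^ 2 ≤ y ^ 2) →
      |∫ y in A, φ y| ≤ Cw * (1 + s ^ 2)⁻¹ := by
    intro A s hA hAs
    rw [← div_eq_mul_inv, le_div_iff₀ (by positivity)]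
    calc |∫ y in A, φ y| * (1 + s ^ 2) ≤ (∫ y in A, |φ y|) * (1 + s ^ 2) := by
          gcongr; exact abs_integral_le_integral_abs
      _ = ∫ y in A, |φ y| * (1 + s ^ 2) := (integral_mul_const _ _).symm
      _ ≤ ∫ y in A, (1 + y ^ 2) * |φ y| := by
          refine setIntegral_mono_on (hφi.abs.mul_const _).integrableOn hw.integrableOn hA
            fun y hy => ?_
          rw [mul_comm]
          gcongr ?_ * _
          linarith [hAs y hy]
      _ ≤ Cw := setIntegral_le_integral hw (Filter.Eventually.of_forall fun y => by positivity)
  have hPneg : ∀ s ≤ 0, |P s| ≤ Cw * (1 + s ^ 2)⁻¹ := fun s hs =>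
    hgen _ s measurableSet_Iic fun y hy => by
      have : y ≤ s := hy
      nlinarith
  have hPpos : ∀ s ≥ 0, |1 - P s| ≤ Cw * (1 + s ^ 2)⁻¹ := fun s hs => by
    have : 1 - P s = ∫ y in Set.Ioi s, φ y := by linarith [hP1 s]
    rw [this]
    refine hgen _ s measurableSet_Ioi fun y hy => ?_
    have : s < y := hy
    nlinarith
  have hPc : Continuous P := continuous_iff_continuousAt.2 fun x => (hPd x).continuousAt
  let Ψ : ℝ → ℝ := fun s => if s ≤ 0 then - P s else 1 - P s
  have hΨb : ∀ s, |Ψ s| ≤ Cw * (1 + s ^ 2)⁻¹ := by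
    intro s
    by_cases hs : s ≤ 0
    · simpa [Ψ, hs] using hPneg s hs
    · simpa [Ψ, hs] using hPpos s (not_le.1 hs).le
  have hΨi : Integrable Ψ := by
    refine (integrable_inv_one_add_sq.const_mul Cw).mono' ?_ (Filter.Eventually.of_forall hΨb)
    exact (Measurable.ite measurableSet_Iic hPc.measurable.neg
      (measurable_const.sub hPc.measurable)).aestronglyMeasurable
  have hz : Filter.Tendsto (fun s : ℝ => Cw * (1 + s ^ 2)⁻¹) Filter.atTop (𝓝 0) := by
    rw [← mul_zero Cw]
    refine Filter.Tendsto.const_mul _ (Filter.Tendsto.inv_tendsto_atTop ?_)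
    exact Filter.tendsto_atTop_add_const_left _ _ (Filter.tendsto_pow_atTop (by norm_num))
  have hz' : Filter.Tendsto (fun s : ℝ => Cw * (1 + s ^ 2)⁻¹) Filter.atBot (𝓝 0) := by
    have := hz.comp Filter.tendsto_neg_atBot_atTop
    simpa [Function.comp_def] using this
  refine ⟨Ψ, hΨi, fun g g' hg hg'c ⟨C, hC⟩ ⟨C', hC'⟩ => ?_⟩
  have hgc : Continuous g := continuous_iff_continuousAt.2 fun x => (hg x).continuousAt
  have hi1 : Integrable (fun s => Ψ s * g' s) :=
    hΨi.mul_bdd (c := C') hg'c.aestronglyMeasurable (Filter.Eventually.of_forall hC')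
  have hi2 : Integrable (fun s => φ s * g s) :=
    hφi.mul_bdd (c := C) hgc.aestronglyMeasurable (Filter.Eventually.of_forall hC)
  have hC0 : 0 ≤ C := (abs_nonneg _).trans (hC 0)
  have e1 : ∫ s in Set.Iic (0:ℝ), Ψ s * g' s = - P 0 * g 0 - 0 - ∫ s in Set.Iic (0:ℝ), -φ s * g s := by
    have : ∫ s in Set.Iic (0:ℝ), Ψ s * g' s = ∫ s in Set.Iic (0:ℝ), (- P s) * g' s :=
      setIntegral_congr_fun measurableSet_Iic fun s hs => by
        have : s ≤ 0 := hs
        simp [Ψ, this]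
    rw [this]
    refine integral_Iic_mul_deriv_eq_deriv_mul (u := fun s => - P s) (u' := fun s => - φ s)
      (fun x _ => (hPd x).neg) (fun x _ => hg x) ?_ ?_ ?_ ?_
    · refine hi1.integrableOn.congr_fun (fun s hs => ?_) measurableSet_Iic
      have : s ≤ 0 := hs
      simp [Ψ, this]
    · refine (hi2.neg.integrableOn).congr_fun (fun s hs => ?_) measurableSet_Iic
      simp
    · exact ((hPc.neg.mul hgc).tendsto 0).mono_left nhdsWithin_le_nhds
    · refine squeeze_zero_norm' (a := fun s => C * (Cw * (1 + s ^ 2)⁻¹)) ?_ (by simpa using hz'.const_mul C)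
      filter_upwards [Filter.eventually_le_atBot 0] with s hs
      simp only [Pi.mul_apply, norm_mul, norm_neg, Real.norm_eq_abs]
      rw [mul_comm]
      exact mul_le_mul (hC s) (hPneg s hs) (abs_nonneg _) hC0
  have e2 : ∫ s in Set.Ioi (0:ℝ), Ψ s * g' s = 0 - (1 - P 0) * g 0 - ∫ s in Set.Ioi (0:ℝ), -φ s * g s := by
    have : ∫ s in Set.Ioi (0:ℝ), Ψ s * g' s = ∫ s in Set.Ioi (0:ℝ), (1 - P s) * g' s :=
      setIntegral_congr_fun measurableSet_Ioi fun s hs => by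
        have : ¬ s ≤ 0 := not_le.2 hs
        simp [Ψ, this]
    rw [this]
    refine integral_Ioi_mul_deriv_eq_deriv_mul (u := fun s => 1 - P s) (u' := fun s => - φ s)
      (fun x _ => (hPd x).const_sub 1) (fun x _ => hg x) ?_ ?_ ?_ ?_
    · refine hi1.integrableOn.congr_fun (fun s hs => ?_) measurableSet_Ioi
      have : ¬ s ≤ 0 := not_le.2 hs
      simp [Ψ, this]
    · refine (hi2.neg.integrableOn).congr_fun (fun s hs => ?_) measurableSet_Ioi
      simp
    · exact (((continuous_const.sub hPc).mul hgc).tendsto 0).mono_left nhdsWithin_le_nhds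
    · refine squeeze_zero_norm' (a := fun s => C * (Cw * (1 + s ^ 2)⁻¹)) ?_ (by simpa using hz.const_mul C)
      filter_upwards [Filter.eventually_ge_atTop 0] with s hs
      simp only [Pi.mul_apply, norm_mul, Real.norm_eq_abs]
      rw [mul_comm]
      exact mul_le_mul (hC s) (hPpos s hs) (abs_nonneg _) hC0
  have s1 := intervalIntegral.integral_Iic_add_Ioi (μ := volume) (b := 0)
    hi1.integrableOn hi1.integrableOn
  have s2 := intervalIntegral.integral_Iic_add_Ioi (μ := volume) (b := 0)
    hi2.integrableOn hi2.integrableOn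
  rw [← s1, ← s2, e1, e2]
  simp only [neg_mul, integral_neg]
  ring

/-- Rescaled integration by parts -/
lemma psi_scale {φ Ψ : ℝ → ℝ} (hΨ : ∀ g g' : ℝ → ℝ, (∀ x, HasDerivAt g (g' x) x) → Continuous g' →
      (∃ C, ∀ x, |g x| ≤ C) → (∃ C, ∀ x, |g' x| ≤ C) →
      g 0 - ∫ y, φ y * g y = - ∫ s, Ψ s * g' s) {l : ℝ} (hl : 0 < l)
    (g g' : ℝ → ℝ) (hg : ∀ x, HasDerivAt g (g' x) x) (hg' : Continuous g')
    (hb : ∃ C, ∀ x, |g x| ≤ C) (hb' : ∃ C, ∀ x, |g' x| ≤ C) :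
    g 0 - ∫ y, (l * φ (l * y)) * g y = - ∫ s, Ψ (l * s) * g' s := by
  obtain ⟨C, hC⟩ := hb
  obtain ⟨C', hC'⟩ := hb'
  have := hΨ (fun x => g (l⁻¹ * x)) (fun x => l⁻¹ * g' (l⁻¹ * x)) (fun x => by
      have h1 : HasDerivAt (fun x : ℝ => l⁻¹ * x) l⁻¹ x := by
        simpa using (hasDerivAt_id x).const_mul l⁻¹
      have := (hg (l⁻¹ * x)).comp x h1
      rw [mul_comm]; exact this)
    (by fun_prop) ⟨C, fun x => hC _⟩ ⟨l⁻¹ * C', fun x => by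
      rw [abs_mul, abs_of_pos (inv_pos.2 hl)]
      exact mul_le_mul_of_nonneg_left (hC' _) (inv_pos.2 hl).le⟩
  have e1 := Measure.integral_comp_mul_left (fun y => φ y * g (l⁻¹ * y)) l
  have e2 := Measure.integral_comp_mul_left (fun y => Ψ y * (l⁻¹ * g' (l⁻¹ * y))) l
  simp only [inv_mul_cancel_left₀ hl.ne', smul_eq_mul, abs_of_pos (inv_pos.2 hl)] at e1 e2
  rw [eq_inv_mul_iff_mul_eq₀ hl.ne', ← integral_const_mul] at e1 e2
  rw [← e1, ← e2] at this
  simp only [mul_zero] at this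
  have e3 : ∫ y, (l * φ (l * y)) * g y = ∫ (a : ℝ), l * (φ (l * a) * g a) := by
    congr 1; ext y; ring
  have e4 : ∫ s, Ψ (l * s) * g' s = ∫ (a : ℝ), l * (Ψ (l * a) * (l⁻¹ * g' a)) := by
    congr 1; ext y; field_simp
  rw [e3, e4, this]

lemma Gd.ibp {φ Ψ : ℝ → ℝ} (hΨ : ∀ g g' : ℝ → ℝ, (∀ x, HasDerivAt g (g' x) x) → Continuous g' →
      (∃ C, ∀ x, |g x| ≤ C) → (∃ C, ∀ x, |g' x| ≤ C) →
      g 0 - ∫ y, φ y * g y = - ∫ s, Ψ s * g' s) {l : ℝ} (hl : 0 < l)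
    (hφi : Integrable (fun y => l * φ (l * y))) (hΨi : Integrable (fun y => Ψ (l * y)))
    {G G' : ℝ × ℝ → ℝ} {B B' : ℝ} (h : Gd G B) (h' : Gd G' B') (e : ℝ × ℝ)
    (hd : ∀ p (t : ℝ), HasDerivAt (fun t : ℝ => G (p + t • e)) (G' (p + t • e)) t) (H : XX) :
    ∫ p, G p * ((1 - conv _ hφi e : Module.End ℝ XX) H) p = ∫ p, (- G' p) * conv _ hΨi e H p := by
  rw [h'.neg.transpose]
  have : ∫ p, G p * ((1 - conv _ hφi e : Module.End ℝ XX) H) p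
      = (∫ p, G p * H p) - ∫ p, G p * conv _ hφi e H p := by
    rw [← integral_sub (h.mulH H) (h.mulH _)]
    congr 1; ext p
    simp; ring
  rw [this, h.transpose]
  have key : ∀ p, G p - ∫ y, (l * φ (l * y)) * G (p + y • e) = ∫ y, Ψ (l * y) * - G' (p + y • e) := by
    intro p
    obtain ⟨C, hC⟩ := h.bdd
    obtain ⟨C', hC'⟩ := h'.bdd
    have := psi_scale hΨ hl (fun t => G (p + t • e)) (fun t => G' (p + t • e)) (hd p)
      (h'.cont.comp (by fun_prop)) ⟨C, fun x => hC _⟩ ⟨C', fun x => hC' _⟩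
    simp only [zero_smul, add_zero] at this
    rw [this]
    simp [integral_neg]
  simp_rw [← key, sub_mul]
  rw [integral_sub (h.mulH H) (h.transpose_aux H hφi e).1]

/-- Bounds of the type satisfied by an `L¹`-normalized bump at frequency `K`. -/
structure Nice (K A : ℝ) (a : ℝ → ℝ) : Prop where
  cont : Continuous a
  int : Integrable a
  l1 : ∫ x, |a x| ≤ A
  sup : ∀ x, |a x| ≤ A * K

lemma Nice.nonneg {K A : ℝ} {a : ℝ → ℝ} (h : Nice K A a) : 0 ≤ A :=
  (integral_nonneg fun x => abs_nonneg (a x)).trans h.l1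

/-- products `a(u) b(v) c(u-v)` -/
def abc (a b c : ℝ → ℝ) (p : ℝ × ℝ) : ℝ := a p.1 * b p.2 * c (p.1 - p.2)

lemma Nice.gd {K₁ K₂ K₃ A₁ A₂ A₃ : ℝ} {a b c : ℝ → ℝ} (ha : Nice K₁ A₁ a) (hb : Nice K₂ A₂ b)
    (hc : Nice K₃ A₃ c) : Gd (abc a b c) (A₁ * A₂ * A₃ * min K₃ (min K₁ K₂)) := by
  have hA1 := ha.nonneg
  have hA2 := hb.nonneg
  have hA3 := hc.nonneg
  have hac := ha.cont
  have hbc := hb.cont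
  have hcc := hc.cont
  have hcont : Continuous (abc a b c) := by unfold abc; fun_prop
  have hAK1 : 0 ≤ A₁ * K₁ := (abs_nonneg _).trans (ha.sup 0)
  have hAK2 : 0 ≤ A₂ * K₂ := (abs_nonneg _).trans (hb.sup 0)
  have hAK3 : 0 ≤ A₃ * K₃ := (abs_nonneg _).trans (hc.sup 0)
  have habs : ∀ p, |abc a b c p| = |a p.1| * |b p.2| * |c (p.1 - p.2)| := fun p => by
    simp [abc, abs_mul]
  have hab : Integrable (fun p : ℝ × ℝ => |a p.1| * |b p.2|) (volume.prod volume) :=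
    ha.int.abs.mul_prod hb.int.abs
  have hint : Integrable (abc a b c) (volume.prod volume) := by
    refine (ha.int.mul_prod hb.int).mul_bdd (c := A₃ * K₃) ?_
      (Filter.Eventually.of_forall fun p => hc.sup _)
    exact (by fun_prop : Continuous fun p : ℝ × ℝ => c (p.1 - p.2)).aestronglyMeasurable
  refine ⟨hcont, ⟨A₁ * K₁ * (A₂ * K₂) * (A₃ * K₃), fun p => ?_⟩, hint, ?_⟩
  · rw [habs]
    gcongr
    exacts [ha.sup _, hb.sup _, hc.sup _]
  · have b1 : ∫ p, |abc a b c p| ≤ A₁ * A₂ * A₃ * K₃ := by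
      calc ∫ p, |abc a b c p| ≤ ∫ p : ℝ × ℝ, |a p.1| * |b p.2| * (A₃ * K₃) := by
            refine integral_mono hint.abs (hab.mul_const _) fun p => ?_
            simp only [habs]
            gcongr
            exact hc.sup _
        _ = (∫ x, |a x|) * (∫ x, |b x|) * (A₃ * K₃) := by
            rw [integral_mul_const]
            congr 1
            exact integral_prod_mul (fun x => |a x|) (fun x => |b x|)
        _ ≤ A₁ * A₂ * (A₃ * K₃) := by
            gcongr
            exacts [ha.l1, hb.l1]
        _ = _ := by ring
    have b2 : ∫ p, |abc a b c p| ≤ A₁ * A₂ * A₃ * K₁ := by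
      calc ∫ p, |abc a b c p| = ∫ y, ∫ x, |abc a b c (x, y)| :=
            integral_prod_symm (fun p => |abc a b c p|) hint.abs
        _ ≤ ∫ y, (A₁ * K₁ * A₃) * |b y| := by
            refine integral_mono hint.abs.integral_prod_right (hb.int.abs.const_mul _) fun y => ?_
            have hci : Integrable (fun x => |c (x - y)|) := (hc.int.comp_sub_right y).abs
            calc ∫ x, |abc a b c (x, y)| ≤ ∫ x, (A₁ * K₁ * |b y|) * |c (x - y)| := by
                  refine integral_mono_of_nonneg (Filter.Eventually.of_forall fun x => abs_nonneg _)
                    (hci.const_mul _) (Filter.Eventually.of_forall fun x => ?_)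
                  simp only [habs]
                  gcongr
                  exact ha.sup _
              _ = (A₁ * K₁ * |b y|) * ∫ x, |c x| := by
                  rw [integral_const_mul, integral_sub_right_eq_self (fun x => |c x|)]
              _ ≤ (A₁ * K₁ * |b y|) * A₃ := by gcongr; exact hc.l1
              _ = _ := by ring
        _ = (A₁ * K₁ * A₃) * ∫ y, |b y| := integral_const_mul _ _
        _ ≤ (A₁ * K₁ * A₃) * A₂ := by gcongr; exact hb.l1
        _ = _ := by ring
    have b3 : ∫ p, |abc a b c p| ≤ A₁ * A₂ * A₃ * K₂ := by
      calc ∫ p, |abc a b c p| = ∫ x, ∫ y, |abc a b c (x, y)| :=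
            integral_prod (fun p => |abc a b c p|) hint.abs
        _ ≤ ∫ x, (A₂ * K₂ * A₃) * |a x| := by
            refine integral_mono hint.abs.integral_prod_left (ha.int.abs.const_mul _) fun x => ?_
            have hci : Integrable (fun y => |c (x - y)|) := (hc.int.comp_sub_left x).abs
            calc ∫ y, |abc a b c (x, y)| ≤ ∫ y, (|a x| * (A₂ * K₂)) * |c (x - y)| := by
                  refine integral_mono_of_nonneg (Filter.Eventually.of_forall fun x => abs_nonneg _)
                    (hci.const_mul _) (Filter.Eventually.of_forall fun y => ?_)
                  simp only [habs]
                  gcongr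
                  exact hb.sup _
              _ = (|a x| * (A₂ * K₂)) * ∫ x, |c x| := by
                  rw [integral_const_mul, integral_sub_left_eq_self (fun x => |c x|)]
              _ ≤ (|a x| * (A₂ * K₂)) * A₃ := by gcongr; exact hc.l1
              _ = _ := by ring
        _ = (A₂ * K₂ * A₃) * ∫ y, |a y| := integral_const_mul _ _
        _ ≤ (A₂ * K₂ * A₃) * A₁ := by gcongr; exact ha.l1
        _ = _ := by ring
    rcases min_choice K₃ (min K₁ K₂) with h | h
    · rw [h]; exact b1
    · rw [h]
      rcases min_choice K₁ K₂ with h | h <;> rw [h]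
      exacts [b2, b3]

/-- Test functions with control on derivatives. -/
structure TestG (G : ℝ × ℝ → ℝ) (β R₁ R₂ : ℝ) : Prop where
  g : Gd G β
  ex : ∃ Gu Gv Guv : ℝ × ℝ → ℝ, Gd Gu (β * R₁) ∧ Gd Gv (β * R₂) ∧ Gd Guv (β * (R₁ * R₂)) ∧
    (∀ p (t : ℝ), HasDerivAt (fun t : ℝ => G (p + t • ((1, 0) : ℝ × ℝ)))
      (Gu (p + t • ((1, 0) : ℝ × ℝ))) t) ∧
    (∀ p (t : ℝ), HasDerivAt (fun t : ℝ => G (p + t • ((0, 1) : ℝ × ℝ)))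
      (Gv (p + t • ((0, 1) : ℝ × ℝ))) t) ∧
    (∀ p (t : ℝ), HasDerivAt (fun t : ℝ => Gu (p + t • ((0, 1) : ℝ × ℝ)))
      (Guv (p + t • ((0, 1) : ℝ × ℝ))) t)

lemma abc_du {a b c a' c' : ℝ → ℝ} (ha : ∀ x, HasDerivAt a (a' x) x)
    (hc : ∀ x, HasDerivAt c (c' x) x) (p : ℝ × ℝ) (t : ℝ) :
    HasDerivAt (fun t : ℝ => abc a b c (p + t • ((1, 0) : ℝ × ℝ)))
      (abc a' b c (p + t • ((1, 0) : ℝ × ℝ)) + abc a b c' (p + t • ((1, 0) : ℝ × ℝ))) t := by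
  simp only [abc, Prod.fst_add, Prod.snd_add, Prod.smul_fst, Prod.smul_snd, smul_eq_mul, mul_one,
    mul_zero, add_zero]
  have h1 : HasDerivAt (fun t : ℝ => a (p.1 + t)) (a' (p.1 + t)) t := (ha _).comp_const_add _ _
  have h3 : HasDerivAt (fun t : ℝ => c (p.1 + t - p.2)) (c' (p.1 + t - p.2)) t := by
    have := (hc (p.1 - p.2 + t)).comp_const_add (p.1 - p.2) t
    simpa only [sub_add_eq_add_sub] using this
  exact ((h1.mul_const (b p.2)).mul h3)

lemma abc_dv {a b c b' c' : ℝ → ℝ} (hb : ∀ x, HasDerivAt b (b' x) x)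
    (hc : ∀ x, HasDerivAt c (c' x) x) (p : ℝ × ℝ) (t : ℝ) :
    HasDerivAt (fun t : ℝ => abc a b c (p + t • ((0, 1) : ℝ × ℝ)))
      (abc a b' c (p + t • ((0, 1) : ℝ × ℝ)) + -abc a b c' (p + t • ((0, 1) : ℝ × ℝ))) t := by
  simp only [abc, Prod.fst_add, Prod.snd_add, Prod.smul_fst, Prod.smul_snd, smul_eq_mul, mul_one,
    mul_zero, add_zero]
  have h1 : HasDerivAt (fun t : ℝ => b (p.2 + t)) (b' (p.2 + t)) t := (hb _).comp_const_add _ _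
  have h3 : HasDerivAt (fun t : ℝ => c (p.1 - (p.2 + t))) (-c' (p.1 - (p.2 + t))) t := by
    have := (hc (p.1 - p.2 - t)).comp_const_sub (p.1 - p.2) t
    simpa only [sub_sub] using this
  have := ((h1.const_mul (a p.1)).mul h3)
  exact this.congr_deriv (by ring)

lemma testG_abc {K₁ K₂ M A₁ A₂ A₃ : ℝ} {a b c a' b' c' c'' : ℝ → ℝ}
    (ha : Nice K₁ A₁ a) (ha' : Nice K₁ (A₁ * K₁) a')
    (hb : Nice K₂ A₂ b) (hb' : Nice K₂ (A₂ * K₂) b')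
    (hc : Nice M A₃ c) (hc' : Nice M (A₃ * M) c') (hc'' : Nice M (A₃ * M * M) c'')
    (da : ∀ x, HasDerivAt a (a' x) x) (db : ∀ x, HasDerivAt b (b' x) x)
    (dc : ∀ x, HasDerivAt c (c' x) x) (dc' : ∀ x, HasDerivAt c' (c'' x) x) :
    TestG (abc a b c) (A₁ * A₂ * A₃ * min M (min K₁ K₂)) (K₁ + M) (K₂ + M) := by
  refine ⟨ha.gd hb hc, fun p => abc a' b c p + abc a b c' p, fun p => abc a b' c p + -abc a b c' p,
    fun p => (abc a' b' c p + -abc a' b c' p) + (abc a b' c' p + -abc a b c'' p), ?_, ?_, ?_,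
    abc_du da dc, abc_dv db dc, fun p t => (abc_dv db dc p t).add (abc_dv db dc' p t)⟩
  · exact ((ha'.gd hb hc).add (ha.gd hb hc')).mono (le_of_eq (by ring))
  · exact ((ha.gd hb' hc).add (ha.gd hb hc').neg).mono (le_of_eq (by ring))
  · exact (((ha'.gd hb' hc).add (ha'.gd hb hc').neg).add
      ((ha.gd hb' hc').add (ha.gd hb hc'').neg)).mono (le_of_eq (by ring))

/-- The data of the mollifier kernel and its integrated version. -/
structure KD where
  φ : ℝ → ℝ
  Ψ : ℝ → ℝ
  hφ : Integrable φ
  hΨ : Integrable Ψ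
  one : ∫ y, φ y = 1
  mom : Integrable (fun y => |y| * |φ y|)
  ibp : ∀ g g' : ℝ → ℝ, (∀ x, HasDerivAt g (g' x) x) → Continuous g' →
      (∃ C, ∀ x, |g x| ≤ C) → (∃ C, ∀ x, |g' x| ≤ C) →
      g 0 - ∫ y, φ y * g y = - ∫ s, Ψ s * g' s

lemma int_scale {φ : ℝ → ℝ} (h : Integrable φ) (k : ℕ) :
    Integrable (fun y => (2:ℝ) ^ k * φ ((2:ℝ) ^ k * y)) :=
  (h.comp_mul_left' (by positivity)).const_mul _

lemma int_scale' {φ : ℝ → ℝ} (h : Integrable φ) (k : ℕ) :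
    Integrable (fun y => φ ((2:ℝ) ^ k * y)) :=
  (h.comp_mul_left' (by positivity))

namespace KD

variable (D : KD)

def S (e : ℝ × ℝ) : ℕ → Module.End ℝ XX
  | 0 => 0
  | k + 1 => conv _ (int_scale D.hφ k) e

def E (e : ℝ × ℝ) (k : ℕ) : Module.End ℝ XX := conv _ (int_scale' D.hΨ k) e

/-- operator norm constant -/
def κ : ℝ := 1 + (∫ y, |D.φ y|) + 2 * ∫ y, |D.Ψ y|

lemma κ_nonneg : 0 ≤ D.κ := by unfold κ; positivity

lemma S_norm (e : ℝ × ℝ) (n : ℕ) (H : XX) : ‖D.S e n H‖ ≤ (∫ y, |D.φ y|) * ‖H‖ := by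
  cases n with
  | zero => simp only [S, LinearMap.zero_apply, norm_zero]; positivity
  | succ k =>
    refine (conv_norm (int_scale D.hφ k) _ _).trans (le_of_eq ?_)
    simp only [abs_mul, abs_of_pos (show (0:ℝ) < 2 ^ k by positivity)]
    rw [integral_const_mul, Measure.integral_comp_mul_left (fun y => |D.φ y|),
      abs_of_pos (by positivity), smul_eq_mul, mul_inv_cancel_left₀ (by positivity)]

lemma S_norm' (e : ℝ × ℝ) (n : ℕ) (H : XX) : ‖D.S e n H‖ ≤ D.κ * ‖H‖ := by
  refine (D.S_norm e n H).trans ?_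
  gcongr
  unfold κ
  have : 0 ≤ ∫ y, |D.Ψ y| := by positivity
  linarith

lemma D_norm (e : ℝ × ℝ) (n : ℕ) (H : XX) : ‖(1 - D.S e n : Module.End ℝ XX) H‖ ≤ D.κ * ‖H‖ := by
  have h1 : ‖(1 - D.S e n : Module.End ℝ XX) H‖ ≤ ‖H‖ + ‖D.S e n H‖ := norm_sub_le _ _
  have h2 := D.S_norm e n H
  have : 0 ≤ (∫ y, |D.Ψ y|) * ‖H‖ := by positivity
  unfold κ; nlinarith

lemma E_norm (e : ℝ × ℝ) (k : ℕ) (H : XX) : ‖D.E e k H‖ ≤ D.κ / 2 ^ (k + 1) * ‖H‖ := by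
  refine (conv_norm (int_scale' D.hΨ k) _ _).trans ?_
  gcongr
  rw [Measure.integral_comp_mul_left (fun y => |D.Ψ y|), abs_of_pos (by positivity), smul_eq_mul,
    pow_succ, inv_mul_eq_div, div_le_div_iff₀ (by positivity) (by positivity)]
  have : 0 ≤ ∫ y, |D.φ y| := by positivity
  unfold κ
  have h2 : (0:ℝ) < 2 ^ k := by positivity
  nlinarith

lemma S_comm (e e' : ℝ × ℝ) (m n : ℕ) : Commute (D.S e m) (D.S e' n) := by
  cases m with
  | zero => exact Commute.zero_left _
  | succ m =>
    cases n with
    | zero => exact Commute.zero_right _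
    | succ n => exact conv_comm (int_scale D.hφ m) (int_scale D.hφ n) _ _

lemma E_comm (e e' : ℝ × ℝ) (m n : ℕ) : Commute (D.E e m) (D.S e' n) := by
  cases n with
  | zero => exact Commute.zero_right _
  | succ n => exact conv_comm (int_scale' D.hΨ m) (int_scale D.hφ n) _ _

lemma DD_bound {G : ℝ × ℝ → ℝ} {β R₁ R₂ : ℝ} (hG : TestG G β R₁ R₂) (h1 : 1 ≤ R₁) (h2 : 1 ≤ R₂)
    (i j : ℕ) (H : XX) :
    |∫ p, G p * ((1 - D.S (1, 0) i : Module.End ℝ XX) ((1 - D.S (0, 1) j : Module.End ℝ XX) H)) p|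
      ≤ D.κ ^ 2 * β * (min 1 (R₁ / 2 ^ i) * min 1 (R₂ / 2 ^ j)) * ‖H‖ := by
  obtain ⟨g, Gu, Gv, Guv, hu, hv, huv, du, dv, duv⟩ := hG
  have hκ := D.κ_nonneg
  have hβ : 0 ≤ β := (integral_nonneg fun x => abs_nonneg (G x)).trans g.le
  have comm1 : ∀ H : XX, (1 - D.S (1, 0) i : Module.End ℝ XX) ((1 - D.S (0, 1) j : Module.End ℝ XX) H)
      = (1 - D.S (0, 1) j : Module.End ℝ XX) ((1 - D.S (1, 0) i : Module.End ℝ XX) H) := by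
    intro H
    have : D.S (1, 0) i (D.S (0, 1) j H) = D.S (0, 1) j (D.S (1, 0) i H) :=
      congrArg (fun T : Module.End ℝ XX => T H) (D.S_comm (1, 0) (0, 1) i j).eq
    simp only [LinearMap.sub_apply, Module.End.one_apply, map_sub, this]
    abel
  have comm2 : ∀ k, ∀ H : XX, D.E (1, 0) k ((1 - D.S (0, 1) j : Module.End ℝ XX) H)
      = (1 - D.S (0, 1) j : Module.End ℝ XX) (D.E (1, 0) k H) := by
    intro k H
    have : D.E (1, 0) k (D.S (0, 1) j H) = D.S (0, 1) j (D.E (1, 0) k H) :=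
      congrArg (fun T : Module.End ℝ XX => T H) (D.E_comm (1, 0) (0, 1) k j).eq
    simp only [LinearMap.sub_apply, Module.End.one_apply, map_sub, this]
  by_cases hi : (2:ℝ) ^ i ≤ R₁
  · have mi : min 1 (R₁ / 2 ^ i) = 1 := min_eq_left ((one_le_div (by positivity)).2 hi)
    by_cases hj : (2:ℝ) ^ j ≤ R₂
    · have mj : min 1 (R₂ / 2 ^ j) = 1 := min_eq_left ((one_le_div (by positivity)).2 hj)
      rw [mi, mj]
      refine (g.pair _).trans ?_
      calc _ ≤ β * (D.κ * (D.κ * ‖H‖)) := by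
            gcongr
            refine (D.D_norm _ _ _).trans ?_
            gcongr
            exact D.D_norm _ _ _
        _ = _ := by ring
    · have mj : min 1 (R₂ / 2 ^ j) = R₂ / 2 ^ j :=
        min_eq_right ((div_le_one (by positivity)).2 (not_le.1 hj).le)
      rw [mi, mj, comm1]
      cases j with
      | zero => exact absurd (by simpa using h2) hj
      | succ k =>
        simp only [S]
        rw [Gd.ibp D.ibp (by positivity) (int_scale D.hφ k) (int_scale' D.hΨ k) g hv _ dv]
        refine (hv.neg.pair _).trans ?_
        have : 0 ≤ β * R₂ := by positivity
        calc _ ≤ β * R₂ * (D.κ / 2 ^ (k + 1) * (D.κ * ‖H‖)) := by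
              gcongr
              refine (D.E_norm _ _ _).trans ?_
              gcongr
              exact D.D_norm _ _ _
          _ = _ := by ring
  · have mi : min 1 (R₁ / 2 ^ i) = R₁ / 2 ^ i :=
        min_eq_right ((div_le_one (by positivity)).2 (not_le.1 hi).le)
    cases i with
    | zero => exact absurd (by simpa using h1) hi
    | succ k =>
      rw [mi]
      have e1 : ∫ p, G p * ((1 - D.S (1, 0) (k+1) : Module.End ℝ XX) ((1 - D.S (0, 1) j : Module.End ℝ XX) H)) p
        = ∫ p, (- Gu p) * (D.E (1, 0) k ((1 - D.S (0, 1) j : Module.End ℝ XX) H)) p :=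
        Gd.ibp D.ibp (by positivity) (int_scale D.hφ k) (int_scale' D.hΨ k) g hu _ du _
      rw [e1]
      by_cases hj : (2:ℝ) ^ j ≤ R₂
      · have mj : min 1 (R₂ / 2 ^ j) = 1 := min_eq_left ((one_le_div (by positivity)).2 hj)
        rw [mj]
        refine (hu.neg.pair _).trans ?_
        have : 0 ≤ β * R₁ := by positivity
        calc _ ≤ β * R₁ * (D.κ / 2 ^ (k + 1) * (D.κ * ‖H‖)) := by
              gcongr
              refine (D.E_norm _ _ _).trans ?_
              gcongr
              exact D.D_norm _ _ _
          _ = _ := by ring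
      · have mj : min 1 (R₂ / 2 ^ j) = R₂ / 2 ^ j :=
          min_eq_right ((div_le_one (by positivity)).2 (not_le.1 hj).le)
        rw [mj]
        cases j with
        | zero => exact absurd (by simpa using h2) hj
        | succ l =>
          rw [comm2]
          have e2 : ∫ p, (-Gu p) * ((1 - D.S (0, 1) (l+1) : Module.End ℝ XX) (D.E (1, 0) k H)) p
            = ∫ p, (- - Guv p) * (D.E (0, 1) l (D.E (1, 0) k H)) p :=
            Gd.ibp D.ibp (by positivity) (int_scale D.hφ l) (int_scale' D.hΨ l) hu.neg huv.neg _
              (fun p t => (duv p t).neg) _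
          rw [e2]
          refine (huv.neg.neg.pair _).trans ?_
          have : 0 ≤ β * (R₁ * R₂) := by positivity
          calc _ ≤ β * (R₁ * R₂) * (D.κ / 2 ^ (l + 1) * (D.κ / 2 ^ (k + 1) * ‖H‖)) := by
                gcongr
                refine (D.E_norm _ _ _).trans ?_
                gcongr
                exact D.E_norm _ _ _
            _ = _ := by ring

end KD

namespace KD

variable (D : KD)

def P (e : ℝ × ℝ) (i : ℕ) : Module.End ℝ XX := D.S e (i + 1) - D.S e i

def Q (e : ℝ × ℝ) (i : ℕ) : Module.End ℝ XX := (1 - D.S e (i + 1)) + (1 - D.S e i)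

def W (e : ℝ × ℝ) (n : ℕ) : Module.End ℝ XX := D.S e n + D.S e n - D.S e n * D.S e n

lemma P_apply (e : ℝ × ℝ) (i : ℕ) (H : XX) : D.P e i H = D.S e (i + 1) H - D.S e i H := rfl
lemma Q_apply' (e : ℝ × ℝ) (i : ℕ) (H : XX) : D.Q e i H =
  (1 - D.S e (i + 1) : Module.End ℝ XX) H + (1 - D.S e i : Module.End ℝ XX) H := rfl
lemma Q_apply (e : ℝ × ℝ) (i : ℕ) (H : XX) : D.Q e i H =
  (H - D.S e (i + 1) H) + (H - D.S e i H) := rfl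
lemma W_apply (e : ℝ × ℝ) (i : ℕ) (H : XX) : D.W e i H =
  D.S e i H + D.S e i H - D.S e i (D.S e i H) := rfl

lemma S_comm' (e e' : ℝ × ℝ) (m n : ℕ) (H : XX) :
    D.S e m (D.S e' n H) = D.S e' n (D.S e m H) :=
  congrArg (fun T : Module.End ℝ XX => T H) (D.S_comm e e' m n).eq

lemma W_eq (e : ℝ × ℝ) (n : ℕ) (H : XX) :
    D.W e n H = ∑ i ∈ Finset.range n, D.Q e i (D.P e i H) := by
  induction n with
  | zero => simp [W_apply, S]
  | succ n ih =>
    rw [Finset.sum_range_succ, ← ih]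
    simp only [W_apply, Q_apply, P_apply, map_sub, D.S_comm' e e (n + 1) n]
    abel

lemma PQ_comm (e e' : ℝ × ℝ) (i j : ℕ) (H : XX) :
    D.P e i (D.Q e' j H) = D.Q e' j (D.P e i H) := by
  simp only [Q_apply, P_apply, map_sub, map_add, D.S_comm' e' e]
  abel

lemma WW_eq (e e' : ℝ × ℝ) (n : ℕ) (H : XX) : D.W e n (D.W e' n H) =
    ∑ i ∈ Finset.range n, ∑ j ∈ Finset.range n, D.Q e i (D.Q e' j (D.P e i (D.P e' j H))) := by
  rw [W_eq, W_eq]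
  simp only [map_sum, PQ_comm]

lemma W_norm (e : ℝ × ℝ) (n : ℕ) (H : XX) : ‖D.W e n H‖ ≤ (2 * D.κ + D.κ ^ 2) * ‖H‖ := by
  have h1 := D.S_norm' e n H
  have h2 := D.S_norm' e n (D.S e n H)
  have hκ := D.κ_nonneg
  rw [W_apply]
  have h3 := norm_sub_le (D.S e n H + D.S e n H) (D.S e n (D.S e n H))
  have h4 := norm_add_le (D.S e n H) (D.S e n H)
  have h5 := mul_le_mul_of_nonneg_left h1 hκ
  nlinarith

lemma id_sub_W (e : ℝ × ℝ) (n : ℕ) (H : XX) : H - D.W e n H =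
    (1 - D.S e n : Module.End ℝ XX) ((1 - D.S e n : Module.End ℝ XX) H) := by
  simp only [LinearMap.sub_apply, Module.End.one_apply, map_sub, W_apply]
  abel

lemma approx (e : ℝ × ℝ) (F : XX) {L : ℝ} (hL : ∀ p (y : ℝ), |F p - F (p - y • e)| ≤ L * |y|)
    (k : ℕ) : ‖(1 - D.S e (k + 1) : Module.End ℝ XX) F‖ ≤ L * (∫ y, |y| * |D.φ y|) / 2 ^ k := by
  have hL0 : 0 ≤ L := by simpa using (abs_nonneg _).trans (hL 0 1)
  have hm : 0 ≤ ∫ y, |y| * |D.φ y| := by positivity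
  refine (BoundedContinuousFunction.norm_le (by positivity)).2 fun p => ?_
  have hk : (0:ℝ) < 2 ^ k := by positivity
  have hone : ∫ y, (2:ℝ) ^ k * D.φ (2 ^ k * y) = 1 := by
    rw [integral_const_mul, Measure.integral_comp_mul_left, abs_of_pos (by positivity), D.one]
    simp
  have hi := int_scale D.hφ k
  have hmi : Integrable (fun y => |y| * |(2:ℝ) ^ k * D.φ (2 ^ k * y)|) := by
    refine (int_scale' D.mom k).congr (Filter.Eventually.of_forall fun y => ?_)
    simp only [abs_mul, abs_of_pos hk]; ring
  have e1 : ((1 - D.S e (k + 1) : Module.End ℝ XX) F) p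
      = ∫ y, ((2:ℝ) ^ k * D.φ (2 ^ k * y)) * (F p - F (p - y • e)) := by
    simp_rw [mul_sub]
    rw [integral_sub (hi.mul_const _) (conv_integrable hi e F p), integral_mul_const, hone, one_mul]
    rfl
  rw [e1]
  calc _ ≤ ∫ y, L * (|y| * |(2:ℝ) ^ k * D.φ (2 ^ k * y)|) := by
        refine norm_integral_le_of_norm_le (hmi.const_mul _) (Filter.Eventually.of_forall fun y => ?_)
        rw [norm_mul, Real.norm_eq_abs, Real.norm_eq_abs]
        calc _ ≤ |(2:ℝ) ^ k * D.φ (2 ^ k * y)| * (L * |y|) := by gcongr; exact hL p y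
          _ = _ := by ring
    _ = L * ∫ y, |2 ^ k * y| * |D.φ (2 ^ k * y)| := by
        rw [integral_const_mul]
        congr 2; ext y
        simp only [abs_mul, abs_of_pos hk]; ring
    _ = _ := by
        rw [Measure.integral_comp_mul_left (fun y => |y| * |D.φ y|), abs_of_pos (by positivity),
          smul_eq_mul]
        ring

lemma approxWW (e e' : ℝ × ℝ) (F : XX) {L : ℝ} (hL : ∀ p (y : ℝ), |F p - F (p - y • e)| ≤ L * |y|)
    (hL' : ∀ p (y : ℝ), |F p - F (p - y • e')| ≤ L * |y|) (k : ℕ) :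
    ‖F - D.W e (k + 1) (D.W e' (k + 1) F)‖ ≤
      ((1 + 2 * D.κ + D.κ ^ 2) * D.κ * L * (∫ y, |y| * |D.φ y|)) * (1 / 2) ^ k := by
  have hκ := D.κ_nonneg
  have h1 : F - D.W e (k + 1) (D.W e' (k + 1) F) =
      (F - D.W e (k + 1) F) + D.W e (k + 1) (F - D.W e' (k + 1) F) := by
    rw [map_sub]; abel
  rw [h1]
  refine (norm_add_le _ _).trans ?_
  have a1 : ‖F - D.W e (k + 1) F‖ ≤ D.κ * (L * (∫ y, |y| * |D.φ y|) / 2 ^ k) := by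
    rw [id_sub_W]
    refine (D.D_norm _ _ _).trans ?_
    gcongr
    exact D.approx e F hL k
  have a2 : ‖F - D.W e' (k + 1) F‖ ≤ D.κ * (L * (∫ y, |y| * |D.φ y|) / 2 ^ k) := by
    rw [id_sub_W]
    refine (D.D_norm _ _ _).trans ?_
    gcongr
    exact D.approx e' F hL' k
  have a3 := (D.W_norm e (k + 1) (F - D.W e' (k + 1) F)).trans
    (mul_le_mul_of_nonneg_left a2 (by positivity))
  refine (add_le_add a1 a3).trans (le_of_eq ?_)
  rw [one_div, inv_pow]
  ring

lemma QQ_bound {G : ℝ × ℝ → ℝ} {β R₁ R₂ : ℝ} (hG : TestG G β R₁ R₂) (h1 : 1 ≤ R₁) (h2 : 1 ≤ R₂)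
    (i j : ℕ) (H : XX) :
    |∫ p, G p * (D.Q (1, 0) i (D.Q (0, 1) j H)) p|
      ≤ 4 * D.κ ^ 2 * β * (min 1 (R₁ / 2 ^ i) * min 1 (R₂ / 2 ^ j)) * ‖H‖ := by
  have hκ := D.κ_nonneg
  have hβ : 0 ≤ β := (integral_nonneg fun x => abs_nonneg (G x)).trans hG.g.le
  have hadd : ∀ H H' : XX, ∫ p, G p * (H + H') p = (∫ p, G p * H p) + ∫ p, G p * H' p := by
    intro H H'
    rw [← integral_add (hG.g.mulH H) (hG.g.mulH H')]
    congr 1; ext p; simp; ring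
  have key : ∀ i' j', i ≤ i' → j ≤ j' →
      |∫ p, G p * ((1 - D.S (1, 0) i' : Module.End ℝ XX) ((1 - D.S (0, 1) j' : Module.End ℝ XX) H)) p|
      ≤ D.κ ^ 2 * β * (min 1 (R₁ / 2 ^ i) * min 1 (R₂ / 2 ^ j)) * ‖H‖ := by
    intro i' j' hi hj
    refine (D.DD_bound hG h1 h2 i' j' H).trans ?_
    have r1 : 0 ≤ R₁ := by linarith
    have r2 : 0 ≤ R₂ := by linarith
    gcongr <;> norm_num
  rw [Q_apply', Q_apply', map_add, map_add, hadd, hadd, hadd]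
  have k1 := key (i + 1) (j + 1) (by lia) (by lia)
  have k2 := key (i + 1) j (by lia) (by lia)
  have k3 := key i (j + 1) (by lia) (by lia)
  have k4 := key i j (by lia) (by lia)
  refine (abs_add_le _ _).trans ((add_le_add ((abs_add_le _ _).trans (add_le_add k1 k2))
    ((abs_add_le _ _).trans (add_le_add k3 k4))).trans (le_of_eq (by ring)))

lemma main_est {G : ℝ × ℝ → ℝ} {β R₁ R₂ : ℝ} (hG : TestG G β R₁ R₂) (h1 : 1 ≤ R₁) (h2 : 1 ≤ R₂)
    (F : XX) {L : ℝ} (hL : ∀ p (y : ℝ), |F p - F (p - y • ((1, 0) : ℝ × ℝ))| ≤ L * |y|)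
    (hL' : ∀ p (y : ℝ), |F p - F (p - y • ((0, 1) : ℝ × ℝ))| ≤ L * |y|)
    {A X Y : ℝ} (hA : 0 ≤ A) {x y : ℕ → ℝ} (hx : ∀ i, 0 ≤ x i) (hy : ∀ i, 0 ≤ y i)
    (hP : ∀ i j, ‖D.P (1, 0) i (D.P (0, 1) j F)‖ ≤ A * (x i * y j))
    (hX : ∀ n, ∑ i ∈ Finset.range n, min 1 (R₁ / 2 ^ i) * x i ≤ X)
    (hY : ∀ n, ∑ i ∈ Finset.range n, min 1 (R₂ / 2 ^ i) * y i ≤ Y) :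
    |∫ p, G p * F p| ≤ 4 * D.κ ^ 2 * β * A * (X * Y) := by
  have hκ := D.κ_nonneg
  have hβ : 0 ≤ β := (integral_nonneg fun x => abs_nonneg (G x)).trans hG.g.le
  have hX0 : 0 ≤ X := by simpa using hX 0
  have bound : ∀ n, |∫ p, G p * (D.W (1, 0) n (D.W (0, 1) n F)) p| ≤
      4 * D.κ ^ 2 * β * A * (X * Y) := by
    intro n
    have : ∫ p, G p * (D.W (1, 0) n (D.W (0, 1) n F)) p = ∑ i ∈ Finset.range n,
        ∑ j ∈ Finset.range n, ∫ p, G p *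
          (D.Q (1, 0) i (D.Q (0, 1) j (D.P (1, 0) i (D.P (0, 1) j F)))) p := by
      rw [WW_eq]
      simp only [BoundedContinuousFunction.sum_apply, Finset.mul_sum]
      rw [integral_finset_sum _ fun i _ => integrable_finset_sum _ fun j _ => hG.g.mulH _]
      refine Finset.sum_congr rfl fun i _ => ?_
      rw [integral_finset_sum _ fun j _ => hG.g.mulH _]
    rw [this]
    calc _ ≤ ∑ i ∈ Finset.range n, ∑ j ∈ Finset.range n,
          (4 * D.κ ^ 2 * β * A) * ((min 1 (R₁ / 2 ^ i) * x i) * (min 1 (R₂ / 2 ^ j) * y j)) := by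
          refine (Finset.abs_sum_le_sum_abs _ _).trans (Finset.sum_le_sum fun i _ =>
            (Finset.abs_sum_le_sum_abs _ _).trans (Finset.sum_le_sum fun j _ => ?_))
          refine (D.QQ_bound hG h1 h2 i j _).trans ?_
          calc _ ≤ 4 * D.κ ^ 2 * β * (min 1 (R₁ / 2 ^ i) * min 1 (R₂ / 2 ^ j)) * (A * (x i * y j)) := by
                gcongr; exact hP i j
            _ = _ := by ring
      _ = (4 * D.κ ^ 2 * β * A) * ((∑ i ∈ Finset.range n, min 1 (R₁ / 2 ^ i) * x i) *
            (∑ i ∈ Finset.range n, min 1 (R₂ / 2 ^ i) * y i)) := by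
          rw [Finset.sum_mul_sum]; simp only [Finset.mul_sum]
      _ ≤ _ := by
          have : ∀ j, 0 ≤ min 1 (R₂ / 2 ^ j) * y j := fun j => by
            have := hy j
            positivity
          have : 0 ≤ ∑ i ∈ Finset.range n, min 1 (R₂ / 2 ^ i) * y i := Finset.sum_nonneg fun j _ => this j
          gcongr
          · exact hX n
          · exact hY n
  set Z := ((1 + 2 * D.κ + D.κ ^ 2) * D.κ * L * (∫ y, |y| * |D.φ y|)) with hZ
  have lim : Filter.Tendsto (fun k : ℕ => β * (Z * (1 / 2 : ℝ) ^ k) + 4 * D.κ ^ 2 * β * A * (X * Y))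
      Filter.atTop (nhds (β * (Z * 0) + 4 * D.κ ^ 2 * β * A * (X * Y))) :=
    (((tendsto_pow_atTop_nhds_zero_of_lt_one (by norm_num) (by norm_num)).const_mul _).const_mul
      _).add_const _
  rw [mul_zero, mul_zero, zero_add] at lim
  refine ge_of_tendsto' lim fun k => ?_
  have : ∫ p, G p * F p = (∫ p, G p * (F - D.W (1, 0) (k + 1) (D.W (0, 1) (k + 1) F)) p) +
      ∫ p, G p * (D.W (1, 0) (k + 1) (D.W (0, 1) (k + 1) F)) p := by
    rw [← integral_add (hG.g.mulH _) (hG.g.mulH _)]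
    congr 1; ext p; simp; ring
  rw [this]
  refine (abs_add_le _ _).trans (add_le_add ((hG.g.pair _).trans ?_) (bound _))
  gcongr
  exact D.approxWW _ _ F hL hL' k

end KD

lemma geo_sum {s : ℝ} (hs : 0 < s) (hs1 : s < 1) : ∃ C : ℝ, 0 ≤ C ∧ ∀ R : ℝ, 1 ≤ R → ∀ n : ℕ,
    ∑ i ∈ Finset.range n, min 1 (R / 2 ^ i) * ((2:ℝ) ^ i) ^ s ≤ C * R ^ s := by
  set q : ℝ := (2:ℝ) ^ s with hq
  set r : ℝ := (2:ℝ) ^ (s - 1) with hr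
  have hq1 : 1 < q := Real.one_lt_rpow (by norm_num) hs
  have hr1 : r < 1 := Real.rpow_lt_one_of_one_lt_of_neg (by norm_num) (by linarith)
  have hr0 : 0 < r := by positivity
  have hqi : ∀ i : ℕ, ((2:ℝ) ^ i) ^ s = q ^ i := fun i => by
    rw [hq, ← Real.rpow_natCast, ← Real.rpow_natCast, ← Real.rpow_mul (by norm_num),
      ← Real.rpow_mul (by norm_num), mul_comm]
  have hri : ∀ i : ℕ, ((2:ℝ) ^ i) ^ (s - 1) = r ^ i := fun i => by
    rw [hr, ← Real.rpow_natCast, ← Real.rpow_natCast, ← Real.rpow_mul (by norm_num),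
      ← Real.rpow_mul (by norm_num), mul_comm]
  have hqr : ∀ i : ℕ, q ^ i / 2 ^ i = r ^ i := fun i => by
    rw [← hqi, ← hri, Real.rpow_sub (by positivity), Real.rpow_one]
  refine ⟨q / (q - 1) + 1 / (1 - r), ?_, fun R hR n => ?_⟩
  · have : 0 < q - 1 := by linarith
    have : 0 < 1 - r := by linarith
    positivity
  have hR0 : 0 < R := by linarith
  obtain ⟨m, hm1, hm2⟩ := exists_nat_pow_near hR (one_lt_two : (1:ℝ) < 2)
  have hnn : ∀ i : ℕ, 0 ≤ min 1 (R / 2 ^ i) * ((2:ℝ) ^ i) ^ s := fun i => by positivity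
  calc _ ≤ ∑ i ∈ Finset.range ((m + 1) + n), min 1 (R / 2 ^ i) * ((2:ℝ) ^ i) ^ s :=
        Finset.sum_le_sum_of_subset_of_nonneg (by intro i; simp; lia) fun i _ _ => hnn i
    _ = ∑ i ∈ Finset.range (m + 1), min 1 (R / 2 ^ i) * ((2:ℝ) ^ i) ^ s +
        ∑ i ∈ Finset.range n, min 1 (R / 2 ^ (m + 1 + i)) * ((2:ℝ) ^ (m + 1 + i)) ^ s :=
        Finset.sum_range_add _ _ _
    _ ≤ ∑ i ∈ Finset.range (m + 1), q ^ i + ∑ i ∈ Finset.range n, (R * r ^ (m + 1)) * r ^ i := by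
        refine add_le_add (Finset.sum_le_sum fun i _ => ?_) (Finset.sum_le_sum fun i _ => ?_)
        · rw [hqi]
          exact mul_le_of_le_one_left (by positivity) (min_le_left _ _)
        · rw [hqi, mul_assoc, ← pow_add, ← hqr]
          calc _ ≤ R / 2 ^ (m + 1 + i) * q ^ (m + 1 + i) := by gcongr; exact min_le_right _ _
            _ = _ := by ring
    _ ≤ q / (q - 1) * R ^ s + 1 / (1 - r) * R ^ s := by
        have hqm : q ^ m ≤ R ^ s := by
          rw [← hqi]; exact Real.rpow_le_rpow (by positivity) hm1 hs.le
        have hrm : R * r ^ (m + 1) ≤ R ^ s := by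
          rw [← hri]
          calc R * ((2:ℝ) ^ (m + 1)) ^ (s - 1) ≤ R * R ^ (s - 1) := by
                refine mul_le_mul_of_nonneg_left ?_ hR0.le
                exact Real.rpow_le_rpow_of_nonpos hR0 hm2.le (by linarith)
            _ = R ^ s := by
                rw [Real.rpow_sub hR0, Real.rpow_one]; field_simp
        refine add_le_add ?_ ?_
        · rw [geom_sum_eq hq1.ne', div_mul_eq_mul_div]
          have : 0 < q - 1 := by linarith
          gcongr
          rw [pow_succ]
          nlinarith
        · rw [← Finset.mul_sum, mul_comm]
          have hg : ∑ i ∈ Finset.range n, r ^ i ≤ 1 / (1 - r) := by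
            rw [one_div, ← tsum_geometric_of_lt_one hr0.le hr1]
            exact (summable_geometric_of_lt_one hr0.le hr1).sum_le_tsum _ fun i _ => by positivity
          have : 0 < 1 - r := by linarith
          gcongr
    _ = _ := by ring

lemma factor_bound {g' g a : ℝ} (h1 : -(1/2) < g') (h2 : g' ≤ g) (h3 : g < 0) (ha : 0 < a) :
    a ^ g' * (a + 1) ^ (-g) * √(min 1 a) ≤ 2 := by
  have h2g : (2:ℝ) ^ (-g) ≤ 2 := by
    calc (2:ℝ) ^ (-g) ≤ 2 ^ (1:ℝ) := Real.rpow_le_rpow_of_exponent_le (by norm_num) (by linarith)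
      _ = 2 := Real.rpow_one _
  rcases le_total a 1 with h | h
  · rw [min_eq_right h, Real.sqrt_eq_rpow, mul_right_comm, ← Real.rpow_add ha]
    calc a ^ (g' + 1 / 2) * (a + 1) ^ (-g) ≤ 1 * 2 ^ (-g) := by
          gcongr
          · exact Real.rpow_le_one ha.le h (by linarith)
          · linarith
          · linarith
      _ ≤ 2 := by linarith
  · rw [min_eq_left h, Real.sqrt_one, mul_one]
    calc a ^ g' * (a + 1) ^ (-g) ≤ a ^ g' * (2 * a) ^ (-g) := by
          gcongr
          · linarith
          · linarith
      _ = 2 ^ (-g) * a ^ (g' - g) := by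
          rw [Real.mul_rpow (by norm_num) ha.le, sub_eq_add_neg, Real.rpow_add ha]; ring
      _ ≤ 2 * 1 := by
          gcongr
          exact Real.rpow_le_one_of_one_le_of_nonpos h (by linarith)
      _ = 2 := by norm_num

lemma final_num {g' g h K₁ K₂ M : ℝ} (h1 : -(1/2) < g') (h2 : g' ≤ g) (h3 : g < 0)
    (h4 : -(1/2) < h) (h5 : h < 0) (hK₁ : 0 < K₁) (hK₂ : 0 < K₂) (hM : 0 < M) :
    K₁ ^ g' * K₂ ^ h * (min M (min K₁ K₂) / M) * ((K₁ + M) ^ (-g) * (K₂ + M) ^ (-h)) ≤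
      4 * M ^ (g' - g) := by
  obtain ⟨a, ha, rfl⟩ : ∃ a, 0 < a ∧ K₁ = a * M := ⟨K₁ / M, by positivity, by field_simp⟩
  obtain ⟨b, hb, rfl⟩ : ∃ a, 0 < a ∧ K₂ = a * M := ⟨K₂ / M, by positivity, by field_simp⟩
  have e1 : min M (min (a * M) (b * M)) / M = min 1 (min a b) := by
    rw [← min_mul_of_nonneg _ _ hM.le]
    nth_rewrite 1 [← one_mul M]
    rw [← min_mul_of_nonneg _ _ hM.le]
    field_simp
  have e2 : min 1 (min a b) ≤ √(min 1 a) * √(min 1 b) := by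
    rw [← Real.sqrt_mul (by positivity)]
    apply Real.le_sqrt_of_sq_le
    rw [sq]
    have : 0 ≤ min 1 (min a b) := by positivity
    gcongr
    · exact min_le_left _ _
    · exact min_le_right _ _
  have e3 : a * M + M = (a + 1) * M := by ring
  have e4 : b * M + M = (b + 1) * M := by ring
  rw [e1, e3, e4, Real.mul_rpow ha.le hM.le, Real.mul_rpow hb.le hM.le,
    Real.mul_rpow (by positivity) hM.le, Real.mul_rpow (by positivity) hM.le]
  have f1 := factor_bound h1 h2 h3 ha
  have f2 := factor_bound h4 le_rfl h5 hb
  have e5 : M ^ g' * M ^ (-g) = M ^ (g' - g) := by rw [← Real.rpow_add hM]; ring_nf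
  have e6 : M ^ h * M ^ (-h) = 1 := by rw [← Real.rpow_add hM]; simp
  calc _ = a ^ g' * (a + 1) ^ (-g) * (b ^ h * (b + 1) ^ (-h)) * min 1 (min a b) *
        ((M ^ g' * M ^ (-g)) * (M ^ h * M ^ (-h))) := by ring
    _ ≤ a ^ g' * (a + 1) ^ (-g) * (b ^ h * (b + 1) ^ (-h)) * (√(min 1 a) * √(min 1 b)) *
        ((M ^ g' * M ^ (-g)) * (M ^ h * M ^ (-h))) := by gcongr
    _ = (a ^ g' * (a + 1) ^ (-g) * √(min 1 a)) * (b ^ h * (b + 1) ^ (-h) * √(min 1 b)) *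
        M ^ (g' - g) := by rw [e5, e6]; ring
    _ ≤ 2 * 2 * M ^ (g' - g) := by gcongr
    _ = _ := by ring

lemma nice_scale {f : ℝ → ℝ} {A M s : ℝ} (hc : Continuous f) (hi : Integrable f)
    (h1 : ∫ x, |f x| ≤ A) (h2 : ∀ x, |f x| ≤ A) (hM : 0 < M) (hs : 0 ≤ s) :
    Nice M (A / M * s) (fun x => s * f (M * x)) := by
  refine ⟨by fun_prop, (hi.comp_mul_left' hM.ne').const_mul _, ?_, fun x => ?_⟩
  · simp only [abs_mul, abs_of_nonneg hs]
    rw [integral_const_mul, Measure.integral_comp_mul_left (fun y => |f y|), smul_eq_mul,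
      abs_of_pos (by positivity)]
    calc s * (M⁻¹ * ∫ y, |f y|) ≤ s * (M⁻¹ * A) := by gcongr
      _ = _ := by field_simp
  · simp only [abs_mul, abs_of_nonneg hs]
    calc s * |f (M * x)| ≤ s * A := by gcongr; exact h2 _
      _ = _ := by field_simp

lemma Nice.mono {K A K' A' : ℝ} {a : ℝ → ℝ} (h : Nice K A a) (hA : A ≤ A') (hK0 : 0 ≤ K)
    (hK : K ≤ K') : Nice K' A' a := by
  have := h.nonneg
  refine ⟨h.cont, h.int, h.l1.trans hA, fun x => (h.sup x).trans ?_⟩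
  have : 0 ≤ A' := this.trans hA
  gcongr

lemma Nice.sub {K A A' : ℝ} {a b : ℝ → ℝ} (h : Nice K A a) (h' : Nice K A' b) :
    Nice K (A + A') (fun x => a x - b x) := by
  refine ⟨h.cont.sub h'.cont, h.int.sub h'.int, ?_, fun x => ?_⟩
  · refine le_trans ?_ (add_le_add h.l1 h'.l1)
    rw [← integral_add h.int.abs h'.int.abs]
    exact integral_mono (h.int.sub h'.int).abs (h.int.abs.add h'.int.abs) fun p => abs_sub _ _
  · refine (abs_sub _ _).trans ?_
    have := h.sup x
    have := h'.sup x
    linarith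

lemma Nice.neg {K A : ℝ} {a : ℝ → ℝ} (h : Nice K A a) : Nice K A (fun x => - a x) := by
  refine ⟨h.cont.neg, h.int.neg, ?_, fun x => ?_⟩
  · simpa only [abs_neg] using h.l1
  · simpa only [abs_neg] using h.sup x

lemma Nice.refl_shift {K A : ℝ} {a : ℝ → ℝ} (h : Nice K A a) (t : ℝ) :
    Nice K A (fun x => a (t - x)) := by
  refine ⟨h.cont.comp (by fun_prop), h.int.comp_sub_left t, ?_, fun x => h.sup _⟩
  rw [integral_sub_left_eq_self (fun x => |a x|)]
  exact h.l1

open scoped SchwartzMap in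
lemma schwartz_bd (f : 𝓢(ℝ, ℝ)) : ∃ A, 0 ≤ A ∧ ∫ x, |f x| ≤ A ∧ ∀ x, |f x| ≤ A := by
  have h0 : 0 ≤ ∫ x, |f x| := by positivity
  have h1 : ∀ x, |f x| ≤ SchwartzMap.seminorm ℝ 0 0 f := fun x => SchwartzMap.norm_le_seminorm ℝ f x
  have h2 := (abs_nonneg _).trans (h1 0)
  exact ⟨(∫ x, |f x|) + SchwartzMap.seminorm ℝ 0 0 f, by linarith, by linarith,
    fun x => by linarith [h1 x]⟩

open scoped SchwartzMap in
lemma schwartz_deriv (f : 𝓢(ℝ, ℝ)) (x : ℝ) :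
    HasDerivAt f (SchwartzMap.derivCLM ℝ ℝ f x) x := by
  rw [SchwartzMap.derivCLM_apply]
  exact f.differentiableAt.hasDerivAt

lemma hasDerivAt_scale {f f' : ℝ → ℝ} (h : ∀ x, HasDerivAt f (f' x) x) (s M x : ℝ) :
    HasDerivAt (fun x => s * f (M * x)) (s * M * f' (M * x)) x := by
  have h1 := ((h (M * x)).comp x ((hasDerivAt_id x).const_mul M)).const_mul s
  refine h1.congr_deriv ?_
  ring

lemma invFourier_scale (ρ : ℝ → ℝ) {l : ℝ} (hl : 0 < l) (x : ℝ) :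
    invFourier (fun ξ => ρ (ξ / l)) x = l * invFourier ρ (l * x) := by
  unfold invFourier
  have h := Measure.integral_comp_div (fun ξ => Real.cos (l * x * ξ) * ρ ξ) l
  rw [abs_of_pos hl, smul_eq_mul] at h
  have e : ∫ ξ, Real.cos (x * ξ) * ρ (ξ / l) = ∫ ξ, Real.cos (l * x * (ξ / l)) * ρ (ξ / l) := by
    congr 1; ext ξ
    congr 2
    field_simp
  rw [e, h]
  ring

lemma cutoff_integrable {ρ : ℝ → ℝ} (hρ : IsLPCutoff ρ) {l : ℝ} (hl : 0 < l) (x : ℝ) :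
    Integrable (fun ξ => Real.cos (x * ξ) * ρ (ξ / l)) := by
  have hc := hρ.smooth.continuous
  refine Continuous.integrable_of_hasCompactSupport (by fun_prop) ?_
  refine HasCompactSupport.of_support_subset_isCompact
    (isCompact_Icc (a := -(9/8 * l)) (b := 9/8 * l)) ?_
  intro ξ hξ
  by_contra h
  apply hξ
  have : ρ (ξ / l) = 0 := by
    apply hρ.eq_zero
    by_contra h'
    apply h
    rw [not_le, abs_div, abs_of_pos hl, div_lt_iff₀ hl] at h'
    exact abs_le.1 h'.le
  simp [this]

lemma lpKernel_zero {ρ φ : ℝ → ℝ} (h : ∀ x, invFourier ρ x = √(2 * π) * φ x) (y : ℝ) :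
    lpKernel ρ 0 y = √(2 * π) * φ y := h y

lemma lpKernel_succ {ρ φ : ℝ → ℝ} (hρ : IsLPCutoff ρ)
    (h : ∀ x, invFourier ρ x = √(2 * π) * φ x) (k : ℕ) (y : ℝ) :
    lpKernel ρ (k + 1) y = √(2 * π) * (2 ^ (k + 1) * φ (2 ^ (k + 1) * y) - 2 ^ k * φ (2 ^ k * y)) := by
  have h1 := invFourier_scale ρ (show (0:ℝ) < 2 ^ (k + 1) by positivity) y
  have h2 := invFourier_scale ρ (show (0:ℝ) < 2 ^ k by positivity) y
  have h3 : lpKernel ρ (k + 1) y = invFourier (fun ξ => ρ (ξ / 2 ^ (k + 1))) y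
      - invFourier (fun ξ => ρ (ξ / 2 ^ k)) y := by
    unfold lpKernel invFourier
    rw [← mul_sub, ← integral_sub (cutoff_integrable hρ (by positivity) y)
      (cutoff_integrable hρ (by positivity) y)]
    congr 2; ext ξ
    simp only [lpSymbol]
    have : 2 * ξ / 2 ^ (k + 1) = ξ / 2 ^ k := by rw [pow_succ]; field_simp
    rw [this]; ring
  rw [h3, h1, h2, h, h]
  ring

open scoped SchwartzMap in
lemma kernel_nice {ρ : ℝ → ℝ} (hρ : IsLPCutoff ρ) (φ : 𝓢(ℝ, ℝ))
    (h : ∀ x, invFourier ρ x = √(2 * π) * φ x) :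
    ∃ A, 0 ≤ A ∧ ∀ k : ℕ, ∃ a' : ℝ → ℝ, Nice (2 ^ k) A (lpKernel ρ k) ∧ Nice (2 ^ k) (A * 2 ^ k) a' ∧
      ∀ x, HasDerivAt (lpKernel ρ k) (a' x) x := by
  obtain ⟨A0, h00, h01, h02⟩ := schwartz_bd φ
  obtain ⟨A1, h10, h11, h12⟩ := schwartz_bd (SchwartzMap.derivCLM ℝ ℝ φ)
  set φ' := SchwartzMap.derivCLM ℝ ℝ φ
  have hd : ∀ x, HasDerivAt φ (φ' x) x := schwartz_deriv φ
  set c := √(2 * π)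
  have hc : 0 ≤ c := Real.sqrt_nonneg _
  have n0 : ∀ k : ℕ, Nice (2 ^ k) ((A0 + A1) * c) (fun x => (c * 2 ^ k) * φ (2 ^ k * x)) := by
    intro k
    have := nice_scale φ.continuous φ.integrable (h01.trans (by linarith : A0 ≤ A0 + A1))
      (fun x => (h02 x).trans (by linarith : A0 ≤ A0 + A1)) (show (0:ℝ) < 2 ^ k by positivity)
      (show 0 ≤ c * 2 ^ k by positivity)
    convert this using 1
    field_simp
  have n1 : ∀ k : ℕ, Nice (2 ^ k) ((A0 + A1) * c * 2 ^ k)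
      (fun x => (c * 2 ^ k * 2 ^ k) * φ' (2 ^ k * x)) := by
    intro k
    have := nice_scale φ'.continuous φ'.integrable (h11.trans (by linarith : A1 ≤ A0 + A1))
      (fun x => (h12 x).trans (by linarith : A1 ≤ A0 + A1)) (show (0:ℝ) < 2 ^ k by positivity)
      (show 0 ≤ c * 2 ^ k * 2 ^ k by positivity)
    convert this using 1
    field_simp
  have hA : 0 ≤ (A0 + A1) * c := by positivity
  refine ⟨(A0 + A1) * c + (A0 + A1) * c, by positivity, fun k => ?_⟩
  cases k with
  | zero =>
    have e : lpKernel ρ 0 = fun x => (c * 2 ^ 0) * φ (2 ^ 0 * x) := by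
      ext x; rw [lpKernel_zero h]; simp [c]
    refine ⟨_, ?_, (n1 0).mono ?_ (by positivity) le_rfl, ?_⟩
    · rw [e]; exact (n0 0).mono (by linarith) (by positivity) le_rfl
    · simp; positivity
    · intro x; rw [e]; exact hasDerivAt_scale hd _ _ _
  | succ k =>
    have e : lpKernel ρ (k + 1) = fun x => (c * 2 ^ (k + 1)) * φ (2 ^ (k + 1) * x)
        - (c * 2 ^ k) * φ (2 ^ k * x) := by
      ext x; rw [lpKernel_succ hρ h]; ring
    have hk : (2:ℝ) ^ k ≤ 2 ^ (k + 1) := by rw [pow_succ]; linarith [show (0:ℝ) < 2 ^ k by positivity]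
    refine ⟨fun x => (c * 2 ^ (k + 1) * 2 ^ (k + 1)) * φ' (2 ^ (k + 1) * x)
      - (c * 2 ^ k * 2 ^ k) * φ' (2 ^ k * x), ?_, ?_, fun x => ?_⟩
    rotate_left 2
    · rw [e]; exact (hasDerivAt_scale hd _ _ _).sub (hasDerivAt_scale hd _ _ _)
    · rw [e]
      exact (n0 (k + 1)).sub ((n0 k).mono le_rfl (by positivity) hk)
    · rw [add_mul]
      exact (n1 (k + 1)).sub ((n1 k).mono (by gcongr) (by positivity) hk)

open scoped SchwartzMap in
lemma chi_nice {χ : ℝ → ℝ} (hs : ContDiff ℝ (⊤ : ℕ∞) χ) (hc : HasCompactSupport χ) :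
    ∃ A, 0 ≤ A ∧ ∀ M, 0 < M → ∃ c' c'' : ℝ → ℝ, Nice M (A / M) (fun x => χ (M * x)) ∧
      Nice M (A / M * M) c' ∧ Nice M (A / M * M * M) c'' ∧
      (∀ x, HasDerivAt (fun x => χ (M * x)) (c' x) x) ∧ (∀ x, HasDerivAt c' (c'' x) x) := by
  let f0 : 𝓢(ℝ, ℝ) := hc.toSchwartzMap hs
  have e0 : ∀ x, f0 x = χ x := fun x => rfl
  let f1 := SchwartzMap.derivCLM ℝ ℝ f0
  let f2 := SchwartzMap.derivCLM ℝ ℝ f1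
  obtain ⟨A0, p0, q0, r0⟩ := schwartz_bd f0
  obtain ⟨A1, p1, q1, r1⟩ := schwartz_bd f1
  obtain ⟨A2, p2, q2, r2⟩ := schwartz_bd f2
  have l0 : A0 ≤ A0 + A1 + A2 := by linarith
  have l1 : A1 ≤ A0 + A1 + A2 := by linarith
  have l2 : A2 ≤ A0 + A1 + A2 := by linarith
  refine ⟨A0 + A1 + A2, by positivity, fun M hM => ⟨fun x => M * f1 (M * x),
    fun x => M * M * f2 (M * x), ?_, ?_, ?_, fun x => ?_, fun x => ?_⟩⟩
  · have := nice_scale f0.continuous f0.integrable (q0.trans l0) (fun x => (r0 x).trans l0) hM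
      zero_le_one
    simpa only [mul_one, one_mul, e0] using this
  · exact nice_scale f1.continuous f1.integrable (q1.trans l1) (fun x => (r1 x).trans l1) hM hM.le
  · have := nice_scale f2.continuous f2.integrable (q2.trans l2) (fun x => (r2 x).trans l2) hM
      (mul_nonneg hM.le hM.le)
    rwa [← mul_assoc] at this
  · have := hasDerivAt_scale (schwartz_deriv f0) 1 M x
    simpa only [one_mul, e0] using this
  · exact hasDerivAt_scale (schwartz_deriv f1) M M x

lemma LPu_eq {ρ : ℝ → ℝ} (hρ : IsLPCutoff ρ) (D : KD)
    (h : ∀ x, invFourier ρ x = √(2 * π) * D.φ x) (i : ℕ) (H : XX) (p : ℝ × ℝ) :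
    LPu ρ i H p = √(2 * π) * D.P (1, 0) i H p := by
  have hp : ∀ y : ℝ, p - y • ((1, 0) : ℝ × ℝ) = (p.1 - y, p.2) := fun y => by
    ext <;> simp
  rw [KD.P_apply, BoundedContinuousFunction.sub_apply]
  cases i with
  | zero =>
    simp only [KD.S, conv_apply, hp, LPu, lpKernel_zero h, LinearMap.zero_apply,
      BoundedContinuousFunction.coe_zero, Pi.zero_apply, sub_zero, pow_zero, one_mul, mul_assoc]
    exact integral_const_mul _ _
  | succ k =>
    have i1 := conv_integrable (int_scale D.hφ (k + 1)) (1, 0) H p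
    have i2 := conv_integrable (int_scale D.hφ k) (1, 0) H p
    simp only [KD.S, conv_apply]
    rw [← integral_sub i1 i2, ← integral_const_mul]
    simp only [LPu, lpKernel_succ hρ h, hp]
    congr 1; ext y; ring

lemma LPv_eq {ρ : ℝ → ℝ} (hρ : IsLPCutoff ρ) (D : KD)
    (h : ∀ x, invFourier ρ x = √(2 * π) * D.φ x) (i : ℕ) (H : XX) (p : ℝ × ℝ) :
    LPv ρ i H p = √(2 * π) * D.P (0, 1) i H p := by
  have hp : ∀ y : ℝ, p - y • ((0, 1) : ℝ × ℝ) = (p.1, p.2 - y) := fun y => by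
    ext <;> simp
  rw [KD.P_apply, BoundedContinuousFunction.sub_apply]
  cases i with
  | zero =>
    simp only [KD.S, conv_apply, hp, LPv, lpKernel_zero h, LinearMap.zero_apply,
      BoundedContinuousFunction.coe_zero, Pi.zero_apply, sub_zero, pow_zero, one_mul, mul_assoc]
    exact integral_const_mul _ _
  | succ k =>
    have i1 := conv_integrable (int_scale D.hφ (k + 1)) (0, 1) H p
    have i2 := conv_integrable (int_scale D.hφ k) (0, 1) H p
    simp only [KD.S, conv_apply]
    rw [← integral_sub i1 i2, ← integral_const_mul]
    simp only [LPv, lpKernel_succ hρ h, hp]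
    congr 1; ext y; ring

lemma LPuv_eq {ρ : ℝ → ℝ} (hρ : IsLPCutoff ρ) (D : KD)
    (h : ∀ x, invFourier ρ x = √(2 * π) * D.φ x) (i j : ℕ) (H : XX) (p : ℝ × ℝ) :
    LPu ρ i (LPv ρ j H) p = 2 * π * D.P (1, 0) i (D.P (0, 1) j H) p := by
  have e : LPv ρ j H = ((√(2 * π) • D.P (0, 1) j H : XX) : ℝ × ℝ → ℝ) := by
    ext q; rw [LPv_eq hρ D h]; rfl
  rw [e, LPu_eq hρ D h, map_smul]
  change √(2 * π) * (√(2 * π) * _) = _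
  rw [← mul_assoc, Real.mul_self_sqrt (by positivity)]
  rfl

lemma LPuv_abc {ρ : ℝ → ℝ} {c : ℝ → ℝ} (k₁ k₂ : ℕ) (F : XX) (q : ℝ × ℝ)
    (hi : Integrable (fun p => abc (fun u => lpKernel ρ k₁ (q.1 - u)) (fun v => lpKernel ρ k₂ (q.2 - v))
      c p * F p)) :
    LPu ρ k₁ (LPv ρ k₂ (fun p => c (p.1 - p.2) * F p)) q =
      ∫ p, abc (fun u => lpKernel ρ k₁ (q.1 - u)) (fun v => lpKernel ρ k₂ (q.2 - v)) c p * F p := by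
  have e := integral_prod (μ := (volume : Measure ℝ)) (ν := (volume : Measure ℝ)) _ hi
  rw [← Measure.volume_eq_prod] at e
  rw [e]
  unfold LPu LPv
  rw [← integral_sub_left_eq_self _ volume q.1]
  congr 1; ext u
  rw [← integral_sub_left_eq_self _ volume q.2, ← integral_const_mul]
  congr 1; ext v
  simp only [abc, sub_sub_cancel]
  ring

lemma cb_lip {F : ℝ × ℝ → ℝ} (hF : CbSmooth F) : ∃ L : ℝ, ∀ p q, |F p - F q| ≤ L * ‖p - q‖ := by
  obtain ⟨L, hL⟩ := hF.2 1
  refine ⟨L, fun p q => ?_⟩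
  rw [← Real.norm_eq_abs]
  refine Convex.norm_image_sub_le_of_norm_fderiv_le (𝕜 := ℝ) (s := Set.univ)
    (fun x _ => (hF.1.differentiable (by simp)).differentiableAt) (fun x _ => ?_) convex_univ
    (Set.mem_univ _) (Set.mem_univ _)
  rw [← norm_iteratedFDeriv_one]
  exact hL x

lemma cb_XX {F : ℝ × ℝ → ℝ} (hF : CbSmooth F) : ∃ H : XX, (H : ℝ × ℝ → ℝ) = F := by
  obtain ⟨C, hC⟩ := hF.2 0
  exact ⟨BoundedContinuousFunction.ofNormedAddCommGroup F hF.1.continuous C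
    (fun x => by simpa using hC x), rfl⟩

open scoped SchwartzMap in
lemma real_estimate (ρ : ℝ → ℝ) (hρ : IsLPCutoff ρ) (γ₁' γ₁ γ₂ : ℝ)
    (h₁'l : -(1/2) < γ₁') (h₁l : -(1/2) < γ₁) (h₁u : γ₁ < 0)
    (h₂l : -(1/2) < γ₂) (h₂u : γ₂ < 0) (hlt : γ₁' < γ₁)
    (χ' : ℝ → ℝ) (hχ's : ContDiff ℝ (⊤ : ℕ∞) χ') (hχ'c : HasCompactSupport χ') :
    ∃ C : ℝ, 0 ≤ C ∧ ∀ τ : ℝ, 0 < τ → ∀ F : ℝ × ℝ → ℝ, CbSmooth F → ∀ N : ℝ, 0 ≤ N →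
      (∀ i j : ℕ, ∀ p, ((2 : ℝ) ^ i) ^ γ₁ * ((2 : ℝ) ^ j) ^ γ₂ * |LPu ρ i (LPv ρ j F) p| ≤ N) →
      ∀ k₁ k₂ : ℕ, ∀ q, ((2 : ℝ) ^ k₁) ^ γ₁' * ((2 : ℝ) ^ k₂) ^ γ₂ *
        |LPu ρ k₁ (LPv ρ k₂ (fun p => χ' ((p.1 - p.2) / τ) * F p)) q| ≤ C * τ ^ (γ₁ - γ₁') * N := by
  obtain ⟨φ, hφ, hφ1⟩ := exists_kernel hρ
  obtain ⟨Ψ, hΨ, hibp⟩ := exists_psi φ hφ1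
  let D : KD := ⟨φ, Ψ, φ.integrable, hΨ, hφ1, by
    simpa using φ.integrable_pow_mul volume 1, hibp⟩
  have hD : ∀ x, invFourier ρ x = √(2 * π) * D.φ x := hφ
  obtain ⟨A, hA, hker⟩ := kernel_nice hρ φ hφ
  obtain ⟨B, hB, hchi⟩ := chi_nice hχ's hχ'c
  obtain ⟨C₁, hC₁, hs₁⟩ := geo_sum (s := -γ₁) (by linarith) (by linarith)
  obtain ⟨C₂, hC₂, hs₂⟩ := geo_sum (s := -γ₂) (by linarith) (by linarith)
  have hκ := D.κ_nonneg
  refine ⟨4 * D.κ ^ 2 * A ^ 2 * B * (2 * π)⁻¹ * (C₁ * C₂) * 4, by positivity, ?_⟩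
  intro τ hτ F hF N hN hFN k₁ k₂ q
  obtain ⟨L, hL⟩ := cb_lip hF
  obtain ⟨H, rfl⟩ := cb_XX hF
  obtain ⟨M, hM, rfl⟩ : ∃ M, 0 < M ∧ τ = M⁻¹ := ⟨τ⁻¹, by positivity, by simp⟩
  obtain ⟨a', na, na', da⟩ := hker k₁
  obtain ⟨b', nb, nb', db⟩ := hker k₂
  obtain ⟨c', c'', nc, nc', nc'', dc, dc'⟩ := hchi M hM
  have da2 : ∀ x, HasDerivAt (fun u => lpKernel ρ k₁ (q.1 - u)) (- a' (q.1 - x)) x := fun x => by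
    exact ((da (q.1 - x)).comp x ((hasDerivAt_id x).const_sub q.1)).congr_deriv (by simp)
  have db2 : ∀ x, HasDerivAt (fun u => lpKernel ρ k₂ (q.2 - u)) (- b' (q.2 - x)) x := fun x => by
    exact ((db (q.2 - x)).comp x ((hasDerivAt_id x).const_sub q.2)).congr_deriv (by simp)
  have hT := testG_abc (na.refl_shift q.1) (na'.refl_shift q.1).neg (nb.refl_shift q.2)
    (nb'.refl_shift q.2).neg nc nc' nc'' da2 db2 dc dc'
  have hK1 : (1:ℝ) ≤ 2 ^ k₁ := one_le_pow₀ (by norm_num)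
  have hK2 : (1:ℝ) ≤ 2 ^ k₂ := one_le_pow₀ (by norm_num)
  have hR1 : 1 ≤ (2:ℝ) ^ k₁ + M := by linarith
  have hR2 : 1 ≤ (2:ℝ) ^ k₂ + M := by linarith
  have hP : ∀ i j, ‖D.P (1, 0) i (D.P (0, 1) j H)‖ ≤
      (N * (2 * π)⁻¹) * (((2:ℝ) ^ i) ^ (-γ₁) * ((2:ℝ) ^ j) ^ (-γ₂)) := by
    intro i j
    refine (BoundedContinuousFunction.norm_le (by positivity)).2 fun p => ?_
    have := hFN i j p
    rw [LPuv_eq hρ D hD, abs_mul, abs_of_pos (by positivity : 0 < 2 * π)] at this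
    rw [Real.norm_eq_abs, Real.rpow_neg (by positivity), Real.rpow_neg (by positivity)]
    have t1 : 0 < ((2:ℝ) ^ i) ^ γ₁ := by positivity
    have t2 : 0 < ((2:ℝ) ^ j) ^ γ₂ := by positivity
    have t3 : 0 < 2 * π := by positivity
    generalize ((2:ℝ) ^ i) ^ γ₁ = s at *
    generalize ((2:ℝ) ^ j) ^ γ₂ = t at *
    generalize 2 * π = w at *
    generalize |(D.P (1, 0) i (D.P (0, 1) j H)) p| = z at *
    calc z = (s * t * (w * z)) * (w⁻¹ * (s⁻¹ * t⁻¹)) := by field_simp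
      _ ≤ N * (w⁻¹ * (s⁻¹ * t⁻¹)) := by gcongr
      _ = _ := by ring
  have key := D.main_est hT hR1 hR2 H (L := L)
    (fun p y => (hL _ _).trans (le_of_eq (by simp [norm_smul, Prod.norm_def])))
    (fun p y => (hL _ _).trans (le_of_eq (by simp [norm_smul, Prod.norm_def])))
    (by positivity : 0 ≤ N * (2 * π)⁻¹) (fun i => by positivity) (fun i => by positivity) hP
    (hs₁ _ hR1) (hs₂ _ hR2)
  have e := LPuv_abc (ρ := ρ) (c := fun x => χ' (M * x)) k₁ k₂ H q (hT.g.mulH H)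
  have e2 : (fun p : ℝ × ℝ => χ' ((p.1 - p.2) / M⁻¹) * H p) =
      fun p => (fun x => χ' (M * x)) (p.1 - p.2) * H p := by
    ext p; simp only [div_inv_eq_mul, mul_comm]
  rw [e2, e]
  have num := final_num h₁'l hlt.le h₁u h₂l h₂u (show (0:ℝ) < 2 ^ k₁ by positivity)
    (show (0:ℝ) < 2 ^ k₂ by positivity) hM
  have e3 : M⁻¹ ^ (γ₁ - γ₁') = M ^ (γ₁' - γ₁) := by
    rw [Real.inv_rpow hM.le, ← Real.rpow_neg hM.le, neg_sub]
  rw [e3]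
  calc _ ≤ ((2 : ℝ) ^ k₁) ^ γ₁' * ((2 : ℝ) ^ k₂) ^ γ₂ * _ := by
        refine mul_le_mul_of_nonneg_left key (by positivity)
    _ = (4 * D.κ ^ 2 * A ^ 2 * B * (2 * π)⁻¹ * (C₁ * C₂) * N) *
        (((2 : ℝ) ^ k₁) ^ γ₁' * ((2 : ℝ) ^ k₂) ^ γ₂ * (min M (min (2 ^ k₁) (2 ^ k₂)) / M) *
          (((2 : ℝ) ^ k₁ + M) ^ (-γ₁) * ((2 : ℝ) ^ k₂ + M) ^ (-γ₂))) := by ring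
    _ ≤ (4 * D.κ ^ 2 * A ^ 2 * B * (2 * π)⁻¹ * (C₁ * C₂) * N) * (4 * M ^ (γ₁' - γ₁)) := by
        gcongr
    _ = _ := by ring

/-- **Lemma 2.23: time-localization.**
For `γ₁′, γ₁, γ₂ ∈ (−1/2, 0)` with `γ₁′ < γ₁` and a smooth compactly supported `χ̃`, one has
`‖χ̃((u−v)/τ) F‖_{C_u^{γ₁′}C_v^{γ₂}} ≲ τ^{γ₁−γ₁′} ‖F‖_{C_u^{γ₁}C_v^{γ₂}}` for all `τ > 0`. -/
theorem time_localization
    (ρ : ℝ → ℝ) (hρ : IsLPCutoff ρ)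
    (γ₁' γ₁ γ₂ : ℝ)
    (h₁'l : -(1/2) < γ₁') (h₁'u : γ₁' < 0)
    (h₁l : -(1/2) < γ₁) (h₁u : γ₁ < 0)
    (h₂l : -(1/2) < γ₂) (h₂u : γ₂ < 0)
    (hlt : γ₁' < γ₁)
    (χ' : ℝ → ℝ) (hχ's : ContDiff ℝ (⊤ : ℕ∞) χ') (hχ'c : HasCompactSupport χ') :
    ∃ C : ℝ≥0∞, C ≠ ∞ ∧ ∀ τ : ℝ, 0 < τ → ∀ F : ℝ × ℝ → ℝ, CbSmooth F →
      hNorm2 ρ γ₁' γ₂ (fun p => χ' ((p.1 - p.2) / τ) * F p) ≤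
        C * ENNReal.ofReal (τ ^ (γ₁ - γ₁')) * hNorm2 ρ γ₁ γ₂ F := by
  obtain ⟨C, hC, hest⟩ := real_estimate ρ hρ γ₁' γ₁ γ₂ h₁'l h₁l h₁u h₂l h₂u hlt χ' hχ's hχ'c
  refine ⟨ENNReal.ofReal (C + 1), ENNReal.ofReal_ne_top, fun τ hτ F hF => ?_⟩
  by_cases hN : hNorm2 ρ γ₁ γ₂ F = ∞
  · rw [hN, ENNReal.mul_top]
    · exact le_top
    · rw [← ENNReal.ofReal_mul (by positivity)]
      have : 0 < (C + 1) * τ ^ (γ₁ - γ₁') := by positivity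
      simpa using this
  · have hb : ∀ i j : ℕ, ∀ p, ((2 : ℝ) ^ i) ^ γ₁ * ((2 : ℝ) ^ j) ^ γ₂ * |LPu ρ i (LPv ρ j F) p| ≤
        (hNorm2 ρ γ₁ γ₂ F).toReal := by
      intro i j p
      rw [← ENNReal.ofReal_le_iff_le_toReal hN, ENNReal.ofReal_mul (by positivity)]
      refine le_trans ?_ (le_iSup₂ (f := fun k₁ k₂ : ℕ =>
        ENNReal.ofReal (((2 : ℝ) ^ k₁) ^ γ₁ * ((2 : ℝ) ^ k₂) ^ γ₂) *
          ⨆ p : ℝ × ℝ, ENNReal.ofReal |LPu ρ k₁ (LPv ρ k₂ F) p|) i j)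
      gcongr
      exact le_iSup (fun p : ℝ × ℝ => ENNReal.ofReal |LPu ρ i (LPv ρ j F) p|) p
    have hmain := hest τ hτ F hF _ ENNReal.toReal_nonneg hb
    have e : ENNReal.ofReal (C + 1) * ENNReal.ofReal (τ ^ (γ₁ - γ₁')) * hNorm2 ρ γ₁ γ₂ F =
        ENNReal.ofReal ((C + 1) * τ ^ (γ₁ - γ₁') * (hNorm2 ρ γ₁ γ₂ F).toReal) := by
      rw [ENNReal.ofReal_mul (by positivity), ENNReal.ofReal_mul (by positivity),
        ENNReal.ofReal_toReal hN]
    rw [e]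
    refine iSup₂_le fun k₁ k₂ => ?_
    rw [ENNReal.mul_iSup]
    refine iSup_le fun q => ?_
    rw [← ENNReal.ofReal_mul (by positivity)]
    refine ENNReal.ofReal_le_ofReal ((hmain k₁ k₂ q).trans ?_)
    have : 0 ≤ (hNorm2 ρ γ₁ γ₂ F).toReal := ENNReal.toReal_nonneg
    gcongr
    linarith
end
end

section
/- Structured representation of the Duhamel integral (Lemma 7.2). Let ζ: ℝ² → ℝ and f: ℝ → ℝ be continuously differentiable, and define Duh[H](u,v) := −∫_u^v (∫_u^{v'} H(u',v') du') dv'. Then for all (u,v) ∈ ℝ², Duh[(u',v') ↦ ζ(u',v') f'(u')](u,v) = (∫_u^v ζ(u,v') dv')·f(u) − ∫_u^v ζ(y,y) f(y) dy − Duh[(u',v') ↦ (∂_u ζ)(u',v') f(u')](u,v). -/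
noncomputable section

open Real MeasureTheory

/-- The Duhamel integral `Duh[H](u,v) = −∫_u^v ∫_u^{v'} H(u',v') du' dv'`. -/
def Duh (H : ℝ × ℝ → ℝ) (p : ℝ × ℝ) : ℝ :=
  -∫ v' in p.1..p.2, ∫ u' in p.1..v', H (u', v')

/-- **Lemma 7.2: structured representation of the Duhamel integral.**
For continuously differentiable `ζ : ℝ² → ℝ` and `f : ℝ → ℝ`,
`Duh[ζ(u',v') f'(u')](u,v) = (∫_u^v ζ(u,v') dv') f(u) − ∫_u^v ζ(y,y) f(y) dy
  − Duh[(∂_u ζ)(u',v') f(u')](u,v)`. -/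
theorem duhamel_structured_representation
    (ζ : ℝ × ℝ → ℝ) (f : ℝ → ℝ)
    (hζ : ContDiff ℝ 1 ζ) (hf : ContDiff ℝ 1 f)
    (u v : ℝ) :
    Duh (fun q => ζ q * deriv f q.1) (u, v) =
      (∫ v' in u..v, ζ (u, v')) * f u - (∫ y in u..v, ζ (y, y) * f y) -
        Duh (fun q => deriv (fun x => ζ (x, q.2)) q.1 * f q.1) (u, v) := by
  have hd : ∀ q : ℝ × ℝ, HasDerivAt (fun x => ζ (x, q.2)) (fderiv ℝ ζ q (1, 0)) q.1 := by
    intro q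
    have h1 : HasFDerivAt ζ (fderiv ℝ ζ q) (q.1, q.2) :=
      (hζ.differentiable one_ne_zero q).hasFDerivAt
    have h2 : HasDerivAt (fun x : ℝ => (x, q.2)) ((1 : ℝ), (0 : ℝ)) q.1 :=
      (hasDerivAt_id q.1).prodMk (hasDerivAt_const q.1 q.2)
    exact h1.comp_hasDerivAt q.1 h2
  have hdc : Continuous (fun q : ℝ × ℝ => fderiv ℝ ζ q (1, 0)) :=
    (hζ.continuous_fderiv one_ne_zero).clm_apply continuous_const
  have hfc : Continuous f := hf.continuous
  have hζc : Continuous ζ := hζ.continuous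
  have hf'c : Continuous (deriv f) := hf.continuous_deriv le_rfl
  have hinner : ∀ w : ℝ, (∫ x in u..w, ζ (x, w) * deriv f x) =
      ζ (w, w) * f w - ζ (u, w) * f u - ∫ x in u..w, fderiv ℝ ζ (x, w) (1, 0) * f x := by
    intro w
    apply intervalIntegral.integral_mul_deriv_eq_deriv_mul
    · intro x _
      exact hd (x, w)
    · intro x _
      exact (hf.differentiable one_ne_zero x).hasDerivAt
    · exact (hdc.comp (by fun_prop : Continuous fun x : ℝ => (x, w))).intervalIntegrable _ _
    · exact hf'c.intervalIntegrable _ _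
  have hJ : Continuous (fun w : ℝ => ∫ x in u..w, fderiv ℝ ζ (x, w) (1, 0) * f x) := by
    apply intervalIntegral.continuous_parametric_intervalIntegral_of_continuous
      (f := fun w x => fderiv ℝ ζ (x, w) (1, 0) * f x)
    · exact (hdc.comp continuous_swap).mul (hfc.comp continuous_snd)
    · exact continuous_id
  have hA : Continuous (fun w : ℝ => ζ (w, w) * f w) := by fun_prop
  have hB : Continuous (fun w : ℝ => ζ (u, w) * f u) := by fun_prop
  have hAB : Continuous (fun w : ℝ => ζ (w, w) * f w - ζ (u, w) * f u) := hA.sub hB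
  have hder : ∀ x w : ℝ, deriv (fun x => ζ (x, w)) x = fderiv ℝ ζ (x, w) (1, 0) :=
    fun x w => (hd (x, w)).deriv
  simp only [Duh, hder, hinner]
  rw [intervalIntegral.integral_sub (hAB.intervalIntegrable _ _)
      (hJ.intervalIntegrable _ _),
    intervalIntegral.integral_sub (hA.intervalIntegrable _ _) (hB.intervalIntegrable _ _),
    intervalIntegral.integral_mul_const]
  ring
end
end

section
/- Weighted L^∞ moment bounds for Brownian motion (Lemma 2.24). Let (W(x))_{x∈ℝ} be a two-sided standard Brownian motion on a probability space (Ω, 𝓕, ℙ). For every σ > 1/2 there exists a constant C(σ) > 0 such that for all p ∈ [2, ∞), all τ > 0 and all x₀ ∈ ℝ, ( 𝔼[ ( sup_{x∈ℝ} (1 + x²)^{−σ/2} · τ^{−1/2} |W(τx + x₀) − W(x₀)| )^p ] )^{1/p} ≤ C(σ) √p. -/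
noncomputable section

open Real MeasureTheory ProbabilityTheory
open scoped ENNReal NNReal

/-- A process indexed by `ℝ` is a standard Brownian motion on `[0,∞)` if it is a centered
Gaussian process with covariance `𝔼[W s W t] = min s t` for `s, t ≥ 0`, i.e. every finite
linear combination at nonnegative times is a centered Gaussian with the induced variance. -/
def IsStandardBMNonneg {Ω : Type*} [MeasurableSpace Ω] (P : Measure Ω)
    (W : ℝ → Ω → ℝ) : Prop :=
  (∀ x : ℝ, Measurable (W x)) ∧
    ∀ (n : ℕ) (t : Fin n → ℝ) (c : Fin n → ℝ), (∀ i, 0 ≤ t i) →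
      Measure.map (fun ω => ∑ i, c i * W (t i) ω) P =
        gaussianReal 0 (∑ i, ∑ j, c i * c j * min (t i) (t j)).toNNReal

/-- A two-sided standard Brownian motion: almost surely continuous paths, `W 0 = 0`, and the
two one-sided processes `(W x)_{x ≥ 0}` and `(W (−x))_{x ≥ 0}` are independent standard
Brownian motions. -/
structure IsTwoSidedBM {Ω : Type*} [MeasurableSpace Ω] (P : Measure Ω)
    (W : ℝ → Ω → ℝ) : Prop where
  cont : ∀ᵐ ω ∂P, Continuous fun x => W x ω
  zero : ∀ᵐ ω ∂P, W 0 ω = 0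
  pos : IsStandardBMNonneg P W
  neg : IsStandardBMNonneg P fun x => W (-x)
  indep : ∀ (n m : ℕ) (s : Fin n → ℝ) (t : Fin m → ℝ),
    (∀ i, 0 ≤ s i) → (∀ j, 0 ≤ t j) →
      IndepFun (fun ω i => W (s i) ω) (fun ω j => W (-t j) ω) P

lemma aux_minkowski {Ω : Type*} [MeasurableSpace Ω] (P : Measure Ω) (q : ℝ) (hq : 1 ≤ q)
    (f : ℕ → Ω → ℝ≥0∞) (hf : ∀ n, Measurable (f n)) :
    (∫⁻ ω, (∑' n, f n ω) ^ q ∂P) ^ (1 / q) ≤ ∑' n, (∫⁻ ω, (f n ω) ^ q ∂P) ^ (1 / q) := by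
  have hq0 : 0 < q := by linarith
  have hfin : ∀ N : ℕ, (∫⁻ ω, (∑ n ∈ Finset.range N, f n ω) ^ q ∂P) ^ (1 / q) ≤
      ∑ n ∈ Finset.range N, (∫⁻ ω, (f n ω) ^ q ∂P) ^ (1 / q) := by
    intro N
    induction N with
    | zero => simp [hq0]
    | succ N ih =>
      simp only [Finset.sum_range_succ]
      have hm : Measurable fun ω => ∑ n ∈ Finset.range N, f n ω :=
        Finset.measurable_fun_sum _ fun n _ => hf n
      have h := ENNReal.lintegral_Lp_add_le (μ := P) hm.aemeasurable (hf N).aemeasurable hq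
      simp only [Pi.add_apply] at h
      exact h.trans (by gcongr)
  have ht : Filter.Tendsto (fun N : ℕ => ∫⁻ ω, (∑ n ∈ Finset.range N, f n ω) ^ q ∂P)
      Filter.atTop (nhds (∫⁻ ω, (∑' n, f n ω) ^ q ∂P)) := by
    apply lintegral_tendsto_of_tendsto_of_monotone
    · intro N
      exact ((Finset.measurable_fun_sum _ fun n _ => hf n).pow_const q).aemeasurable
    · refine Filter.Eventually.of_forall fun ω => ?_
      intro a b hab
      dsimp only
      gcongr
    · refine Filter.Eventually.of_forall fun ω => ?_
      exact ((ENNReal.continuous_rpow_const (y := q)).tendsto _).comp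
        ENNReal.summable.hasSum.tendsto_sum_nat
  have ht2 := ((ENNReal.continuous_rpow_const (y := 1 / q)).tendsto _).comp ht
  refine le_of_tendsto' ht2 fun N => (hfin N).trans ?_
  exact ENNReal.sum_le_tsum _

lemma aux_gauss (q : ℝ) (hq : 1 ≤ q) (v : ℝ) (hv : 0 < v) :
    ∫⁻ x, ‖x‖ₑ ^ q ∂(gaussianReal 0 v.toNNReal) ≤ ENNReal.ofReal (2 * √q * √v) ^ q := by
  have hq0 : 0 < q := by linarith
  set t : ℝ := √q / √v with ht
  have hsq : 0 < √q := by positivity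
  have hsv : 0 < √v := by positivity
  have hqq : √q * √q = q := Real.mul_self_sqrt hq0.le
  have hvv : √v * √v = v := Real.mul_self_sqrt hv.le
  have ht0 : 0 < t := by positivity
  have key : ∀ x : ℝ, |x| ^ q ≤ (√q * √v) ^ q * exp (-q) * (exp (t * x) + exp (-t * x)) := by
    intro x
    have h1 : t * |x| / q ≤ exp (t * |x| / q - 1) := by
      have := Real.add_one_le_exp (t * |x| / q - 1); linarith
    have h2 : |x| = (√q * √v) * (t * |x| / q) := by
      rw [ht]; field_simp; rw [Real.sq_sqrt hq0.le]
    have h3 : |x| ^ q ≤ (√q * √v) ^ q * exp (t * |x| - q) := by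
      calc |x| ^ q = ((√q * √v) * (t * |x| / q)) ^ q := by rw [← h2]
        _ = (√q * √v) ^ q * (t * |x| / q) ^ q := by
            rw [Real.mul_rpow (by positivity) (by positivity)]
        _ ≤ (√q * √v) ^ q * (exp (t * |x| / q - 1)) ^ q := by gcongr
        _ = _ := by
            rw [← Real.exp_mul]; congr 2; field_simp
    have h4 : exp (t * |x|) ≤ exp (t * x) + exp (-t * x) := by
      rcases abs_cases x with ⟨h, _⟩ | ⟨h, _⟩ <;> rw [h]
      · linarith [exp_pos (-t * x)]
      · have : t * -x = -t * x := by ring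
        rw [this]; linarith [exp_pos (t * x)]
    calc |x| ^ q ≤ (√q * √v) ^ q * exp (t * |x| - q) := h3
      _ = (√q * √v) ^ q * exp (-q) * exp (t * |x|) := by
          rw [mul_assoc, ← exp_add]; congr 2; ring
      _ ≤ _ := by gcongr
  have hexpInt : ∀ s : ℝ, Integrable (fun x => exp (s * x)) (gaussianReal 0 v.toNNReal) :=
    fun s => integrable_exp_mul_gaussianReal s
  have hval : ∀ s : ℝ, ∫ x, exp (s * x) ∂(gaussianReal 0 v.toNNReal) = exp (v * s ^ 2 / 2) := by
    intro s
    have := congrFun (mgf_id_gaussianReal (μ := 0) (v := v.toNNReal)) s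
    simp only [mgf, id] at this
    rw [this, Real.coe_toNNReal _ hv.le]; simp
  have hvt : v * t ^ 2 = q := by
    rw [ht, div_pow, Real.sq_sqrt hq0.le, Real.sq_sqrt hv.le]; field_simp
  calc ∫⁻ x, ‖x‖ₑ ^ q ∂(gaussianReal 0 v.toNNReal)
      ≤ ∫⁻ x, ENNReal.ofReal ((√q * √v) ^ q * exp (-q) * (exp (t * x) + exp (-t * x)))
          ∂(gaussianReal 0 v.toNNReal) := by
        refine lintegral_mono fun x => ?_
        dsimp only
        rw [Real.enorm_eq_ofReal_abs, ENNReal.ofReal_rpow_of_nonneg (abs_nonneg _) hq0.le]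
        exact ENNReal.ofReal_le_ofReal (key x)
    _ = ENNReal.ofReal ((√q * √v) ^ q * exp (-q) * (exp (q / 2) + exp (q / 2))) := by
        rw [← ofReal_integral_eq_lintegral_ofReal]
        · rw [integral_const_mul, integral_add (hexpInt _) (hexpInt _), hval, hval, neg_sq, hvt]
        · exact ((hexpInt t).add (hexpInt (-t))).const_mul _
        · exact Filter.Eventually.of_forall fun x => by positivity
    _ ≤ ENNReal.ofReal (2 * √q * √v) ^ q := by
        rw [ENNReal.ofReal_rpow_of_nonneg (by positivity) hq0.le]
        apply ENNReal.ofReal_le_ofReal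
        rw [mul_assoc 2, Real.mul_rpow (x := 2) (by norm_num) (by positivity), mul_assoc,
          mul_comm ((2:ℝ) ^ q)]
        gcongr
        have h1 : exp (-q) * (exp (q / 2) + exp (q / 2)) = 2 * exp (-(q/2)) := by
          rw [← two_mul, mul_left_comm, ← exp_add]; congr 2; ring
        rw [h1]
        have h2 : exp (-(q/2)) ≤ 1 := Real.exp_le_one_iff.2 (by linarith)
        have h3 : (2:ℝ) ^ (1:ℝ) ≤ 2 ^ q := Real.rpow_le_rpow_of_exponent_le (by norm_num) hq
        rw [Real.rpow_one] at h3
        linarith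

lemma aux_chain (f : ℝ → ℝ) (hf : Continuous f) (q : ℝ) (hq : 1 ≤ q) (L : ℝ) (hL : 0 < L)
    (x : ℝ) (hx0 : 0 ≤ x) (hxL : x < L) :
    ‖f x - f 0‖ₑ ≤ ∑' n : ℕ, (∑ j ∈ Finset.range (2 ^ n),
      ‖f (L * ((j + 1 : ℕ) / 2 ^ n)) - f (L * (j / 2 ^ n))‖ₑ ^ q) ^ (1 / q) := by
  have hq0 : 0 < q := by linarith
  set A : ℕ → ℝ≥0∞ := fun n => (∑ j ∈ Finset.range (2 ^ n),
      ‖f (L * ((j + 1 : ℕ) / 2 ^ n)) - f (L * (j / 2 ^ n))‖ₑ ^ q) ^ (1 / q) with hA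
  have hAj : ∀ n j : ℕ, j < 2 ^ n →
      ‖f (L * ((j + 1 : ℕ) / 2 ^ n)) - f (L * (j / 2 ^ n))‖ₑ ≤ A n := by
    intro n j hj
    rw [hA]
    dsimp only
    rw [one_div, ENNReal.le_rpow_inv_iff hq0]
    exact Finset.single_le_sum
      (f := fun j : ℕ => ‖f (L * ((j + 1 : ℕ) / 2 ^ n)) - f (L * (j / 2 ^ n))‖ₑ ^ q)
      (fun _ _ => zero_le) (Finset.mem_range.2 hj)
  set y := x / L with hy
  have hy0 : 0 ≤ y := by positivity
  have hy1 : y < 1 := by rw [hy, div_lt_one hL]; exact hxL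
  set d : ℕ → ℕ := fun n => ⌊2 ^ n * y⌋₊ with hd
  have hdlt : ∀ n, d n < 2 ^ n := by
    intro n
    rw [hd]; dsimp only
    rw [Nat.floor_lt (by positivity)]
    push_cast
    have : (0:ℝ) < 2 ^ n := by positivity
    nlinarith
  have hdle : ∀ n, (d n : ℝ) ≤ 2 ^ n * y := fun n => Nat.floor_le (by positivity)
  have hdlt' : ∀ n, 2 ^ n * y < (d n : ℝ) + 1 := fun n => Nat.lt_floor_add_one _
  have hstep : ∀ n, d (n + 1) = 2 * d n ∨ d (n + 1) = 2 * d n + 1 := by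
    intro n
    have h1 := hdle n
    have h2 := hdlt' n
    have h3 := hdle (n+1)
    have h4 := hdlt' (n+1)
    rw [pow_succ] at h3 h4
    have h5 : (2 * d n : ℝ) < (d (n+1) : ℝ) + 1 := by nlinarith
    have h6 : (d (n+1) : ℝ) < 2 * d n + 2 := by nlinarith
    have h5' : 2 * d n < d (n+1) + 1 := by exact_mod_cast h5
    have h6' : d (n+1) < 2 * d n + 2 := by exact_mod_cast h6
    omega
  have hbound : ∀ N, ‖f (L * (d N / 2 ^ N)) - f 0‖ₑ ≤ ∑ n ∈ Finset.range (N + 1), A n := by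
    intro N
    induction N with
    | zero =>
      have : d 0 = 0 := by have := hdlt 0; simpa using this
      simp [this]
    | succ N ih =>
      rw [Finset.sum_range_succ]
      have e : L * (((2 * d N : ℕ) : ℝ) / 2 ^ (N + 1)) = L * (d N / 2 ^ N) := by
        push_cast; rw [pow_succ]; field_simp
      rcases hstep N with h | h
      · rw [h, e]; exact ih.trans le_self_add
      · have h7 := hAj (N+1) (2 * d N) (by have := hdlt N; rw [pow_succ]; omega)
        rw [e] at h7
        rw [h]
        have : f (L * (((2 * d N + 1 : ℕ) : ℝ) / 2 ^ (N + 1))) - f 0 =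
          (f (L * (d N / 2 ^ N)) - f 0) +
          (f (L * (((2 * d N + 1 : ℕ) : ℝ) / 2 ^ (N + 1))) - f (L * (d N / 2 ^ N))) := by ring
        rw [this]
        exact (enorm_add_le _ _).trans (add_le_add ih h7)
  have hlim : Filter.Tendsto (fun N : ℕ => L * ((d N : ℝ) / 2 ^ N)) Filter.atTop (nhds x) := by
    have h2 : Filter.Tendsto (fun N : ℕ => (d N : ℝ) / 2 ^ N) Filter.atTop (nhds y) := by
      have h3 : Filter.Tendsto (fun N : ℕ => y - (1 / 2 : ℝ) ^ N) Filter.atTop (nhds (y - 0)) :=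
        tendsto_const_nhds.sub (tendsto_pow_atTop_nhds_zero_of_lt_one (by norm_num) (by norm_num))
      rw [sub_zero] at h3
      refine tendsto_of_tendsto_of_tendsto_of_le_of_le h3 tendsto_const_nhds ?_ ?_
      · intro N
        have := hdlt' N
        have hp : (0:ℝ) < 2 ^ N := by positivity
        dsimp only
        rw [le_div_iff₀ hp, sub_mul, one_div, inv_pow, inv_mul_cancel₀ hp.ne']
        linarith
      · intro N
        have hp : (0:ℝ) < 2 ^ N := by positivity
        dsimp only
        rw [div_le_iff₀ hp, mul_comm]; exact hdle N
    have h3 := h2.const_mul L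
    have : L * y = x := by rw [hy]; field_simp
    rwa [this] at h3
  have hlim2 : Filter.Tendsto (fun N : ℕ => ‖f (L * ((d N : ℝ) / 2 ^ N)) - f 0‖ₑ) Filter.atTop
      (nhds ‖f x - f 0‖ₑ) :=
    (((hf.tendsto x).comp hlim).sub_const (f 0)).enorm
  exact le_of_tendsto' hlim2 fun N => (hbound N).trans (ENNReal.sum_le_tsum _)

lemma aux_level {Ω : Type*} [MeasurableSpace Ω] (P : Measure Ω)
    (Z : ℝ → Ω → ℝ) (hZ : ∀ x, Measurable (Z x)) (q : ℝ) (hq : 4 ≤ q) (K : ℝ) (hK : 0 ≤ K)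
    (hinc : ∀ s t, ∫⁻ ω, ‖Z s ω - Z t ω‖ₑ ^ q ∂P ≤ ENNReal.ofReal (K * √|s - t|) ^ q)
    (L : ℝ) (hL : 0 < L) :
    (∫⁻ ω, (∑' n : ℕ, (∑ j ∈ Finset.range (2 ^ n),
      ‖Z (L * ((j + 1 : ℕ) / 2 ^ n)) ω - Z (L * (j / 2 ^ n)) ω‖ₑ ^ q) ^ (1 / q)) ^ q ∂P) ^ (1 / q)
      ≤ ENNReal.ofReal (K * √L * ∑' n : ℕ, ((2:ℝ) ^ (-(1/4) : ℝ)) ^ n) := by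
  have hq0 : 0 < q := by linarith
  have hmeas : ∀ n j : ℕ, Measurable fun ω =>
    ‖Z (L * ((j + 1 : ℕ) / 2 ^ n)) ω - Z (L * (j / 2 ^ n)) ω‖ₑ ^ q := fun n j =>
      (((hZ _).sub (hZ _)).enorm).pow_const q
  refine (aux_minkowski P q (by linarith) _ fun n =>
    (Finset.measurable_fun_sum _ fun j _ => hmeas n j).pow_const _).trans ?_
  have hr0 : (0:ℝ) ≤ (2:ℝ) ^ (-(1/4) : ℝ) := by positivity
  have hr1 : (2:ℝ) ^ (-(1/4) : ℝ) < 1 :=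
    Real.rpow_lt_one_of_one_lt_of_neg (by norm_num) (by norm_num)
  rw [← tsum_mul_left, ENNReal.ofReal_tsum_of_nonneg (fun n => by positivity)
    ((summable_geometric_of_lt_one hr0 hr1).mul_left _)]
  refine ENNReal.tsum_le_tsum fun n => ?_
  have h1 : ∀ ω, ((∑ j ∈ Finset.range (2 ^ n),
      ‖Z (L * ((j + 1 : ℕ) / 2 ^ n)) ω - Z (L * (j / 2 ^ n)) ω‖ₑ ^ q) ^ (1 / q)) ^ q =
      ∑ j ∈ Finset.range (2 ^ n),
      ‖Z (L * ((j + 1 : ℕ) / 2 ^ n)) ω - Z (L * (j / 2 ^ n)) ω‖ₑ ^ q := fun ω => by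
    rw [← ENNReal.rpow_mul, one_div_mul_cancel hq0.ne', ENNReal.rpow_one]
  simp only [h1]
  rw [lintegral_finsetSum _ fun j _ => hmeas n j]
  have h2 : ∑ j ∈ Finset.range (2 ^ n), ∫⁻ ω,
      ‖Z (L * ((j + 1 : ℕ) / 2 ^ n)) ω - Z (L * (j / 2 ^ n)) ω‖ₑ ^ q ∂P ≤
      ENNReal.ofReal (2 ^ n) * ENNReal.ofReal (K * √(L / 2 ^ n)) ^ q := by
    calc _ ≤ ∑ j ∈ Finset.range (2 ^ n), ENNReal.ofReal (K * √(L / 2 ^ n)) ^ q := by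
            refine Finset.sum_le_sum fun j _ => (hinc _ _).trans (le_of_eq ?_)
            have : L * (((j + 1 : ℕ) : ℝ) / 2 ^ n) - L * (j / 2 ^ n) = L / 2 ^ n := by
              push_cast; ring
            rw [this, abs_of_pos (by positivity)]
      _ = _ := by
        rw [Finset.sum_const, Finset.card_range, nsmul_eq_mul]
        congr 1
        rw [ENNReal.ofReal_pow (by norm_num)]; simp
  calc _ ≤ (ENNReal.ofReal (2 ^ n) * ENNReal.ofReal (K * √(L / 2 ^ n)) ^ q) ^ (1 / q) := by
          gcongr
    _ = ENNReal.ofReal ((2 ^ n) ^ (1 / q) * (K * √(L / 2 ^ n))) := by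
        rw [ENNReal.mul_rpow_of_nonneg _ _ (by positivity), ← ENNReal.rpow_mul,
          mul_one_div_cancel hq0.ne', ENNReal.rpow_one,
          ENNReal.ofReal_rpow_of_nonneg (by positivity) (by positivity),
          ← ENNReal.ofReal_mul (by positivity)]
    _ ≤ _ := by
        apply ENNReal.ofReal_le_ofReal
        have h3 : ((2:ℝ) ^ n) ^ (1 / q) ≤ ((2:ℝ) ^ n) ^ (1 / 4 : ℝ) := by
          apply Real.rpow_le_rpow_of_exponent_le (one_le_pow₀ (by norm_num))
          exact one_div_le_one_div_of_le (by norm_num) hq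
        have h4 : ((2:ℝ) ^ n) ^ (1 / 4 : ℝ) / √(2 ^ n) = ((2:ℝ) ^ (-(1/4) : ℝ)) ^ n := by
          rw [Real.sqrt_eq_rpow, ← Real.rpow_sub (by positivity), ← Real.rpow_natCast,
            ← Real.rpow_natCast, ← Real.rpow_mul (by norm_num), ← Real.rpow_mul (by norm_num)]
          congr 1; ring
        rw [← h4, Real.sqrt_div hL.le]
        calc _ ≤ ((2:ℝ) ^ n) ^ (1 / 4 : ℝ) * (K * (√L / √(2 ^ n))) := by gcongr
          _ = _ := by ring

lemma aux_inc_pos {Ω : Type*} [MeasurableSpace Ω] (P : Measure Ω)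
    (W : ℝ → Ω → ℝ) (hW : IsStandardBMNonneg P W) (q : ℝ) (hq : 1 ≤ q)
    (s t : ℝ) (hs : 0 ≤ s) (ht : 0 ≤ t) :
    ∫⁻ ω, ‖W s ω - W t ω‖ₑ ^ q ∂P ≤ ENNReal.ofReal (2 * √q * √|s - t|) ^ q := by
  have hq0 : 0 < q := by linarith
  rcases eq_or_ne s t with rfl | hne
  · simp [hq0]
  have h := hW.2 2 ![s, t] ![1, -1] (by intro i; fin_cases i <;> simpa)
  have hv : (∑ i : Fin 2, ∑ j : Fin 2, (![1, -1] : Fin 2 → ℝ) i * (![1, -1] : Fin 2 → ℝ) j *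
      min ((![s, t] : Fin 2 → ℝ) i) ((![s, t] : Fin 2 → ℝ) j)) = |s - t| := by
    simp only [Fin.sum_univ_two, Matrix.cons_val_zero, Matrix.cons_val_one, min_self]
    rcases le_total s t with h | h
    · rw [min_eq_left h, min_eq_right h, abs_of_nonpos (by linarith)]; ring
    · rw [min_eq_right h, min_eq_left h, abs_of_nonneg (by linarith)]; ring
  have hf : (fun ω => ∑ i : Fin 2, (![1, -1] : Fin 2 → ℝ) i * W ((![s, t] : Fin 2 → ℝ) i) ω) =
      fun ω => W s ω - W t ω := by
    funext ω
    simp only [Fin.sum_univ_two, Matrix.cons_val_zero, Matrix.cons_val_one]; ring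
  rw [hv, hf] at h
  have hm : Measurable fun ω => W s ω - W t ω := (hW.1 s).sub (hW.1 t)
  have h2 := aux_gauss q hq |s - t| (abs_pos.2 (sub_ne_zero.2 hne))
  rw [← h, lintegral_map (by fun_prop) hm] at h2
  exact h2

lemma aux_inc {Ω : Type*} [MeasurableSpace Ω] (P : Measure Ω)
    (W : ℝ → Ω → ℝ) (hW : IsTwoSidedBM P W) (q : ℝ) (hq : 1 ≤ q) (s t : ℝ) :
    ∫⁻ ω, ‖W s ω - W t ω‖ₑ ^ q ∂P ≤ ENNReal.ofReal (4 * √q * √|s - t|) ^ q := by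
  have hq0 : 0 < q := by linarith
  wlog hst : t ≤ s generalizing s t
  · have := this t s (by linarith)
    rw [abs_sub_comm] at this
    refine le_trans (le_of_eq ?_) this
    refine lintegral_congr fun ω => ?_
    rw [← enorm_neg, neg_sub]
  have hpn : ∀ a b : ℝ, (0 ≤ a ∧ 0 ≤ b) ∨ (a ≤ 0 ∧ b ≤ 0) →
      ∫⁻ ω, ‖W a ω - W b ω‖ₑ ^ q ∂P ≤ ENNReal.ofReal (2 * √q * √|a - b|) ^ q := by
    rintro a b (⟨ha, hb⟩ | ⟨ha, hb⟩)
    · exact aux_inc_pos P W hW.pos q hq a b ha hb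
    · have := aux_inc_pos P _ hW.neg q hq (-a) (-b) (by linarith) (by linarith)
      simp only [neg_neg] at this
      rwa [← abs_neg, show -(-a - -b) = a - b by ring] at this
  by_cases hc : (0 ≤ s ∧ 0 ≤ t) ∨ (s ≤ 0 ∧ t ≤ 0)
  · refine (hpn s t hc).trans ?_
    gcongr; norm_num
  · have hs : 0 ≤ s := by
      by_contra h; exact hc (Or.inr ⟨by linarith, by linarith⟩)
    have ht : t ≤ 0 := by
      by_contra h; exact hc (Or.inl ⟨by linarith, by linarith⟩)
    have h1 := hpn s 0 (Or.inl ⟨hs, le_rfl⟩)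
    have h2 := hpn 0 t (Or.inr ⟨le_rfl, ht⟩)
    have hm : ∀ x, Measurable (W x) := hW.pos.1
    have h3 := ENNReal.lintegral_Lp_add_le (μ := P) (f := fun ω => ‖W s ω - W 0 ω‖ₑ)
      (g := fun ω => ‖W 0 ω - W t ω‖ₑ) ((hm s).sub (hm 0)).enorm.aemeasurable
      ((hm 0).sub (hm t)).enorm.aemeasurable hq
    have hroot : ∀ (A : ℝ≥0∞) (B : ℝ≥0∞), A ≤ B ^ q → A ^ (1 / q) ≤ B := fun A B hAB => by
      rw [one_div, ENNReal.rpow_inv_le_iff hq0]; exact hAB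
    have hle : ∀ u, u ≤ |s - t| → ENNReal.ofReal (2 * √q * √u) ≤
        ENNReal.ofReal (2 * √q * √|s - t|) := fun u hu => by gcongr
    have h4 := (hroot _ _ h1).trans (hle _ (by
      rw [abs_of_nonneg (by linarith), abs_of_nonneg (by linarith)]; linarith))
    have h5 := (hroot _ _ h2).trans (hle _ (by
      rw [abs_of_nonneg (by linarith), abs_of_nonneg (by linarith)]; linarith))
    have h6 := h3.trans (add_le_add h4 h5)
    rw [← ENNReal.ofReal_add (by positivity) (by positivity), one_div,
      ENNReal.rpow_inv_le_iff hq0] at h6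
    have e : 2 * √q * √|s - t| + 2 * √q * √|s - t| = 4 * √q * √|s - t| := by ring
    rw [e] at h6
    refine le_trans (lintegral_mono fun ω => ?_) h6
    simp only [Pi.add_apply]
    gcongr
    have : W s ω - W t ω = (W s ω - W 0 ω) + (W 0 ω - W t ω) := by ring
    rw [this]; exact enorm_add_le _ _

lemma aux_weight (σ : ℝ) (hσ : 0 < σ) (x : ℝ) :
    ∃ k : ℕ, |x| < 2 ^ k ∧ (1 + x ^ 2) ^ (-σ / 2) ≤ 2 ^ σ * ((2:ℝ) ^ (-σ)) ^ k := by
  classical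
  have hex : ∃ k : ℕ, |x| < 2 ^ k := pow_unbounded_of_one_lt _ (by norm_num)
  refine ⟨Nat.find hex, Nat.find_spec hex, ?_⟩
  have hmin := fun m => Nat.find_min (H := hex) (m := m)
  generalize Nat.find hex = k at hmin
  have h1 : ((2:ℝ) ^ k / 2) ^ 2 ≤ 1 + x ^ 2 := by
    cases k with
    | zero => norm_num; nlinarith [sq_nonneg x]
    | succ m =>
      have := hmin m (by omega)
      rw [not_lt] at this
      have h3 : ((2:ℝ) ^ (m + 1) / 2) = 2 ^ m := by rw [pow_succ]; ring
      rw [h3, ← sq_abs x]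
      have : ((2:ℝ) ^ m) ^ 2 ≤ |x| ^ 2 := by gcongr
      linarith
  calc (1 + x ^ 2) ^ (-σ / 2) ≤ (((2:ℝ) ^ k / 2) ^ 2) ^ (-σ / 2) :=
        Real.rpow_le_rpow_of_nonpos (by positivity) h1 (by linarith)
    _ = _ := by
        rw [← Real.rpow_natCast, ← Real.rpow_mul (by positivity), Real.div_rpow (by positivity)
          (by positivity), ← Real.rpow_natCast, ← Real.rpow_natCast, ← Real.rpow_mul (by norm_num),
          ← Real.rpow_mul (by norm_num), ← Real.rpow_sub (by norm_num),
          ← Real.rpow_add (by norm_num)]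
        congr 1; push_cast; ring

/-- The dyadic chaining majorant. -/
def auxD {Ω : Type*} (Z : ℝ → Ω → ℝ) (q L : ℝ) (ω : Ω) : ℝ≥0∞ :=
  ∑' n : ℕ, (∑ j ∈ Finset.range (2 ^ n),
      ‖Z (L * ((j + 1 : ℕ) / 2 ^ n)) ω - Z (L * (j / 2 ^ n)) ω‖ₑ ^ q) ^ (1 / q)

lemma auxD_meas {Ω : Type*} [MeasurableSpace Ω] (Z : ℝ → Ω → ℝ) (hZ : ∀ x, Measurable (Z x))
    (q L : ℝ) : Measurable (auxD Z q L) := by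
  unfold auxD
  refine Measurable.tsum fun n => ?_
  refine Measurable.pow_const (Finset.measurable_fun_sum _ fun j _ => ?_) _
  exact (((hZ _).sub (hZ _)).enorm).pow_const q

/-- **Lemma 2.24: weighted `L^∞` moment bounds for Brownian motion.**
For every `σ > 1/2` there is `C(σ) > 0` such that for all `p ≥ 2`, `τ > 0` and `x₀ ∈ ℝ`,
`‖ sup_x ⟨x⟩^{−σ} τ^{−1/2} |W(τx + x₀) − W(x₀)| ‖_{L^p_ω} ≤ C(σ) √p`. -/
theorem bm_weighted_linfty_moment
    {Ω : Type*} [MeasurableSpace Ω] (P : Measure Ω) [IsProbabilityMeasure P]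
    (W : ℝ → Ω → ℝ) (hW : IsTwoSidedBM P W)
    (σ : ℝ) (hσ : 1 / 2 < σ) :
    ∃ C : ℝ, 0 < C ∧ ∀ p : ℝ, 2 ≤ p → ∀ τ : ℝ, 0 < τ → ∀ x₀ : ℝ,
      (∫⁻ ω, (⨆ x : ℝ, ENNReal.ofReal
          ((1 + x ^ 2) ^ (-σ / 2) *
            (τ ^ (-(1 : ℝ) / 2) * |W (τ * x + x₀) ω - W x₀ ω|))) ^ p ∂P) ^ (1 / p) ≤
        ENNReal.ofReal (C * Real.sqrt p) := by
  set G : ℝ := ∑' n : ℕ, ((2:ℝ) ^ (-(1/4) : ℝ)) ^ n with hG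
  set r : ℝ := (2:ℝ) ^ (1 / 2 - σ) with hr
  set S : ℝ := ∑' k : ℕ, r ^ k with hS
  have hg1 : (2:ℝ) ^ (-(1/4) : ℝ) < 1 :=
    Real.rpow_lt_one_of_one_lt_of_neg (by norm_num) (by norm_num)
  have hr0 : 0 < r := by positivity
  have hr1 : r < 1 := Real.rpow_lt_one_of_one_lt_of_neg (by norm_num) (by linarith)
  have hG0 : 0 < G := by
    rw [hG, tsum_geometric_of_lt_one (by positivity) hg1]
    exact inv_pos.2 (by linarith)
  have hSs : Summable fun k : ℕ => r ^ k := summable_geometric_of_lt_one hr0.le hr1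
  have hS0 : 0 < S := by
    rw [hS, tsum_geometric_of_lt_one hr0.le hr1]
    exact inv_pos.2 (by linarith)
  refine ⟨8 * 2 ^ σ * √2 * G * S, by positivity, ?_⟩
  intro p hp τ hτ x₀
  have hp0 : 0 < p := by linarith
  set q : ℝ := 2 * p with hq
  have hq4 : 4 ≤ q := by linarith
  have hq0 : 0 < q := by linarith
  have hWm : ∀ x, Measurable (W x) := hW.pos.1
  let Z : ℝ → ℝ → Ω → ℝ := fun ε x ω => W (τ * (ε * x) + x₀) ω
  have hZm : ∀ ε x, Measurable (Z ε x) := fun ε x => hWm _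
  have hZinc : ∀ ε, |ε| = 1 → ∀ s t, ∫⁻ ω, ‖Z ε s ω - Z ε t ω‖ₑ ^ q ∂P ≤
      ENNReal.ofReal (4 * √q * √τ * √|s - t|) ^ q := by
    intro ε hε s t
    refine (aux_inc P W hW q (by linarith) _ _).trans (le_of_eq ?_)
    have : τ * (ε * s) + x₀ - (τ * (ε * t) + x₀) = τ * (ε * (s - t)) := by ring
    rw [this, abs_mul, abs_mul, hε, one_mul, abs_of_pos hτ, Real.sqrt_mul hτ.le, mul_assoc (4 * √q)]
  let D : ℝ → ℕ → Ω → ℝ≥0∞ := fun ε k => auxD (Z ε) q (2 ^ k)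
  have hDm : ∀ ε k, Measurable (D ε k) := fun ε k => auxD_meas _ (hZm ε) _ _
  have hDN : ∀ ε, |ε| = 1 → ∀ k, (∫⁻ ω, (D ε k ω) ^ q ∂P) ^ (1 / q) ≤
      ENNReal.ofReal (4 * √q * √τ * √(2 ^ k) * G) := fun ε hε k =>
    aux_level P (Z ε) (hZm ε) q hq4 _ (by positivity) (hZinc ε hε) (2 ^ k) (by positivity)
  let c : ℕ → ℝ := fun k => (2 ^ σ * ((2:ℝ) ^ (-σ)) ^ k) * τ ^ (-(1 : ℝ) / 2)
  have hc0 : ∀ k, 0 ≤ c k := fun k => by positivity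
  let M : Ω → ℝ≥0∞ := fun ω => ∑' k, ENNReal.ofReal (c k) * (D 1 k ω + D (-1) k ω)
  have hMm : Measurable M :=
    Measurable.tsum fun k => ((hDm 1 k).add (hDm (-1) k)).const_mul _
  have hae : ∀ᵐ ω ∂P, (⨆ x : ℝ, ENNReal.ofReal
          ((1 + x ^ 2) ^ (-σ / 2) *
            (τ ^ (-(1 : ℝ) / 2) * |W (τ * x + x₀) ω - W x₀ ω|))) ≤ M ω := by
    filter_upwards [hW.cont] with ω hω
    refine iSup_le fun x => ?_
    obtain ⟨k, hk, hw⟩ := aux_weight σ (by linarith) x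
    have hch : ∀ ε y : ℝ, 0 ≤ y → y < 2 ^ k →
        ‖W (τ * (ε * y) + x₀) ω - W x₀ ω‖ₑ ≤ D ε k ω := by
      intro ε y hy0 hy1
      have h := aux_chain (fun x => Z ε x ω) (hω.comp (by fun_prop)) q (by linarith) (2 ^ k)
        (by positivity) y hy0 hy1
      simpa [Z, D, auxD] using h
    have hx : ‖W (τ * x + x₀) ω - W x₀ ω‖ₑ ≤ D 1 k ω + D (-1) k ω := by
      rcases le_total 0 x with h0 | h0
      · rw [abs_of_nonneg h0] at hk
        have := hch 1 x h0 hk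
        rw [one_mul] at this
        exact this.trans le_self_add
      · rw [abs_of_nonpos h0] at hk
        have := hch (-1) (-x) (by linarith) hk
        rw [neg_one_mul, neg_neg] at this
        exact this.trans le_add_self
    calc _ ≤ ENNReal.ofReal (c k * |W (τ * x + x₀) ω - W x₀ ω|) := by
            apply ENNReal.ofReal_le_ofReal
            rw [← mul_assoc]
            refine mul_le_mul_of_nonneg_right ?_ (abs_nonneg _)
            exact mul_le_mul_of_nonneg_right hw (by positivity)
      _ = ENNReal.ofReal (c k) * ‖W (τ * x + x₀) ω - W x₀ ω‖ₑ := by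
            rw [ENNReal.ofReal_mul (hc0 k), Real.enorm_eq_ofReal_abs]
      _ ≤ ENNReal.ofReal (c k) * (D 1 k ω + D (-1) k ω) := by gcongr
      _ ≤ M ω := ENNReal.le_tsum (f := fun k => ENNReal.ofReal (c k) * (D 1 k ω + D (-1) k ω)) k
  have hMN : (∫⁻ ω, (M ω) ^ q ∂P) ^ (1 / q) ≤
      ENNReal.ofReal (8 * 2 ^ σ * √2 * G * S * √p) := by
    refine (aux_minkowski P q (by linarith) _ fun k =>
      ((hDm 1 k).add (hDm (-1) k)).const_mul _).trans ?_
    have e : 8 * 2 ^ σ * √2 * G * S * √p = ∑' k : ℕ, (8 * 2 ^ σ * √q * G) * r ^ k := by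
      rw [tsum_mul_left, hq, Real.sqrt_mul (by norm_num)]; ring
    rw [e, ENNReal.ofReal_tsum_of_nonneg (fun k => by positivity) (hSs.mul_left _)]
    refine ENNReal.tsum_le_tsum fun k => ?_
    have h1 := ENNReal.lintegral_Lp_add_le (μ := P) (hDm 1 k).aemeasurable
      (hDm (-1) k).aemeasurable (show 1 ≤ q by linarith)
    have h2 := h1.trans (add_le_add (hDN 1 (by simp) k) (hDN (-1) (by simp) k))
    simp only [Pi.add_apply] at h2
    simp only [ENNReal.mul_rpow_of_nonneg _ _ hq0.le]
    rw [lintegral_const_mul _ (((hDm 1 k).add (hDm (-1) k)).pow_const q),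
      ENNReal.mul_rpow_of_nonneg _ _ (by positivity), ← ENNReal.rpow_mul,
      mul_one_div_cancel hq0.ne', ENNReal.rpow_one]
    refine (mul_le_mul_right h2 _).trans (le_of_eq ?_)
    rw [← ENNReal.ofReal_add (by positivity) (by positivity), ← ENNReal.ofReal_mul (hc0 k)]
    congr 1
    have h3 : τ ^ (-(1 : ℝ) / 2) * √τ = 1 := by
      rw [Real.sqrt_eq_rpow, ← Real.rpow_add hτ]; norm_num
    have h4 : r ^ k = ((2:ℝ) ^ (-σ)) ^ k * √(2 ^ k) := by
      rw [hr, sub_eq_neg_add, Real.rpow_add (by norm_num), mul_pow, ← Real.sqrt_eq_rpow]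
      congr 1
      rw [Real.sqrt_eq_rpow, Real.sqrt_eq_rpow, ← Real.rpow_natCast, ← Real.rpow_natCast,
        ← Real.rpow_mul (by norm_num), ← Real.rpow_mul (by norm_num), mul_comm]
    rw [h4]
    calc _ = (8 * 2 ^ σ * √q * G * (((2:ℝ) ^ (-σ)) ^ k * √(2 ^ k))) *
        (τ ^ (-(1 : ℝ) / 2) * √τ) := by simp only [c]; ring
      _ = _ := by rw [h3, mul_one]
  calc _ ≤ (∫⁻ ω, (M ω) ^ p ∂P) ^ (1 / p) := by
        gcongr ?_ ^ _
        refine lintegral_mono_ae ?_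
        filter_upwards [hae] with ω hω
        gcongr
    _ ≤ (∫⁻ ω, (M ω) ^ q ∂P) ^ (1 / q) := by
        have := eLpNorm'_le_eLpNorm'_of_exponent_le (μ := P) (f := M) hp0
          (show p ≤ q by linarith) hMm.aestronglyMeasurable
        simpa [eLpNorm'] using this
    _ ≤ _ := hMN
end
end

section
/- Bilinear bounds encoded by the enhanced data norm (Lemma 3.4). Let D ≥ 1 and let 0 < s ≤ r ≤ 1. There exists a constant C = C(s, r) such that for all C_b^∞ maps φ⁺ = (φ^{+,1},…,φ^{+,D}), φ⁻ = (φ^{−,1},…,φ^{−,D}): ℝ → ℝ^D, all signs ±₁, ±₂ ∈ {+,−}, all 1 ≤ m, n ≤ D, and all dyadic scales M, N, one has ‖P_M φ^{±₁,m} · (P_N φ^{±₂,n})'‖_{C^{r−1}} ≤ C ( 1{M ≤ 2^{10}N} M^{−s} N^{r−s} + 1{M > 2^{10}N} M^{r−1−s} N^{1−s} ) ‖(φ⁺,φ⁻)‖_{𝔇ˢ}² ≤ C M^{−s} N^{r−s} ‖(φ⁺,φ⁻)‖_{𝔇ˢ}², where 1{·} denotes the indicator of the stated condition and the inequalities are in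 [0,∞]. -/
noncomputable section

open Real MeasureTheory
open scoped ENNReal Classical NNReal

/-- The enhanced data norm `‖(φ⁺, φ⁻)‖_{𝔇ˢ}`: the maximum of (a) the `C^s` norms of the
components, (b) the square roots of the high×high→low products `M^s ‖P_M φ^{±₁,m} ·
(P_N φ^{±₂,n})′‖_{C^{s−1}}` over comparable dyadic scales `M ∼ N`, and (c) the corresponding
shifted products for opposite signs `±₁ ≠ ±₂`, uniformly in the shift `t`. (`b = true`
selects `φ⁺`, `b = false` selects `φ⁻`.) -/
def dsNorm (ρ : ℝ → ℝ) {D : ℕ} (s : ℝ) (φp φm : ℝ → Fin D → ℝ) : ℝ≥0∞ :=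
  max
    ((⨆ m : Fin D, hNorm ρ s fun x => φp x m) +
      ⨆ n : Fin D, hNorm ρ s fun x => φm x n)
    (max
      (⨆ b₁ : Bool, ⨆ b₂ : Bool, ⨆ m : Fin D, ⨆ n : Fin D,
        ⨆ kM : ℕ, ⨆ kN : ℕ, ⨆ _ : DClose kM kN,
          (ENNReal.ofReal (((2 : ℝ) ^ kM) ^ s) *
              hNorm ρ (s - 1) fun x =>
                LP ρ kM (fun y => (if b₁ then φp else φm) y m) x *
                  deriv (LP ρ kN (fun y => (if b₂ then φp else φm) y n)) x) ^
            ((1 : ℝ) / 2))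
      (⨆ b₁ : Bool, ⨆ b₂ : Bool, ⨆ _ : b₁ ≠ b₂, ⨆ m : Fin D, ⨆ n : Fin D,
        ⨆ kM : ℕ, ⨆ kN : ℕ, ⨆ _ : DClose kM kN, ⨆ t : ℝ,
          (ENNReal.ofReal (((2 : ℝ) ^ kM) ^ s) *
              hNorm ρ (s - 1) fun x =>
                LP ρ kM (fun y => (if b₁ then φp else φm) y m) (x - t) *
                  deriv (LP ρ kN (fun y => (if b₂ then φp else φm) y n)) (x + t)) ^
            ((1 : ℝ) / 2)))


namespace EDB

open FourierTransform SchwartzMap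

/-- Symbols: smooth, even, compactly supported. -/
structure IsSym (σ : ℝ → ℝ) : Prop where
  smooth : ContDiff ℝ (⊤ : ℕ∞) σ
  even : ∀ ξ, σ (-ξ) = σ ξ
  supp : ∃ R : ℝ, 0 < R ∧ ∀ ξ : ℝ, R ≤ |ξ| → σ ξ = 0

theorem IsSym.hcs {σ : ℝ → ℝ} (h : IsSym σ) : HasCompactSupport σ := by
  obtain ⟨R, hR, h0⟩ := h.supp
  refine HasCompactSupport.intro (isCompact_closedBall (0 : ℝ) R) ?_
  intro x hx
  apply h0
  simp at hx
  exact hx.le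

theorem integral_sin_zero {σ : ℝ → ℝ} (h : IsSym σ) (x : ℝ) :
    ∫ ξ : ℝ, Real.sin (x * ξ) * σ ξ = 0 := by
  have h1 := integral_neg_eq_self (fun ξ : ℝ => Real.sin (x * ξ) * σ ξ) volume
  simp only [h.even, mul_neg, Real.sin_neg, neg_mul] at h1
  rw [integral_neg] at h1
  linarith

theorem invFourier_eq_complex {σ : ℝ → ℝ} (h : IsSym σ) (x : ℝ) :
    ((∫ ξ : ℝ, Real.cos (x * ξ) * σ ξ : ℝ) : ℂ) =
      ∫ ξ : ℝ, Complex.exp (-(x * ξ : ℝ) * Complex.I) * (σ ξ : ℂ) := by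
  have hc := h.hcs
  have hcont := h.smooth.continuous
  have i1 : Integrable (fun ξ : ℝ => Real.cos (x * ξ) * σ ξ) :=
    Continuous.integrable_of_hasCompactSupport (by fun_prop) hc.mul_left
  have i2 : Integrable (fun ξ : ℝ => Real.sin (x * ξ) * σ ξ) :=
    Continuous.integrable_of_hasCompactSupport (by fun_prop) hc.mul_left
  have e : ∀ ξ : ℝ, Complex.exp (-(x * ξ : ℝ) * Complex.I) * (σ ξ : ℂ) =
      ((Real.cos (x * ξ) * σ ξ : ℝ) : ℂ) - ((Real.sin (x * ξ) * σ ξ : ℝ) : ℂ) * Complex.I := by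
    intro ξ
    have : (-(x * ξ : ℝ) : ℂ) = ((-(x * ξ) : ℝ) : ℂ) := by push_cast; ring
    rw [this, Complex.exp_mul_I, ← Complex.ofReal_cos, ← Complex.ofReal_sin, Real.cos_neg,
      Real.sin_neg]
    push_cast
    ring
  simp_rw [e]
  rw [integral_sub i1.ofReal (i2.ofReal.mul_const _), integral_mul_const, integral_complex_ofReal,
    integral_complex_ofReal, integral_sin_zero h]
  simp

/-- The rescaled symbol. -/
theorem exists_symS {σ : ℝ → ℝ} (h : IsSym σ) :
    ∃ T : 𝓢(ℝ, ℂ), ∀ ξ, T ξ = ((Real.sqrt (2 * π) * σ (2 * π * ξ) : ℝ) : ℂ) := by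
  obtain ⟨R, hR, h0⟩ := h.supp
  have h1 : HasCompactSupport
      (fun ξ : ℝ => ((Real.sqrt (2 * π) * σ (2 * π * ξ) : ℝ) : ℂ)) := by
    refine HasCompactSupport.intro (isCompact_closedBall (0 : ℝ) R) ?_
    intro x hx
    have : σ (2 * π * x) = 0 := by
      apply h0
      simp at hx
      rw [abs_mul, abs_of_pos Real.two_pi_pos]
      nlinarith [Real.pi_gt_three, abs_nonneg x]
    simp [this]
  have h2 : ContDiff ℝ (⊤ : ℕ∞)
      (fun ξ : ℝ => ((Real.sqrt (2 * π) * σ (2 * π * ξ) : ℝ) : ℂ)) := by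
    have := h.smooth
    exact Complex.ofRealCLM.contDiff.comp (contDiff_const.mul (this.comp (contDiff_const.mul contDiff_id)))
  exact ⟨h1.toSchwartzMap h2, fun ξ => rfl⟩

theorem fourier_symS {σ : ℝ → ℝ} (h : IsSym σ) (T : 𝓢(ℝ, ℂ))
    (hT : ∀ ξ, T ξ = ((Real.sqrt (2 * π) * σ (2 * π * ξ) : ℝ) : ℂ)) (x : ℝ) :
    (𝓕 T : 𝓢(ℝ, ℂ)) x = (invFourier σ x : ℂ) := by
  rw [SchwartzMap.fourier_coe, Real.fourier_eq']
  have h3 : (0:ℝ) < 2 * π := Real.two_pi_pos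
  have := Measure.integral_comp_mul_left (fun u : ℝ => Complex.exp (-(x * u : ℝ) * Complex.I) *
    ((Real.sqrt (2 * π) * σ u : ℝ) : ℂ)) (2 * π)
  have e : ∀ v : ℝ, Complex.exp (↑(-2 * π * inner ℝ v x) * Complex.I) • T v =
     Complex.exp (-(x * (2 * π * v) : ℝ) * Complex.I) *
      ((Real.sqrt (2 * π) * σ (2 * π * v) : ℝ) : ℂ) := by
    intro v
    rw [hT, smul_eq_mul]
    congr 2
    simp
    ring_nf
  simp_rw [e]
  erw [this]
  unfold invFourier
  push_cast
  rw [invFourier_eq_complex h, abs_of_pos (inv_pos.2 h3)]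
  simp_rw [show ∀ u : ℝ, Complex.exp (-((x:ℂ) * u) * Complex.I) * ((Real.sqrt (2 * π) : ℂ) * (σ u : ℂ)) =
    (Real.sqrt (2 * π) : ℂ) * (Complex.exp (-((x * u : ℝ):ℂ) * Complex.I) * (σ u : ℂ)) from fun u => by push_cast; ring]
  rw [integral_const_mul, Complex.real_smul, ← mul_assoc]
  congr 1
  rw [← Complex.ofReal_inv (Real.sqrt _), ← Complex.ofReal_mul]
  congr 1
  field_simp
  rw [Real.sq_sqrt h3.le]

/-- The kernel attached to a symbol, as a Schwartz function. -/
theorem exists_kerS {σ : ℝ → ℝ} (h : IsSym σ) :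
    ∃ S : 𝓢(ℝ, ℂ), (∀ x, S x = (invFourier σ x : ℂ)) ∧
      (∀ ξ, (𝓕 S : 𝓢(ℝ, ℂ)) ξ = ((Real.sqrt (2 * π) * σ (2 * π * ξ) : ℝ) : ℂ)) ∧
      (∀ ξ, (𝓕⁻ S : 𝓢(ℝ, ℂ)) ξ = ((Real.sqrt (2 * π) * σ (2 * π * ξ) : ℝ) : ℂ)) := by
  obtain ⟨T, hT⟩ := exists_symS h
  have hi : ∀ ξ, (𝓕⁻ (𝓕 T : 𝓢(ℝ, ℂ)) : 𝓢(ℝ, ℂ)) ξ = ((Real.sqrt (2 * π) * σ (2 * π * ξ) : ℝ) : ℂ) := by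
    intro ξ
    rw [FourierTransform.fourierInv_fourier_eq, hT]
  refine ⟨𝓕 T, fourier_symS h T hT, ?_, hi⟩
  intro ξ
  have := hi (-ξ)
  rw [mul_neg, h.even] at this
  rw [← this, SchwartzMap.fourierInv_coe, SchwartzMap.fourier_coe, Real.fourierInv_eq_fourier_neg,
    neg_neg]

end EDB

namespace EDB

open FourierTransform SchwartzMap

theorem fourier_translate_zero (S : 𝓢(ℝ, ℂ)) (a ξ : ℝ) (h : (𝓕 S : 𝓢(ℝ, ℂ)) ξ = 0) :
    (𝓕 (S.compSubConstCLM ℂ a) : 𝓢(ℝ, ℂ)) ξ = 0 := by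
  have h1 := congrFun (VectorFourier.fourierIntegral_comp_add_right Real.fourierChar volume
    (innerₗ ℝ) (S : ℝ → ℂ) (-a)) ξ
  have h2 : (𝓕 S : 𝓢(ℝ, ℂ)) ξ =
    VectorFourier.fourierIntegral Real.fourierChar volume (innerₗ ℝ) (S : ℝ → ℂ) ξ := rfl
  have h3 : (𝓕 (S.compSubConstCLM ℂ a) : 𝓢(ℝ, ℂ)) ξ =
    VectorFourier.fourierIntegral Real.fourierChar volume (innerₗ ℝ)
      ((S : ℝ → ℂ) ∘ fun v ↦ v + -a) ξ := by
    rw [SchwartzMap.fourier_coe]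
    rfl
  rw [h3, h1, ← h2, h, smul_zero]

theorem fourierInv_translate_zero (S : 𝓢(ℝ, ℂ)) (a ξ : ℝ) (h : (𝓕⁻ S : 𝓢(ℝ, ℂ)) ξ = 0) :
    (𝓕⁻ (S.compSubConstCLM ℂ a) : 𝓢(ℝ, ℂ)) ξ = 0 := by
  rw [SchwartzMap.fourierInv_coe, Real.fourierInv_eq_fourier_neg, ← SchwartzMap.fourier_coe] at h ⊢
  exact fourier_translate_zero S a _ h

theorem tri_schwartz (a b c : 𝓢(ℝ, ℂ))
    (h : ∀ η ζ, (𝓕⁻ a : 𝓢(ℝ, ℂ)) η * (𝓕⁻ b : 𝓢(ℝ, ℂ)) ζ * (𝓕 c : 𝓢(ℝ, ℂ)) (η + ζ) = 0) :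
    ∫ t, a t * b t * c t = 0 := by
  have h1 := integral_fourier_mul_eq
    (SchwartzMap.convolution (ContinuousLinearMap.mul ℂ ℂ) (𝓕⁻ a) (𝓕⁻ b)) c
  rw [SchwartzMap.fourier_convolution] at h1
  simp only [SchwartzMap.pairing_apply_apply, FourierTransform.fourier_fourierInv_eq,
    ContinuousLinearMap.mul_apply'] at h1
  rw [h1]
  apply integral_eq_zero_of_ae
  filter_upwards with ξ
  rw [SchwartzMap.convolution_apply, MeasureTheory.convolution, ← integral_mul_const]
  apply integral_eq_zero_of_ae
  filter_upwards with η
  have := h η (ξ - η)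
  rw [add_sub_cancel] at this
  simpa using this

theorem tri_zero {σ₁ σ₂ σ₃ : ℝ → ℝ} (h₁ : IsSym σ₁) (h₂ : IsSym σ₂) (h₃ : IsSym σ₃)
    (hz : ∀ η ζ, σ₁ η * σ₂ ζ * σ₃ (η + ζ) = 0) (a b c : ℝ) :
    ∫ t, invFourier σ₁ (t - a) * invFourier σ₂ (t - b) * invFourier σ₃ (t - c) = 0 := by
  obtain ⟨S₁, e₁, f₁, g₁⟩ := exists_kerS h₁
  obtain ⟨S₂, e₂, f₂, g₂⟩ := exists_kerS h₂
  obtain ⟨S₃, e₃, f₃, g₃⟩ := exists_kerS h₃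
  have hp : Real.sqrt (2 * π) ≠ 0 := (Real.sqrt_pos.2 Real.two_pi_pos).ne'
  have := tri_schwartz (S₁.compSubConstCLM ℂ a) (S₂.compSubConstCLM ℂ b) (S₃.compSubConstCLM ℂ c)
    (by
      intro η ζ
      have hz' := hz (2 * π * η) (2 * π * ζ)
      rw [← mul_add] at hz'
      rcases mul_eq_zero.1 hz' with hz' | hz'
      · rcases mul_eq_zero.1 hz' with hz' | hz'
        · rw [fourierInv_translate_zero S₁ a η (by rw [g₁, hz']; simp)]; simp
        · rw [fourierInv_translate_zero S₂ b ζ (by rw [g₂, hz']; simp)]; simp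
      · rw [fourier_translate_zero S₃ c _ (by rw [f₃, hz']; simp)]; simp)
  simp only [compSubConstCLM_apply, e₁, e₂, e₃, ← Complex.ofReal_mul] at this
  rw [integral_complex_ofReal] at this
  exact_mod_cast this

theorem conv_id {σ τ : ℝ → ℝ} (h₁ : IsSym σ) (h₂ : IsSym τ)
    (hz : ∀ ξ, τ ξ * σ ξ = σ ξ) (t : ℝ) :
    ∫ y, invFourier τ y * invFourier σ (t - y) = Real.sqrt (2 * π) * invFourier σ t := by
  obtain ⟨S, e₁, f₁, g₁⟩ := exists_kerS h₁
  obtain ⟨T, e₂, f₂, g₂⟩ := exists_kerS h₂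
  have key : SchwartzMap.convolution (ContinuousLinearMap.mul ℂ ℂ) T S =
      ((Real.sqrt (2 * π) : ℝ) : ℂ) • S := by
    have : 𝓕 (SchwartzMap.convolution (ContinuousLinearMap.mul ℂ ℂ) T S) =
        𝓕 (((Real.sqrt (2 * π) : ℝ) : ℂ) • S) := by
      rw [SchwartzMap.fourier_convolution, FourierTransform.fourier_smul]
      ext ξ
      simp only [SchwartzMap.pairing_apply_apply, ContinuousLinearMap.mul_apply', f₁, f₂,
        _root_.smul_apply, smul_eq_mul, ← Complex.ofReal_mul]
      congr 1
      have := hz (2 * π * ξ)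
      linear_combination (Real.sqrt (2 * π))^2 * this
    have h := congrArg (fun u : 𝓢(ℝ, ℂ) => (𝓕⁻ u : 𝓢(ℝ, ℂ))) this
    simpa using h
  have := DFunLike.congr_fun key t
  rw [SchwartzMap.convolution_apply, MeasureTheory.convolution] at this
  simp only [e₁, e₂, ContinuousLinearMap.mul_apply', _root_.smul_apply, smul_eq_mul,
    ← Complex.ofReal_mul] at this
  rw [integral_complex_ofReal] at this
  exact_mod_cast this

theorem invFourier_neg (σ : ℝ → ℝ) (x : ℝ) : invFourier σ (-x) = invFourier σ x := by
  simp [invFourier]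

theorem inv_integrable {σ : ℝ → ℝ} (h : IsSym σ) : Integrable (invFourier σ) := by
  obtain ⟨S, e, -, -⟩ := exists_kerS h
  have := S.integrable (μ := volume)
  have h2 := this.re
  refine h2.congr (Filter.Eventually.of_forall fun x => ?_)
  simp [e]

theorem inv_hasDeriv {σ : ℝ → ℝ} (h : IsSym σ) : ∃ k' : ℝ → ℝ, Integrable k' ∧
    ∀ x, HasDerivAt (invFourier σ) (k' x) x := by
  obtain ⟨S, e, -, -⟩ := exists_kerS h
  refine ⟨fun x => (deriv S x).re, ?_, ?_⟩
  · have := (SchwartzMap.derivCLM ℂ ℂ S).integrable (μ := volume)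
    have h2 := this.re
    exact h2.congr (Filter.Eventually.of_forall fun x => rfl)
  · intro x
    have h1 : HasDerivAt S (deriv S x) x := S.differentiableAt.hasDerivAt
    have := Complex.reCLM.hasFDerivAt.comp_hasDerivAt x h1
    refine (this.congr_of_eventuallyEq (Filter.Eventually.of_forall fun x => ?_))
    simp [e]

theorem inv_continuous {σ : ℝ → ℝ} (h : IsSym σ) : Continuous (invFourier σ) := by
  obtain ⟨k', -, h'⟩ := inv_hasDeriv h
  exact continuous_iff_continuousAt.2 fun x => (h' x).continuousAt

end EDB

namespace EDB

/-- Convolution of a kernel with a function. -/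
def cv (k f : ℝ → ℝ) (x : ℝ) : ℝ := ∫ y : ℝ, k y * f (x - y)

theorem cv_eq (k f : ℝ → ℝ) (x : ℝ) : cv k f x = ∫ z : ℝ, k (x - z) * f z := by
  have := integral_sub_left_eq_self (fun y : ℝ => k y * f (x - y)) volume x
  simp only [sub_sub_cancel] at this
  exact this.symm

theorem cv_bound {k f : ℝ → ℝ} (hk : Integrable k) {B : ℝ} (hf : ∀ x, |f x| ≤ B) (x : ℝ) :
    |cv k f x| ≤ (∫ y, |k y|) * B := by
  rw [← integral_mul_const, ← Real.norm_eq_abs]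
  refine norm_integral_le_of_norm_le (hk.abs.mul_const B) (Filter.Eventually.of_forall fun y => ?_)
  rw [norm_mul, Real.norm_eq_abs, Real.norm_eq_abs]
  exact mul_le_mul_of_nonneg_left (hf _) (abs_nonneg _)

theorem int_mul_bdd {k f : ℝ → ℝ} (hk : Integrable k) (hf : Continuous f) {B : ℝ}
    (hB : ∀ x, |f x| ≤ B) : Integrable (fun y => k y * f y) :=
  hk.mul_bdd (c := B) hf.aestronglyMeasurable
    (Filter.Eventually.of_forall fun y => by simpa using hB y)

theorem cv_continuous {k f : ℝ → ℝ} (hk : Integrable k) (hf : Continuous f) {B : ℝ}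
    (hB : ∀ x, |f x| ≤ B) : Continuous (cv k f) := by
  unfold cv
  refine continuous_of_dominated (bound := fun y => |k y| * B) ?_ ?_ (hk.abs.mul_const B) ?_
  · intro x
    exact (int_mul_bdd hk (f := fun y => f (x - y)) (by fun_prop)
      (fun y => hB _)).aestronglyMeasurable
  · intro x
    refine Filter.Eventually.of_forall fun y => ?_
    rw [norm_mul, Real.norm_eq_abs, Real.norm_eq_abs]
    exact mul_le_mul_of_nonneg_left (hB _) (abs_nonneg _)
  · refine Filter.Eventually.of_forall fun y => ?_
    fun_prop

theorem cv_hasDeriv {k f f' : ℝ → ℝ} (hk : Integrable k) (hf : ∀ x, HasDerivAt f (f' x) x)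
    (hf' : Continuous f') {B B' : ℝ} (hB : ∀ x, |f x| ≤ B) (hB' : ∀ x, |f' x| ≤ B') (x : ℝ) :
    HasDerivAt (cv k f) (cv k f' x) x := by
  have hfc : Continuous f := continuous_iff_continuousAt.2 fun x => (hf x).continuousAt
  refine (hasDerivAt_integral_of_dominated_loc_of_deriv_le (μ := volume) (s := Set.univ)
    (F := fun x y => k y * f (x - y)) (F' := fun x y => k y * f' (x - y)) (x₀ := x)
    (bound := fun y => |k y| * B') Filter.univ_mem ?_ ?_ ?_ ?_ (hk.abs.mul_const B') ?_).2
  · refine Filter.Eventually.of_forall fun x => ?_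
    exact (int_mul_bdd hk (f := fun y => f (x - y)) (by fun_prop)
      (fun y => hB _)).aestronglyMeasurable
  · exact (int_mul_bdd hk (f := fun y => f (x - y)) (by fun_prop) (fun y => hB _))
  · exact (int_mul_bdd hk (f := fun y => f' (x - y)) (by fun_prop)
      (fun y => hB' _)).aestronglyMeasurable
  · refine Filter.Eventually.of_forall fun y x _ => ?_
    rw [norm_mul, Real.norm_eq_abs, Real.norm_eq_abs]
    exact mul_le_mul_of_nonneg_left (hB' _) (abs_nonneg _)
  · refine Filter.Eventually.of_forall fun y x _ => ?_
    exact ((hf (x - y)).comp_sub_const x y).const_mul (k y)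

theorem cv_vanish {k₁ k₂ k₃ f g : ℝ → ℝ} (c₁ : Continuous k₁) (c₂ : Continuous k₂)
    (c₃ : Continuous k₃) (i₁ : Integrable k₁) (i₂ : Integrable k₂) (i₃ : Integrable k₃)
    (he : ∀ x, k₁ (-x) = k₁ x)
    (hz : ∀ a b c, ∫ t, k₁ (t - a) * k₂ (t - b) * k₃ (t - c) = 0)
    (cf : Continuous f) (cg : Continuous g) {B B' : ℝ} (hf : ∀ x, |f x| ≤ B)
    (hg : ∀ x, |g x| ≤ B') (x : ℝ) :
    cv k₁ (fun t => cv k₂ f t * cv k₃ g t) x = 0 := by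
  rw [cv_eq]
  have j₂ : ∀ t, Integrable (fun z => k₂ (t - z) * f z) := fun t =>
    int_mul_bdd (i₂.comp_sub_left t) cf hf
  have j₃ : ∀ t, Integrable (fun z => k₃ (t - z) * g z) := fun t =>
    int_mul_bdd (i₃.comp_sub_left t) cg hg
  have e : ∀ t, k₁ (x - t) * (cv k₂ f t * cv k₃ g t) =
      ∫ p : ℝ × ℝ, k₁ (t - x) * ((k₂ (t - p.1) * f p.1) * (k₃ (t - p.2) * g p.2)) := by
    intro t
    rw [integral_const_mul, Measure.volume_eq_prod,
      integral_prod_mul (fun z => k₂ (t - z) * f z) (fun z => k₃ (t - z) * g z), ← cv_eq, ← cv_eq,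
      ← he, neg_sub]
  simp_rw [e]
  rw [integral_integral_swap]
  · apply integral_eq_zero_of_ae
    filter_upwards with p
    have : ∀ t, k₁ (t - x) * ((k₂ (t - p.1) * f p.1) * (k₃ (t - p.2) * g p.2)) =
      (k₁ (t - x) * k₂ (t - p.1) * k₃ (t - p.2)) * (f p.1 * g p.2) := fun t => by ring
    simp_rw [this]
    rw [integral_mul_const, hz]
    simp
  · rw [integrable_prod_iff]
    · constructor
      · refine Filter.Eventually.of_forall fun t => ?_
        exact ((j₂ t).mul_prod (j₃ t)).const_mul (k₁ (t - x))
      · simp only [Function.uncurry, norm_mul, Real.norm_eq_abs]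
        have e2 : ∀ t, ∫ p : ℝ × ℝ, |k₁ (t - x)| * ((|k₂ (t - p.1)| * |f p.1|) *
            (|k₃ (t - p.2)| * |g p.2|)) = |k₁ (t - x)| * (cv (fun y => |k₂ y|) (fun y => |f y|) t *
              cv (fun y => |k₃ y|) (fun y => |g y|) t) := by
          intro t
          rw [integral_const_mul, Measure.volume_eq_prod,
            integral_prod_mul (fun z => |k₂ (t - z)| * |f z|) (fun z => |k₃ (t - z)| * |g z|),
            cv_eq, cv_eq]
        simp_rw [e2]
        have b₂ := cv_bound i₂.abs (f := fun y => |f y|) (B := B) (fun x => by simpa using hf x)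
        have b₃ := cv_bound i₃.abs (f := fun y => |g y|) (B := B') (fun x => by simpa using hg x)
        have d₂ := cv_continuous i₂.abs (f := fun y => |f y|) (by fun_prop) (B := B)
          (fun x => by simpa using hf x)
        have d₃ := cv_continuous i₃.abs (f := fun y => |g y|) (by fun_prop) (B := B')
          (fun x => by simpa using hg x)
        refine int_mul_bdd (i₁.comp_sub_right x).abs (d₂.mul d₃)
          (B := ((∫ y, |(|k₂ y|)|) * B) * ((∫ y, |(|k₃ y|)|) * B')) ?_
        intro t
        rw [abs_mul]
        exact mul_le_mul (b₂ t) (b₃ t) (abs_nonneg _) ((abs_nonneg _).trans (b₂ t))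
    · apply Continuous.aestronglyMeasurable
      simp only [Function.uncurry_def]
      fun_prop

theorem cv_assoc {k₁ k₂ f : ℝ → ℝ} (c₁ : Continuous k₁) (c₂ : Continuous k₂)
    (i₁ : Integrable k₁) (i₂ : Integrable k₂) {c : ℝ}
    (hz : ∀ t, ∫ y, k₁ y * k₂ (t - y) = c * k₂ t)
    (cf : Continuous f) {B : ℝ} (hf : ∀ x, |f x| ≤ B) (x : ℝ) :
    cv k₁ (cv k₂ f) x = c * cv k₂ f x := by
  have j₂ : ∀ t, Integrable (fun z => k₂ (t - z) * f z) := fun t =>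
    int_mul_bdd (i₂.comp_sub_left t) cf hf
  have e : ∀ y, k₁ y * cv k₂ f (x - y) = ∫ z : ℝ, k₁ y * (k₂ (x - y - z) * f z) := by
    intro t
    rw [integral_const_mul, cv_eq]
  rw [cv]
  simp_rw [e]
  rw [integral_integral_swap]
  · rw [cv_eq, ← integral_const_mul]
    congr 1
    ext z
    have : ∀ y, k₁ y * (k₂ (x - y - z) * f z) = k₁ y * k₂ (x - z - y) * f z := fun y => by
      rw [sub_right_comm]; ring
    simp_rw [this]
    rw [integral_mul_const, hz]
    ring
  · rw [integrable_prod_iff]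
    · constructor
      · refine Filter.Eventually.of_forall fun t => ?_
        exact (j₂ (x - t)).const_mul (k₁ t)
      · simp only [Function.uncurry, norm_mul, Real.norm_eq_abs]
        have e2 : ∀ t, ∫ z : ℝ, |k₁ t| * (|k₂ (x - t - z)| * |f z|) =
            |k₁ t| * cv (fun y => |k₂ y|) (fun y => |f y|) (x - t) := by
          intro t
          rw [integral_const_mul, cv_eq]
        simp_rw [e2]
        have b₂ := cv_bound i₂.abs (f := fun y => |f y|) (B := B) (fun x => by simpa using hf x)
        have d₂ := cv_continuous i₂.abs (f := fun y => |f y|) (by fun_prop) (B := B)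
          (fun x => by simpa using hf x)
        exact int_mul_bdd i₁.abs (f := fun t => cv (fun y => |k₂ y|) (fun y => |f y|) (x - t))
          (by fun_prop) (fun t => b₂ _)
    · apply Continuous.aestronglyMeasurable
      simp only [Function.uncurry_def]
      fun_prop

theorem cv_bernstein {κ κ' k f f' : ℝ → ℝ} {c : ℝ} (hc : 0 < c) (cκ : Continuous κ)
    (ck : Continuous k) (iκ : Integrable κ) (iκ' : Integrable κ') (ik : Integrable k)
    (hκ : ∀ x, HasDerivAt κ (κ' x) x)
    (hz : ∀ t, ∫ y, κ y * k (t - y) = c * k t)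
    (hf : ∀ x, HasDerivAt f (f' x) x)
    (hf' : Continuous f') {B₀ B₁ : ℝ} (hB : ∀ x, |f x| ≤ B₀) (hB' : ∀ x, |f' x| ≤ B₁)
    {B : ℝ} (hu : ∀ x, |cv k f x| ≤ B) (x : ℝ) :
    |cv k f' x| ≤ c⁻¹ * (∫ y, |κ' y|) * B := by
  have hfc : Continuous f := continuous_iff_continuousAt.2 fun x => (hf x).continuousAt
  have hd : ∀ x, HasDerivAt (cv k f) (cv k f' x) x := cv_hasDeriv ik hf hf' hB hB'
  have cu := cv_continuous ik hfc hB
  have cu' := cv_continuous ik hf' hB'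
  have bu' := cv_bound ik hB'
  have h1 : cv κ (cv k f') x = c * cv k f' x := cv_assoc cκ ck iκ ik hz hf' hB' x
  have h2 : cv κ (cv k f') x = cv κ' (cv k f) x := by
    have := integral_mul_deriv_eq_deriv_mul_of_integrable (u := κ) (u' := κ')
      (v := fun y => cv k f (x - y)) (v' := fun y => - cv k f' (x - y))
      (fun y _ => hκ y) (fun y _ => (hd (x - y)).comp_const_sub x y)
      (int_mul_bdd iκ (f := fun y => - cv k f' (x - y)) (by fun_prop) (fun y => by
        simpa using bu' (x - y)))
      (int_mul_bdd iκ' (f := fun y => cv k f (x - y)) (by fun_prop) (fun y => hu _))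
      (int_mul_bdd iκ (f := fun y => cv k f (x - y)) (by fun_prop) (fun y => hu _))
    simp only [mul_neg, integral_neg, neg_inj] at this
    exact this
  have h3 := cv_bound iκ' hu x
  rw [← h2, h1, abs_mul, abs_of_pos hc] at h3
  rw [mul_assoc, ← div_eq_inv_mul, le_div_iff₀ hc]
  linarith

end EDB

namespace EDB

theorem sym_dil {ρ : ℝ → ℝ} (hρ : IsLPCutoff ρ) {L : ℝ} (hL : 0 < L) :
    IsSym (fun ξ => ρ (ξ / L)) := by
  refine ⟨hρ.smooth.comp (contDiff_id.div_const L), fun ξ => ?_, 9 / 8 * L, by positivity, ?_⟩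
  · rw [neg_div, hρ.even]
  · intro ξ hξ
    apply hρ.eq_zero
    rw [abs_div, abs_of_pos hL, le_div_iff₀ hL]
    exact hξ

theorem lpSymbol_zero' (ρ : ℝ → ℝ) : lpSymbol ρ 0 = fun ξ => ρ (ξ / 1) := by
  simp [lpSymbol]

theorem lpSymbol_succ' (ρ : ℝ → ℝ) (k : ℕ) :
    lpSymbol ρ (k + 1) = fun ξ => ρ (ξ / 2 ^ (k + 1)) - ρ (ξ / 2 ^ k) := by
  funext ξ
  simp only [lpSymbol]
  congr 2
  rw [pow_succ]
  field_simp

theorem lpSymbol_high {ρ : ℝ → ℝ} (hρ : IsLPCutoff ρ) (k : ℕ) (ξ : ℝ)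
    (h : 9 / 8 * 2 ^ k ≤ |ξ|) : lpSymbol ρ k ξ = 0 := by
  have aux : ∀ j : ℕ, j ≤ k → ρ (ξ / 2 ^ j) = 0 := by
    intro j hj
    apply hρ.eq_zero
    have hp : (0:ℝ) < 2 ^ j := by positivity
    rw [abs_div, abs_of_pos hp, le_div_iff₀ hp]
    have : (2:ℝ) ^ j ≤ 2 ^ k := pow_le_pow_right₀ (by norm_num) hj
    linarith
  cases k with
  | zero =>
    have := aux 0 le_rfl
    simpa [lpSymbol] using this
  | succ k =>
    rw [lpSymbol_succ']
    simp [aux k (by omega), aux (k + 1) le_rfl]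

theorem lpSymbol_low {ρ : ℝ → ℝ} (hρ : IsLPCutoff ρ) (k : ℕ) (hk : 1 ≤ k) (ξ : ℝ)
    (h : |ξ| ≤ 7 / 16 * 2 ^ k) : lpSymbol ρ k ξ = 0 := by
  obtain ⟨k, rfl⟩ : ∃ j, k = j + 1 := ⟨k - 1, by omega⟩
  have aux : ∀ j : ℕ, k ≤ j → ρ (ξ / 2 ^ j) = 1 := by
    intro j hj
    apply hρ.eq_one
    have hp : (0:ℝ) < 2 ^ j := by positivity
    rw [abs_div, abs_of_pos hp, div_le_iff₀ hp]
    have : (2:ℝ) ^ k ≤ 2 ^ j := pow_le_pow_right₀ (by norm_num) hj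
    rw [pow_succ] at h
    linarith
  rw [lpSymbol_succ']
  simp [aux k le_rfl, aux (k + 1) (by omega)]

theorem lpSymbol_sym {ρ : ℝ → ℝ} (hρ : IsLPCutoff ρ) (k : ℕ) : IsSym (lpSymbol ρ k) := by
  refine ⟨?_, ?_, 9 / 8 * 2 ^ k, by positivity, lpSymbol_high hρ k⟩
  · cases k with
    | zero => rw [lpSymbol_zero']; exact (sym_dil hρ one_pos).smooth
    | succ k =>
      rw [lpSymbol_succ']
      exact (sym_dil hρ (L := 2 ^ (k + 1)) (by positivity)).smooth.sub
        (sym_dil hρ (L := 2 ^ k) (by positivity)).smooth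
  · intro ξ
    cases k with
    | zero => rw [lpSymbol_zero']; exact (sym_dil hρ one_pos).even ξ
    | succ k =>
      rw [lpSymbol_succ']
      simp only [neg_div, hρ.even]

theorem inv_dil (ρ : ℝ → ℝ) {L : ℝ} (hL : 0 < L) (x : ℝ) :
    invFourier (fun ξ => ρ (ξ / L)) x = L * invFourier ρ (L * x) := by
  unfold invFourier
  have := Measure.integral_comp_div (fun u : ℝ => Real.cos (L * x * u) * ρ u) L
  rw [abs_of_pos hL, smul_eq_mul] at this
  rw [mul_left_comm, ← this]
  congr 2
  ext ξ
  congr 2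
  field_simp

theorem sym_base {ρ : ℝ → ℝ} (hρ : IsLPCutoff ρ) : IsSym ρ := by
  simpa using sym_dil hρ one_pos

theorem inv_dil_L1 (ρ : ℝ → ℝ) {L : ℝ} (hL : 0 < L) :
    ∫ x, |invFourier (fun ξ => ρ (ξ / L)) x| = ∫ x, |invFourier ρ x| := by
  simp_rw [inv_dil ρ hL, abs_mul, abs_of_pos hL]
  rw [integral_const_mul, Measure.integral_comp_mul_left (fun u => |invFourier ρ u|) L,
    abs_of_pos (inv_pos.2 hL), smul_eq_mul]
  field_simp

theorem lpKernel_L1 {ρ : ℝ → ℝ} (hρ : IsLPCutoff ρ) (k : ℕ) :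
    ∫ x, |lpKernel ρ k x| ≤ 2 * ∫ x, |invFourier ρ x| := by
  have h0 : 0 ≤ ∫ x, |invFourier ρ x| := integral_nonneg fun x => abs_nonneg _
  cases k with
  | zero =>
    have : lpKernel ρ 0 = invFourier ρ := rfl
    rw [this]
    linarith
  | succ k =>
    have s1 := sym_dil hρ (L := 2 ^ (k + 1)) (by positivity)
    have s2 := sym_dil hρ (L := 2 ^ k) (by positivity)
    have e : ∀ x, lpKernel ρ (k + 1) x = invFourier (fun ξ => ρ (ξ / 2 ^ (k + 1))) x -
        invFourier (fun ξ => ρ (ξ / 2 ^ k)) x := by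
      intro x
      unfold lpKernel
      rw [lpSymbol_succ']
      unfold invFourier
      rw [← mul_sub, ← integral_sub]
      · simp_rw [mul_sub]
      · have := s1.smooth.continuous
        exact Continuous.integrable_of_hasCompactSupport ((by fun_prop : Continuous fun ξ : ℝ => Real.cos (x * ξ)).mul this) s1.hcs.mul_left
      · have := s2.smooth.continuous
        exact Continuous.integrable_of_hasCompactSupport ((by fun_prop : Continuous fun ξ : ℝ => Real.cos (x * ξ)).mul this) s2.hcs.mul_left
    have i1 := (inv_integrable s1).abs
    have i2 := (inv_integrable s2).abs
    have : ∫ x, |lpKernel ρ (k + 1) x| ≤ ∫ x, (|invFourier (fun ξ => ρ (ξ / 2 ^ (k + 1))) x| +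
        |invFourier (fun ξ => ρ (ξ / 2 ^ k)) x|) := by
      refine integral_mono (inv_integrable (lpSymbol_sym hρ (k + 1))).abs (i1.add i2) fun x => ?_
      simp only [e]
      exact abs_sub _ _
    rw [integral_add i1 i2, inv_dil_L1 ρ (by positivity), inv_dil_L1 ρ (by positivity)] at this
    linarith

theorem bernstein {ρ : ℝ → ℝ} (hρ : IsLPCutoff ρ) : ∃ C : ℝ, 0 ≤ C ∧
    ∀ (f f' : ℝ → ℝ) (B₀ B₁ B : ℝ) (k : ℕ), (∀ x, HasDerivAt f (f' x) x) → Continuous f' →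
      (∀ x, |f x| ≤ B₀) → (∀ x, |f' x| ≤ B₁) → (∀ x, |LP ρ k f x| ≤ B) →
      ∀ x, |LP ρ k f' x| ≤ C * 2 ^ k * B := by
  obtain ⟨κ', iκ', hκ'⟩ := inv_hasDeriv (sym_base hρ)
  have hp : 0 < Real.sqrt (2 * π) := Real.sqrt_pos.2 Real.two_pi_pos
  have h0 : 0 ≤ ∫ x, |κ' x| := integral_nonneg fun x => abs_nonneg _
  refine ⟨2 * ((Real.sqrt (2 * π))⁻¹ * ∫ x, |κ' x|), by positivity, ?_⟩
  intro f f' B₀ B₁ B k hf hf' hB hB' hu x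
  have hL : (0:ℝ) < 2 ^ (k + 1) := by positivity
  set L : ℝ := 2 ^ (k + 1) with hLdef
  have s1 := sym_dil hρ hL
  have s2 := lpSymbol_sym hρ k
  have hd : ∀ x, HasDerivAt (invFourier (fun ξ => ρ (ξ / L))) (L * (L * κ' (L * x))) x := by
    intro x
    have : invFourier (fun ξ => ρ (ξ / L)) = fun x => L * invFourier ρ (L * x) :=
      funext (inv_dil ρ hL)
    rw [this]
    have := ((hκ' (L * x)).comp x ((hasDerivAt_id x).const_mul L)).const_mul L
    refine this.congr_deriv ?_
    ring
  have hintg : Integrable (fun x => L * (L * κ' (L * x))) :=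
    ((iκ'.comp_mul_left' hL.ne').const_mul L).const_mul L
  have hL1 : ∫ x, |L * (L * κ' (L * x))| = L * ∫ x, |κ' x| := by
    simp_rw [abs_mul, abs_of_pos hL]
    rw [integral_const_mul, integral_const_mul,
      Measure.integral_comp_mul_left (fun u => |κ' u|) L, abs_of_pos (inv_pos.2 hL), smul_eq_mul]
    field_simp
  have := cv_bernstein (κ := invFourier (fun ξ => ρ (ξ / L))) (k := lpKernel ρ k)
    hp (inv_continuous s1) (inv_continuous s2) (inv_integrable s1) hintg (inv_integrable s2) hd
    (conv_id s2 s1 (by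
      intro ξ
      by_cases hξ : 9 / 8 * 2 ^ k ≤ |ξ|
      · rw [lpSymbol_high hρ k ξ hξ]; simp
      · rw [hρ.eq_one, one_mul]
        rw [abs_div, abs_of_pos hL, div_le_iff₀ hL, hLdef, pow_succ]
        have : (0:ℝ) < 2 ^ k := by positivity
        linarith)) hf hf' hB hB' hu x
  rw [hL1] at this
  have e : (√(2 * π))⁻¹ * (L * ∫ (x : ℝ), |κ' x|) * B =
    2 * ((√(2 * π))⁻¹ * ∫ (x : ℝ), |κ' x|) * 2 ^ k * B := by
    rw [hLdef, pow_succ]; ring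
  rw [← e]
  exact this

/-- Vanishing from frequency supports. -/
theorem LP_vanish {ρ : ℝ → ℝ} (hρ : IsLPCutoff ρ) (K M N : ℕ)
    (h : (M + 5 ≤ N ∧ K + 5 ≤ N) ∨ (N + 5 ≤ M ∧ K + 5 ≤ M) ∨ (M + 4 ≤ K ∧ N + 4 ≤ K))
    {f g : ℝ → ℝ}
    (cf : Continuous f) (cg : Continuous g) {B B' : ℝ} (hf : ∀ x, |f x| ≤ B)
    (hg : ∀ x, |g x| ≤ B') (x : ℝ) :
    LP ρ K (fun t => LP ρ M f t * LP ρ N g t) x = 0 := by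
  have key : ∀ A B C : ℕ, A + 4 ≤ C → B + 4 ≤ C → ∀ η ζ,
      lpSymbol ρ A η * lpSymbol ρ B ζ * lpSymbol ρ C (η + ζ) = 0 := by
    intro A B C hA hB η ζ
    by_cases h1 : 9 / 8 * 2 ^ A ≤ |η|
    · rw [lpSymbol_high hρ A η h1]; simp
    by_cases h2 : 9 / 8 * 2 ^ B ≤ |ζ|
    · rw [lpSymbol_high hρ B ζ h2]; simp
    rw [lpSymbol_low hρ C (by omega), mul_zero]
    have a1 : (2:ℝ) ^ (A + 4) ≤ 2 ^ C := pow_le_pow_right₀ (by norm_num) hA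
    have a2 : (2:ℝ) ^ (B + 4) ≤ 2 ^ C := pow_le_pow_right₀ (by norm_num) hB
    rw [pow_add] at a1 a2
    have := abs_add_le η ζ
    have : (0:ℝ) < 2 ^ C := by positivity
    linarith
  have sK := lpSymbol_sym hρ K
  have sM := lpSymbol_sym hρ M
  have sN := lpSymbol_sym hρ N
  refine cv_vanish (inv_continuous sK) (inv_continuous sM) (inv_continuous sN)
    (inv_integrable sK) (inv_integrable sM) (inv_integrable sN)
    (invFourier_neg _) ?_ cf cg hf hg x
  intro a b c
  rcases h with ⟨h1, h2⟩ | ⟨h1, h2⟩ | ⟨h1, h2⟩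
  · exact tri_zero sK sM sN (key K M N (by omega) (by omega)) a b c
  · have := tri_zero sK sN sM (key K N M (by omega) (by omega)) a c b
    rw [← this]
    congr 1
    ext t
    ring
  · have := tri_zero sM sN sK (key M N K (by omega) (by omega)) b c a
    rw [← this]
    congr 1
    ext t
    ring

end EDB

namespace EDB

theorem comp_data {D : ℕ} {φ : ℝ → Fin D → ℝ} (h : CbSmooth φ) (m : Fin D) :
    ∃ f' : ℝ → ℝ, ∃ B₀ B₁ : ℝ, (∀ x, HasDerivAt (fun y => φ y m) (f' x) x) ∧ Continuous f' ∧
      (∀ x, |φ x m| ≤ B₀) ∧ (∀ x, |f' x| ≤ B₁) := by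
  obtain ⟨hs, hb⟩ := h
  obtain ⟨B₀, h0⟩ := hb 0
  obtain ⟨B₁, h1⟩ := hb 1
  have hd : ∀ x, HasDerivAt φ (deriv φ x) x := fun x =>
    (hs.differentiable (by simp) x).hasDerivAt
  refine ⟨fun x => deriv φ x m, B₀, B₁, fun x => hasDerivAt_pi.1 (hd x) m, ?_, ?_, ?_⟩
  · have : Continuous (deriv φ) := hs.continuous_deriv (by simp)
    fun_prop
  · intro x
    have := h0 x
    rw [norm_iteratedFDeriv_zero] at this
    exact (norm_le_pi_norm (φ x) m).trans this
  · intro x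
    have := h1 x
    rw [norm_iteratedFDeriv_one, ← norm_deriv_eq_norm_fderiv] at this
    exact (norm_le_pi_norm (deriv φ x) m).trans this

theorem hNorm_real {ρ : ℝ → ℝ} {γ : ℝ} {f : ℝ → ℝ} {E : ℝ} (hE : 0 ≤ E) :
    hNorm ρ γ f ≤ ENNReal.ofReal E ↔ ∀ (K : ℕ) (x : ℝ), ((2 : ℝ) ^ K) ^ γ * |LP ρ K f x| ≤ E := by
  unfold hNorm
  simp only [iSup_le_iff, ENNReal.mul_iSup]
  refine forall_congr' fun K => forall_congr' fun x => ?_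
  rw [← ENNReal.ofReal_mul (by positivity), ENNReal.ofReal_le_ofReal_iff hE]

theorem ds_a (ρ : ℝ → ℝ) {D : ℕ} (s : ℝ) (φp φm : ℝ → Fin D → ℝ) (b : Bool) (m : Fin D) :
    hNorm ρ s (fun y => (if b then φp else φm) y m) ≤ dsNorm ρ s φp φm := by
  refine le_trans ?_ (le_max_left _ _)
  cases b
  · exact le_trans (le_iSup (fun n => hNorm ρ s fun x => φm x n) m) le_add_self
  · exact le_trans (le_iSup (fun n => hNorm ρ s fun x => φp x n) m) le_self_add

theorem ds_b (ρ : ℝ → ℝ) {D : ℕ} (s : ℝ) (φp φm : ℝ → Fin D → ℝ) (b₁ b₂ : Bool) (m n : Fin D)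
    (kM kN : ℕ) (h : DClose kM kN) :
    ENNReal.ofReal (((2 : ℝ) ^ kM) ^ s) *
              hNorm ρ (s - 1) (fun x =>
                LP ρ kM (fun y => (if b₁ then φp else φm) y m) x *
                  deriv (LP ρ kN (fun y => (if b₂ then φp else φm) y n)) x) ≤
      dsNorm ρ s φp φm ^ 2 := by
  have h1 : (ENNReal.ofReal (((2 : ℝ) ^ kM) ^ s) *
              hNorm ρ (s - 1) (fun x =>
                LP ρ kM (fun y => (if b₁ then φp else φm) y m) x *
                  deriv (LP ρ kN (fun y => (if b₂ then φp else φm) y n)) x)) ^ ((1 : ℝ) / 2) ≤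
      dsNorm ρ s φp φm := by
    refine le_trans ?_ ((le_max_left _ _).trans (le_max_right _ _))
    refine le_iSup_of_le b₁ (le_iSup_of_le b₂ (le_iSup_of_le m (le_iSup_of_le n
      (le_iSup_of_le kM (le_iSup_of_le kN (le_iSup_of_le h le_rfl))))))
  have h2 := ENNReal.rpow_le_rpow h1 (z := 2) (by norm_num)
  rw [← ENNReal.rpow_mul] at h2
  norm_num at h2
  exact h2

/-- The weight. -/
def W (s r : ℝ) (kM kN : ℕ) : ℝ :=
  ((if (2 : ℝ) ^ kM ≤ 2 ^ 10 * (2 : ℝ) ^ kN then (1 : ℝ) else 0) *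
                  (((2 : ℝ) ^ kM) ^ (-s) * ((2 : ℝ) ^ kN) ^ (r - s)) +
                (if 2 ^ 10 * (2 : ℝ) ^ kN < (2 : ℝ) ^ kM then (1 : ℝ) else 0) *
                  (((2 : ℝ) ^ kM) ^ (r - 1 - s) * ((2 : ℝ) ^ kN) ^ (1 - s)))

theorem cmp_weights {s r : ℝ} (hr : r ≤ 1) {kM kN : ℕ} (h : kN ≤ kM) :
    ((2 : ℝ) ^ kM) ^ (r - 1 - s) * ((2 : ℝ) ^ kN) ^ (1 - s) ≤
      ((2 : ℝ) ^ kM) ^ (-s) * ((2 : ℝ) ^ kN) ^ (r - s) := by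
  have hM : (0:ℝ) < 2 ^ kM := by positivity
  have hN : (0:ℝ) < 2 ^ kN := by positivity
  have hNM : (2:ℝ) ^ kN ≤ 2 ^ kM := pow_le_pow_right₀ (by norm_num) h
  have e1 : r - 1 - s = -s + (r - 1) := by ring
  have e2 : r - s = (1 - s) + (r - 1) := by ring
  rw [e1, e2, Real.rpow_add hM, Real.rpow_add hN]
  have := Real.rpow_le_rpow_of_nonpos hN hNM (z := r - 1) (by linarith)
  have p : 0 < ((2 : ℝ) ^ kM) ^ (-s) * ((2 : ℝ) ^ kN) ^ (1 - s) := by positivity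
  nlinarith

theorem W_low {s r : ℝ} {kM kN : ℕ} (h : kM < kN + 10) :
    W s r kM kN = ((2 : ℝ) ^ kM) ^ (-s) * ((2 : ℝ) ^ kN) ^ (r - s) := by
  have : (2 : ℝ) ^ kM ≤ 2 ^ 10 * (2 : ℝ) ^ kN := by
    rw [← pow_add]
    exact pow_le_pow_right₀ (by norm_num) (by omega)
  simp [W, this, not_lt.2 this]

theorem W_high {s r : ℝ} (hr : r ≤ 1) {kM kN : ℕ} (h : kN + 10 ≤ kM) :
    ((2 : ℝ) ^ kM) ^ (r - 1 - s) * ((2 : ℝ) ^ kN) ^ (1 - s) ≤ W s r kM kN := by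
  by_cases h' : (2 : ℝ) ^ kM ≤ 2 ^ 10 * (2 : ℝ) ^ kN
  · simp only [W, h', not_lt.2 h', if_true, if_false, one_mul, zero_mul, add_zero]
    exact cmp_weights hr (by omega)
  · simp only [W, h', not_le.1 h', if_true, if_false, one_mul, zero_mul, zero_add]
    exact le_rfl

theorem W_le {s r : ℝ} (hr : r ≤ 1) (kM kN : ℕ) :
    W s r kM kN ≤ ((2 : ℝ) ^ kM) ^ (-s) * ((2 : ℝ) ^ kN) ^ (r - s) := by
  by_cases h' : (2 : ℝ) ^ kM ≤ 2 ^ 10 * (2 : ℝ) ^ kN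
  · simp only [W, h', not_lt.2 h', if_true, if_false, one_mul, zero_mul, add_zero]
    exact le_rfl
  · simp only [W, h', not_le.1 h', if_true, if_false, one_mul, zero_mul, zero_add]
    refine cmp_weights hr ?_
    by_contra hh
    apply h'
    rw [← pow_add]
    exact pow_le_pow_right₀ (by norm_num) (by omega)

theorem W_pos (s r : ℝ) (kM kN : ℕ) : 0 < W s r kM kN := by
  by_cases h' : (2 : ℝ) ^ kM ≤ 2 ^ 10 * (2 : ℝ) ^ kN
  · simp only [W, h', not_lt.2 h', if_true, if_false, one_mul, zero_mul, add_zero]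
    positivity
  · simp only [W, h', not_le.1 h', if_true, if_false, one_mul, zero_mul, zero_add]
    positivity

theorem high_freq {r : ℝ} (hr0 : 0 ≤ r) (hr : r ≤ 1) {K L : ℕ} (h : L < K + 5) :
    ((2 : ℝ) ^ K) ^ (r - 1) ≤ 16 * ((2 : ℝ) ^ L) ^ (r - 1) := by
  have hL : (0:ℝ) < 2 ^ L / 16 := by positivity
  have h1 : (2:ℝ) ^ L / 16 ≤ 2 ^ K := by
    have : (2:ℝ) ^ L ≤ 2 ^ (K + 4) := pow_le_pow_right₀ (by norm_num) (by omega)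
    rw [pow_add] at this
    linarith
  have h2 := Real.rpow_le_rpow_of_nonpos hL h1 (z := r - 1) (by linarith)
  refine h2.trans ?_
  rw [Real.div_rpow (by positivity) (by norm_num), div_eq_mul_inv, mul_comm]
  refine mul_le_mul_of_nonneg_right ?_ (by positivity)
  rw [← Real.rpow_neg (by norm_num)]
  calc (16:ℝ) ^ (-(r - 1)) ≤ 16 ^ (1:ℝ) :=
        Real.rpow_le_rpow_of_exponent_le (by norm_num) (by linarith)
    _ = 16 := by norm_num

theorem main_real {ρ : ℝ → ℝ} (hρ : IsLPCutoff ρ) {s r : ℝ} (hs : 0 < s) (hsr : s ≤ r)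
    (hr : r ≤ 1) : ∃ C : ℝ, 0 < C ∧ ∀ (f g g' : ℝ → ℝ) (a B₀ B₁ B₂ : ℝ) (kM kN : ℕ),
      0 ≤ a → Continuous f → (∀ x, |f x| ≤ B₀) → (∀ x, HasDerivAt g (g' x) x) → Continuous g' →
      (∀ x, |g x| ≤ B₁) → (∀ x, |g' x| ≤ B₂) →
      (∀ (K : ℕ) x, ((2 : ℝ) ^ K) ^ s * |LP ρ K f x| ≤ a) →
      (∀ (K : ℕ) x, ((2 : ℝ) ^ K) ^ s * |LP ρ K g x| ≤ a) →
      (DClose kM kN → ∀ (K : ℕ) x, ((2 : ℝ) ^ kM) ^ s * (((2 : ℝ) ^ K) ^ (s - 1) *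
        |LP ρ K (fun t => LP ρ kM f t * LP ρ kN g' t) x|) ≤ a ^ 2) →
      ∀ (K : ℕ) x, ((2 : ℝ) ^ K) ^ (r - 1) *
        |LP ρ K (fun t => LP ρ kM f t * LP ρ kN g' t) x| ≤ C * W s r kM kN * a ^ 2 := by
  obtain ⟨C₂, hC₂, hbern⟩ := bernstein hρ
  set C₁ : ℝ := 2 * ∫ x, |invFourier ρ x| with hCeq
  have hC₁ : 0 ≤ C₁ := mul_nonneg (by norm_num) (integral_nonneg fun x => abs_nonneg _)
  refine ⟨16 * C₁ * C₂ + 2 ^ 13, by positivity, ?_⟩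
  intro f g g' a B₀ B₁ B₂ kM kN ha cf bf dg cg' bg bg' hf hg hclose K x
  have hM : (0:ℝ) < 2 ^ kM := by positivity
  have hN : (0:ℝ) < 2 ^ kN := by positivity
  have hK : (0:ℝ) < 2 ^ K := by positivity
  have hWpos := W_pos s r kM kN
  have hRHS : 0 ≤ (16 * C₁ * C₂ + 2 ^ 13) * W s r kM kN * a ^ 2 := by positivity
  have sup : ∀ (u : ℝ → ℝ), (∀ (K : ℕ) x, ((2 : ℝ) ^ K) ^ s * |LP ρ K u x| ≤ a) →
      ∀ (K : ℕ) x, |LP ρ K u x| ≤ ((2 : ℝ) ^ K) ^ (-s) * a := by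
    intro u hu K x
    rw [Real.rpow_neg (by positivity), ← div_eq_inv_mul, le_div_iff₀ (by positivity), mul_comm]
    exact hu K x
  have f1 := sup f hf kM
  have g1 := sup g hg kN
  have g2 := hbern g g' B₁ B₂ _ kN dg cg' bg bg' g1
  have hh : ∀ t, |LP ρ kM f t * LP ρ kN g' t| ≤
      C₂ * (((2 : ℝ) ^ kM) ^ (-s) * ((2 : ℝ) ^ kN) ^ (1 - s)) * a ^ 2 := by
    intro t
    rw [abs_mul]
    refine (mul_le_mul (f1 t) (g2 t) (abs_nonneg _) (by positivity)).trans (le_of_eq ?_)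
    rw [sub_eq_add_neg, Real.rpow_add hN, Real.rpow_one]
    ring
  have hP : |LP ρ K (fun t => LP ρ kM f t * LP ρ kN g' t) x| ≤
      C₁ * (C₂ * (((2 : ℝ) ^ kM) ^ (-s) * ((2 : ℝ) ^ kN) ^ (1 - s)) * a ^ 2) := by
    refine (cv_bound (inv_integrable (lpSymbol_sym hρ K)) hh x).trans ?_
    exact mul_le_mul_of_nonneg_right (lpKernel_L1 hρ K) (by positivity)
  have crude : ∀ L : ℕ, L < K + 5 →
      ((2 : ℝ) ^ L) ^ (r - 1) * (((2 : ℝ) ^ kM) ^ (-s) * ((2 : ℝ) ^ kN) ^ (1 - s)) ≤ W s r kM kN →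
      ((2 : ℝ) ^ K) ^ (r - 1) * |LP ρ K (fun t => LP ρ kM f t * LP ρ kN g' t) x| ≤
        (16 * C₁ * C₂ + 2 ^ 13) * W s r kM kN * a ^ 2 := by
    intro L hL hW
    have h1 := high_freq (r := r) (by linarith) hr hL
    refine (mul_le_mul h1 hP (abs_nonneg _) (by positivity)).trans ?_
    have h2 : 0 ≤ 16 * C₁ * C₂ * a ^ 2 := by positivity
    have h3 : 0 ≤ 2 ^ 13 * W s r kM kN * a ^ 2 := by positivity
    have h4 := mul_le_mul_of_nonneg_left hW h2
    linarith
  rcases lt_or_ge kM (kN + 10) with hlt | hge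
  · rcases lt_or_ge kN (kM + 10) with hlt' | hge'
    · skip
      by_cases hKN : K ≤ kN + 13
      · have hcl : DClose kM kN := by
          constructor
          · rw [div_lt_iff₀ (by positivity), ← pow_add]
            exact pow_lt_pow_right₀ (by norm_num) (by omega)
          · rw [← pow_add]
            exact pow_lt_pow_right₀ (by norm_num) (by omega)
        have h1 := hclose hcl K x
        rw [W_low hlt]
        have h2 : ((2:ℝ) ^ K) ^ (r - s) ≤ 2 ^ 13 * ((2:ℝ) ^ kN) ^ (r - s) := by
          have : (2:ℝ) ^ K ≤ 2 ^ 13 * 2 ^ kN := by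
            rw [← pow_add]
            exact pow_le_pow_right₀ (by norm_num) (by omega)
          refine (Real.rpow_le_rpow hK.le this (by linarith)).trans ?_
          rw [Real.mul_rpow (by positivity) (by positivity)]
          refine mul_le_mul_of_nonneg_right ?_ (by positivity)
          calc ((2:ℝ) ^ 13) ^ (r - s) ≤ (2 ^ 13) ^ (1:ℝ) :=
                Real.rpow_le_rpow_of_exponent_le (by norm_num) (by linarith)
            _ = 2 ^ 13 := by norm_num
        have h3 : ((2 : ℝ) ^ K) ^ (s - 1) *
            |LP ρ K (fun t => LP ρ kM f t * LP ρ kN g' t) x| ≤ ((2 : ℝ) ^ kM) ^ (-s) * a ^ 2 := by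
          rw [Real.rpow_neg (by positivity), ← div_eq_inv_mul, le_div_iff₀ (by positivity),
            mul_comm]
          exact h1
        have e : ((2:ℝ) ^ K) ^ (r - 1) = ((2:ℝ) ^ K) ^ (r - s) * ((2:ℝ) ^ K) ^ (s - 1) := by
          rw [← Real.rpow_add hK]; congr 1; ring
        rw [e, mul_assoc]
        refine (mul_le_mul h2 h3 (by positivity) (by positivity)).trans ?_
        have : 0 ≤ 16 * C₁ * C₂ * (((2:ℝ) ^ kM) ^ (-s) * ((2:ℝ) ^ kN) ^ (r - s)) * a ^ 2 := by
          positivity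
        linarith
      · rw [LP_vanish hρ K kM kN (Or.inr (Or.inr ⟨by omega, by omega⟩)) cf cg' bf bg']
        simpa using hRHS
    · skip
      by_cases hKN : kN < K + 5
      · refine crude kN hKN (le_of_eq ?_)
        rw [W_low hlt, mul_left_comm, ← Real.rpow_add hN]
        congr 2
        ring
      · rw [LP_vanish hρ K kM kN (Or.inl ⟨by omega, by omega⟩) cf cg' bf bg']
        simpa using hRHS
  · skip
    by_cases hKN : kM < K + 5
    · refine crude kM hKN (le_trans (le_of_eq ?_) (W_high hr hge))
      rw [← mul_assoc, ← Real.rpow_add hM]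
      congr 2
    · rw [LP_vanish hρ K kM kN (Or.inr (Or.inl ⟨by omega, by omega⟩)) cf cg' bf bg']
      simpa using hRHS

theorem main_ennreal {ρ : ℝ → ℝ} (hρ : IsLPCutoff ρ) {s r : ℝ} (hs : 0 < s) (hsr : s ≤ r)
    (hr : r ≤ 1) : ∃ C : ℝ, 0 < C ∧ ∀ (D : ℕ) (φp φm : ℝ → Fin D → ℝ), CbSmooth φp → CbSmooth φm →
      ∀ b₁ b₂ : Bool, ∀ m n : Fin D, ∀ kM kN : ℕ,
        hNorm ρ (r - 1) (fun x =>
              LP ρ kM (fun y => (if b₁ then φp else φm) y m) x *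
                deriv (LP ρ kN (fun y => (if b₂ then φp else φm) y n)) x) ≤
          ENNReal.ofReal C * ENNReal.ofReal (W s r kM kN) * dsNorm ρ s φp φm ^ 2 := by
  obtain ⟨C, hC, hmain⟩ := main_real hρ hs hsr hr
  refine ⟨C, hC, ?_⟩
  intro D φp φm hp hm b₁ b₂ m n kM kN
  have hWpos := W_pos s r kM kN
  by_cases hA : dsNorm ρ s φp φm = ∞
  · rw [hA, ← ENNReal.ofReal_mul hC.le, ENNReal.top_pow (by norm_num), ENNReal.mul_top]
    · exact le_top
    · simp only [ne_eq, ENNReal.ofReal_eq_zero, not_le]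
      positivity
  have a1 := ds_a ρ s φp φm b₁ m
  have a2 := ds_a ρ s φp φm b₂ n
  have hb := ds_b ρ s φp φm b₁ b₂ m n kM kN
  obtain ⟨a, ha, hae⟩ : ∃ a : ℝ, 0 ≤ a ∧ dsNorm ρ s φp φm = ENNReal.ofReal a :=
    ⟨_, ENNReal.toReal_nonneg, (ENNReal.ofReal_toReal hA).symm⟩
  rw [hae] at a1 a2 hb ⊢
  have s1 : CbSmooth (if b₁ then φp else φm) := by split_ifs <;> assumption
  have s2 : CbSmooth (if b₂ then φp else φm) := by split_ifs <;> assumption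
  obtain ⟨f', B₀, B₀', df, -, bf, -⟩ := comp_data s1 m
  obtain ⟨g', B₁, B₂, dg, cg', bg, bg'⟩ := comp_data s2 n
  have cf : Continuous (fun y => (if b₁ then φp else φm) y m) :=
    continuous_iff_continuousAt.2 fun x => (df x).continuousAt
  have hder : deriv (LP ρ kN (fun y => (if b₂ then φp else φm) y n)) = LP ρ kN g' := by
    funext x
    exact (cv_hasDeriv (inv_integrable (lpSymbol_sym hρ kN)) dg cg' bg bg' x).deriv
  rw [hder] at hb ⊢
  rw [hNorm_real ha] at a1 a2
  rw [← ENNReal.ofReal_pow ha, ← ENNReal.ofReal_mul hC.le, ← ENNReal.ofReal_mul (by positivity),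
    hNorm_real (by positivity)]
  refine hmain _ _ g' a B₀ B₁ B₂ kM kN ha cf bf dg cg' bg bg' a1 a2 ?_
  intro hcl K x
  have h1 := hb hcl
  rw [← ENNReal.ofReal_pow ha] at h1
  have h2 : ENNReal.ofReal (((2 : ℝ) ^ kM) ^ s) * (ENNReal.ofReal (((2 : ℝ) ^ K) ^ (s - 1)) *
      ENNReal.ofReal |LP ρ K (fun t => LP ρ kM (fun y => (if b₁ then φp else φm) y m) t *
        LP ρ kN g' t) x|) ≤ ENNReal.ofReal (a ^ 2) := by
    refine le_trans (mul_le_mul_right ?_ _) h1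
    unfold hNorm
    refine le_iSup_of_le K (mul_le_mul_right ?_ _)
    exact le_iSup (fun x => ENNReal.ofReal |LP ρ K (fun t => LP ρ kM (fun y => (if b₁ then φp else φm) y m) t *
        LP ρ kN g' t) x|) x
  rwa [← ENNReal.ofReal_mul (by positivity), ← ENNReal.ofReal_mul (by positivity),
    ENNReal.ofReal_le_ofReal_iff (by positivity)] at h2

end EDB

/-- **Lemma 3.4: bilinear bounds encoded by the enhanced data norm.**
For `0 < s ≤ r ≤ 1` and all signs, components and dyadic scales `M, N`,
`‖P_M φ^{±₁,m} (P_N φ^{±₂,n})′‖_{C^{r−1}}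
  ≲ (1{M ≲ N} M^{−s} N^{r−s} + 1{M ≫ N} M^{r−1−s} N^{1−s}) ‖(φ⁺,φ⁻)‖_{𝔇ˢ}²
  ≲ M^{−s} N^{r−s} ‖(φ⁺,φ⁻)‖_{𝔇ˢ}²`. -/
theorem enhanced_data_bilinear_bound
    (ρ : ℝ → ℝ) (hρ : IsLPCutoff ρ)
    (D : ℕ) (hD : 1 ≤ D)
    (s r : ℝ) (hs : 0 < s) (hsr : s ≤ r) (hr : r ≤ 1) :
    ∃ C : ℝ≥0∞, C ≠ ∞ ∧
      ∀ φp φm : ℝ → Fin D → ℝ, CbSmooth φp → CbSmooth φm →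
      ∀ b₁ b₂ : Bool, ∀ m n : Fin D, ∀ kM kN : ℕ,
        (hNorm ρ (r - 1) (fun x =>
              LP ρ kM (fun y => (if b₁ then φp else φm) y m) x *
                deriv (LP ρ kN (fun y => (if b₂ then φp else φm) y n)) x) ≤
          C * ENNReal.ofReal
              ((if (2 : ℝ) ^ kM ≤ 2 ^ 10 * (2 : ℝ) ^ kN then (1 : ℝ) else 0) *
                  (((2 : ℝ) ^ kM) ^ (-s) * ((2 : ℝ) ^ kN) ^ (r - s)) +
                (if 2 ^ 10 * (2 : ℝ) ^ kN < (2 : ℝ) ^ kM then (1 : ℝ) else 0) *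
                  (((2 : ℝ) ^ kM) ^ (r - 1 - s) * ((2 : ℝ) ^ kN) ^ (1 - s))) *
            dsNorm ρ s φp φm ^ 2) ∧
        (hNorm ρ (r - 1) (fun x =>
              LP ρ kM (fun y => (if b₁ then φp else φm) y m) x *
                deriv (LP ρ kN (fun y => (if b₂ then φp else φm) y n)) x) ≤
          C * ENNReal.ofReal (((2 : ℝ) ^ kM) ^ (-s) * ((2 : ℝ) ^ kN) ^ (r - s)) *
            dsNorm ρ s φp φm ^ 2) := by
  obtain ⟨C, hC, hmain⟩ := EDB.main_ennreal hρ hs hsr hr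
  refine ⟨ENNReal.ofReal C, ENNReal.ofReal_ne_top, ?_⟩
  intro φp φm hp hm b₁ b₂ m n kM kN
  have h := hmain D φp φm hp hm b₁ b₂ m n kM kN
  refine ⟨h, h.trans ?_⟩
  gcongr
  exact EDB.W_le hr kM kN
end
end
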